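/- Let q be a prime power and let G be a minimal irreducible ESQ-subgroup of GL₅(F_q) (G acts irreducibly on (F_q)⁵, which is an ESQ module for G, and every proper subgroup of G acts reducibly). Then exactly one of the following holds: (a) G is not absolutely irreducible, G is cyclic of order 11 and ord₁₁(q) = 5; or (b) G is absolutely irreducible of order 55 (a non-abelian group of order 55) and q ≡ 1 (mod 11). In particular no non-abelian simple group arises, and 11 divides |G|. Moreover both possibilities occur: for every prime power q with ord₁₁(q) = 5 there is an irreducible ESQ-subgroup of GL₅(F_q) of order 11, and for every q ≡ 1 (mod 11) there is one of order 55. -/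

import Mathlib

open TensorProduct

section ExteriorSquare

variable (F : Type*) [Field F] (V : Type*) [AddCommGroup V] [Module F V]

/-- The submodule of `V ⊗ V` spanned by the squares `v ⊗ v`. -/
def sqSub : Submodule F (V ⊗[F] V) :=
  Submodule.span F {x : V ⊗[F] V | ∃ v : V, x = v ⊗ₜ[F] v}

/-- The exterior square `Λ²V`, realised as `V ⊗ V` modulo the squares. -/
abbrev Wedge2 := (V ⊗[F] V) ⧸ sqSub F V

variable {F V}

/-- The map `Λ²g = g ∧ g` induced on the exterior square by `g : V → V`. -/
noncomputable def wedge2Map (g : V →ₗ[F] V) : Wedge2 F V →ₗ[F] Wedge2 F V :=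
  Submodule.mapQ _ _ (TensorProduct.map g g) (by
    rw [← Submodule.map_le_iff_le_comap, sqSub, Submodule.map_span]
    refine Submodule.span_le.2 ?_
    rintro _ ⟨_, ⟨v, rfl⟩, rfl⟩
    exact Submodule.subset_span ⟨g v, by simp⟩)

end ExteriorSquare

section LinearGroups

variable {n : ℕ} {F : Type*} [Field F]

/-- The natural action of `g ∈ GL_n(F)` on row vectors. -/
def natAct (g : GL (Fin n) F) : (Fin n → F) →ₗ[F] (Fin n → F) :=
  Matrix.vecMulLinear (g : Matrix (Fin n) (Fin n) F)

/-- `G ≤ GL_n(F)` acts irreducibly on the natural module `F^n`. -/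
def IsIrred (G : Subgroup (GL (Fin n) F)) : Prop :=
  ∀ S : Submodule F (Fin n → F),
    (∀ g ∈ G, Submodule.map (natAct g) S = S) → S = ⊥ ∨ S = ⊤

/-- The natural module `F^n` is an exterior self-quotient (ESQ) module for
`G ≤ GL_n(F)`: there is a `G`-invariant submodule `U ≤ Λ²(F^n)` and a
`G`-equivariant isomorphism `Λ²(F^n)/U ≃ F^n`. -/
def IsESQ (G : Subgroup (GL (Fin n) F)) : Prop :=
  ∃ (U : Submodule F (Wedge2 F (Fin n → F)))
    (e : ((Wedge2 F (Fin n → F)) ⧸ U) ≃ₗ[F] (Fin n → F)),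
    (∀ g ∈ G, Submodule.map (wedge2Map (natAct g)) U ≤ U) ∧
    ∀ g ∈ G, ∀ w : Wedge2 F (Fin n → F),
      e (Submodule.Quotient.mk (wedge2Map (natAct g) w)) =
        natAct g (e (Submodule.Quotient.mk w))

/-- `G ≤ GL_n(F)` is absolutely irreducible: it remains irreducible over the
algebraic closure of `F`. -/
def IsAbsIrred (G : Subgroup (GL (Fin n) F)) : Prop :=
  ∀ S : Submodule (AlgebraicClosure F) (Fin n → AlgebraicClosure F),
    (∀ g ∈ G, Submodule.map
        (Matrix.vecMulLinear
          ((g : Matrix (Fin n) (Fin n) F).map (algebraMap F (AlgebraicClosure F)))) S = S) →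
      S = ⊥ ∨ S = ⊤

/-- `G` is a minimal irreducible ESQ-subgroup of `GL_n(F)`: it is irreducible,
the natural module is ESQ for `G`, and every proper subgroup acts reducibly. -/
def IsMinIrredESQ (G : Subgroup (GL (Fin n) F)) : Prop :=
  IsIrred G ∧ IsESQ G ∧
    ∀ H : Subgroup (GL (Fin n) F), H < G → ¬ IsIrred H

end LinearGroups

open Module

section AlgebraOnModule

variable {k V : Type*} [Field k] [AddCommGroup V] [Module k V]

theorem exists_dual_family {ι : Type*} [FiniteDimensional k V] [DecidableEq ι]
    {a : ι → Dual k V} (ha : LinearIndependent k a) :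
    ∃ v : ι → V, ∀ i j, a i (v j) = if i = j then 1 else 0 := by
  have key : ∀ j, ∃ x : V, ∀ i, a i x = if i = j then 1 else 0 := by
    intro j
    let f := (Basis.span ha).constr k (fun i => if i = j then (1 : k) else 0)
    obtain ⟨F, hF⟩ := LinearMap.exists_extend f
    refine ⟨(evalEquiv k V).symm F, fun i => ?_⟩
    rw [apply_evalEquiv_symm_apply]
    have h1 := LinearMap.congr_fun hF (Basis.span ha i)
    have h2 : f (Basis.span ha i) = if i = j then 1 else 0 := by
      exact (Basis.span ha).constr_basis k _ i
    rw [h2] at h1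
    rw [← h1]
    simp [Basis.span_apply]
  choose v hv using key
  exact ⟨v, fun i j => hv j i⟩

theorem eq_sum_of_dual_basis [FiniteDimensional k V] {n : ℕ} {a : Fin n → Dual k V}
    (hn : finrank k V = n) {v : Fin n → V} (h : ∀ i j, a i (v j) = if i = j then 1 else 0) (x : V) :
    x = ∑ i, a i x • v i := by
  have hli : LinearIndependent k v := by
    rw [Fintype.linearIndependent_iff]
    intro c hc i
    have := congrArg (a i) hc
    simpa [h] using this
  let b := basisOfLinearIndependentOfCardEqFinrank' v hli (by rw [hn, Fintype.card_fin])
  have hb : ∀ i, b i = v i := fun i => by simp [b]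
  have hx := b.sum_repr x
  have hr : ∀ i, a i x = b.repr x i := by
    intro i
    conv_lhs => rw [← hx]
    simp [hb, h]
  simp_rw [hr, ← hb]
  exact hx.symm

/-- `m` is a nonzero alternating product on a five-dimensional space `V`, and `ρ` an irreducible
action of `G` on `V` by automorphisms of this product. -/
structure IsIrredAlt {G : Type*} [Group G] (ρ : G →* (V ≃ₗ[k] V))
    (m : V →ₗ[k] V →ₗ[k] V) : Prop where
  finrank_eq : finrank k V = 5
  alt : ∀ x, m x x = 0
  ne_zero : ∃ x y, m x y ≠ 0
  map_mul : ∀ g x y, ρ g (m x y) = m (ρ g x) (ρ g y)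
  irred : ∀ S : Submodule k V, (∀ g, ∀ x ∈ S, ρ g x ∈ S) → S = ⊥ ∨ S = ⊤

/-- `ξ ∘ m = a ∧ b`. -/
def IsWedge (m : V →ₗ[k] V →ₗ[k] V) (ξ a b : Dual k V) : Prop :=
  ∀ x y, ξ (m x y) = a x * b y - a y * b x

/-- The functionals `ξ` for which `ξ ∘ m` vanishes on `ker a`. -/
def divisibleBy (m : V →ₗ[k] V →ₗ[k] V) (a : Dual k V) : Submodule k (Dual k V) where
  carrier := {ξ | ∀ x y, a x = 0 → a y = 0 → ξ (m x y) = 0}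
  add_mem' := by
    intro ξ η h1 h2 x y hx hy
    simp [h1 x y hx hy, h2 x y hx hy]
  zero_mem' := by intro x y _ _; simp
  smul_mem' := by
    intro c ξ h x y hx hy
    simp [h x y hx hy]

/-- A center: a nonzero functional `a` such that at least two independent
`ξ ∘ m` are divisible by `a`. -/
def IsCenter (m : V →ₗ[k] V →ₗ[k] V) (a : Dual k V) : Prop :=
  a ≠ 0 ∧ 2 ≤ finrank k (divisibleBy m a)

variable {m : V →ₗ[k] V →ₗ[k] V}

theorem mem_divisibleBy {a ξ : Dual k V} :
    ξ ∈ divisibleBy m a ↔ ∀ x y, a x = 0 → a y = 0 → ξ (m x y) = 0 := Iff.rfl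

theorem IsWedge.symm {ξ a b : Dual k V} (h : IsWedge m ξ a b) : IsWedge m (-ξ) b a := by
  intro x y
  rw [LinearMap.neg_apply, h x y]
  ring

theorem IsWedge.mem_left {ξ a b : Dual k V} (h : IsWedge m ξ a b) : ξ ∈ divisibleBy m a := by
  intro x y hx hy
  rw [h x y, hx, hy]
  ring

theorem IsWedge.mem_right {ξ a b : Dual k V} (h : IsWedge m ξ a b) : ξ ∈ divisibleBy m b := by
  intro x y hx hy
  rw [h x y, hx, hy]
  ring

theorem anticomm_of_alt (alt : ∀ x, m x x = 0) (x y : V) : m x y = - m y x := by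
  have := alt (x + y)
  simp only [map_add, LinearMap.add_apply, alt, zero_add, add_zero] at this
  exact eq_neg_of_add_eq_zero_right this

theorem exists_isWedge (alt : ∀ x, m x x = 0) {a ξ : Dual k V} (ha : a ≠ 0)
    (h : ξ ∈ divisibleBy m a) : ∃ b, IsWedge m ξ a b := by
  obtain ⟨x, hx⟩ : ∃ x, a x ≠ 0 := by
    by_contra! hcon
    exact ha (LinearMap.ext hcon)
  obtain ⟨u, hu⟩ : ∃ u, a u = 1 := ⟨(a x)⁻¹ • x, by simp [hx]⟩
  refine ⟨ξ ∘ₗ m u, fun y z => ?_⟩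
  have h1 := h (y - a y • u) (z - a z • u) (by simp [hu]) (by simp [hu])
  simp only [map_sub, map_smul, LinearMap.sub_apply, LinearMap.smul_apply, alt, smul_zero,
    smul_eq_mul, sub_zero] at h1
  rw [anticomm_of_alt alt y u] at h1
  simp only [map_neg, LinearMap.comp_apply] at h1 ⊢
  linear_combination h1

theorem isWedge_of_mem_of_mem [FiniteDimensional k V] (alt : ∀ x, m x x = 0) {a b ξ : Dual k V}
    (hab : LinearIndependent k ![a, b]) (h1 : ξ ∈ divisibleBy m a) (h2 : ξ ∈ divisibleBy m b) :
    ∃ c : k, ∀ x y, ξ (m x y) = c * (a x * b y - a y * b x) := by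
  obtain ⟨v, hv⟩ := exists_dual_family hab
  have e00 : a (v 0) = 1 := by simpa using hv 0 0
  have e01 : a (v 1) = 0 := by simpa using hv 0 1
  have e10 : b (v 0) = 0 := by simpa using hv 1 0
  have e11 : b (v 1) = 1 := by simpa using hv 1 1
  have A := anticomm_of_alt alt
  refine ⟨ξ (m (v 0) (v 1)), fun x y => ?_⟩
  have q1 := h1 (x - a x • v 0 - b x • v 1) (y - a y • v 0 - b y • v 1)
    (by simp [e00, e01]) (by simp [e00, e01])
  have q2 := h1 (x - a x • v 0 - b x • v 1) (v 1)
    (by simp [e00, e01]) (by simp [e01])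
  have q3 := h1 (y - a y • v 0 - b y • v 1) (v 1)
    (by simp [e00, e01]) (by simp [e01])
  have q4 := h2 (x - a x • v 0 - b x • v 1) (v 0)
    (by simp [e10, e11]) (by simp [e10])
  have q5 := h2 (y - a y • v 0 - b y • v 1) (v 0)
    (by simp [e10, e11]) (by simp [e10])
  simp only [map_sub, map_smul, LinearMap.sub_apply, LinearMap.smul_apply, alt, smul_zero,
    smul_eq_mul, sub_zero, A y (v 0), A y (v 1), A x (v 0), A x (v 1), A (v 1) (v 0),
    map_neg, smul_neg] at q1 q2 q3 q4 q5 ⊢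
  linear_combination q1 + a y * q4 + b y * q2 - a x * q5 - b x * q3

namespace IsIrredAlt

variable {G : Type*} [Group G] {ρ : G →* (V ≃ₗ[k] V)} (H : IsIrredAlt ρ m)

include H

theorem finiteDimensional : FiniteDimensional k V :=
  FiniteDimensional.of_finrank_pos (by rw [H.finrank_eq]; norm_num)

theorem anticomm (x y : V) : m x y = - m y x := anticomm_of_alt H.alt x y

theorem span_eq_top : Submodule.span k {z | ∃ x y, z = m x y} = ⊤ := by
  refine (H.irred _ ?_).resolve_left ?_
  · intro g x hx
    induction hx using Submodule.span_induction with
    | mem z hz =>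
      obtain ⟨x, y, rfl⟩ := hz
      exact Submodule.subset_span ⟨ρ g x, ρ g y, H.map_mul g x y⟩
    | zero => simp
    | add x y _ _ hx hy => rw [map_add]; exact add_mem hx hy
    | smul c x _ hx => rw [map_smul]; exact Submodule.smul_mem _ _ hx
  · intro h
    obtain ⟨x, y, hxy⟩ := H.ne_zero
    rw [Submodule.span_eq_bot] at h
    exact hxy (h _ ⟨x, y, rfl⟩)

theorem eq_top_of_forall_mem {Z : Submodule k V} (h : ∀ x y, m x y ∈ Z) : Z = ⊤ := by
  rw [eq_top_iff, ← H.span_eq_top, Submodule.span_le]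
  rintro _ ⟨x, y, rfl⟩
  exact h x y

theorem dual_eq_zero {ξ : Dual k V} (h : ∀ x y, ξ (m x y) = 0) : ξ = 0 := by
  have := H.eq_top_of_forall_mem (Z := LinearMap.ker ξ) h
  exact LinearMap.ker_eq_top.1 this

theorem eq_zero_of_mul {x : V} (h : ∀ y, m x y = 0) : x = 0 := by
  have key : LinearMap.ker m = ⊥ := by
    refine (H.irred _ ?_).resolve_right ?_
    · intro g x hx
      rw [LinearMap.mem_ker] at hx ⊢
      ext y
      have := H.map_mul g x ((ρ g).symm y)
      rw [LinearEquiv.apply_symm_apply] at this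
      simp [← this, hx]
    · intro h
      obtain ⟨x, y, hxy⟩ := H.ne_zero
      apply hxy
      rw [LinearMap.ker_eq_top.1 h]
      rfl
  have : x ∈ LinearMap.ker m := LinearMap.mem_ker.2 (LinearMap.ext h)
  rwa [key, Submodule.mem_bot] at this

theorem exists_apply_ne_zero {a : Dual k V} {x : V} (ha : a ≠ 0) (hx : x ≠ 0) :
    ∃ g, a (ρ g x) ≠ 0 := by
  by_contra! hcon
  let S : Submodule k V := ⨅ g, LinearMap.ker (a ∘ₗ (ρ g : V →ₗ[k] V))
  have hS : ∀ z, z ∈ S ↔ ∀ g, a (ρ g z) = 0 := by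
    intro z
    simp [S]
  have hxS : x ∈ S := (hS x).2 hcon
  rcases H.irred S (fun g z hz => (hS _).2 fun g' => by
    have := (hS z).1 hz (g' * g)
    simpa using this) with h | h
  · rw [h, Submodule.mem_bot] at hxS
    exact hx hxS
  · apply ha
    ext z
    have : z ∈ S := h ▸ Submodule.mem_top
    simpa using (hS z).1 this 1

/-- The translate of a functional by a group element. -/
theorem span_orbit {a : Dual k V} (ha : a ≠ 0) :
    Submodule.span k (Set.range fun g => a ∘ₗ (ρ g : V →ₗ[k] V)) = ⊤ := by
  have := H.finiteDimensional
  set W := Submodule.span k (Set.range fun g => a ∘ₗ (ρ g : V →ₗ[k] V)) with hW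
  have h1 : W.dualCoannihilator = ⊥ := by
    rw [eq_bot_iff]
    intro x hx
    by_contra hx0
    obtain ⟨g, hg⟩ := H.exists_apply_ne_zero ha hx0
    rw [Submodule.mem_dualCoannihilator] at hx
    exact hg (hx _ (Submodule.subset_span ⟨g, rfl⟩))
  have h2 := Subspace.dualCoannihilator_dualAnnihilator_eq (W := W)
  rw [h1] at h2
  simpa using h2.symm

theorem isWedge_translate {ξ a b : Dual k V} (h : IsWedge m ξ a b) (g : G) :
    IsWedge m (ξ ∘ₗ (ρ g : V →ₗ[k] V)) (a ∘ₗ (ρ g : V →ₗ[k] V)) (b ∘ₗ (ρ g : V →ₗ[k] V)) := by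
  intro x y
  simp [H.map_mul, h (ρ g x) (ρ g y)]

theorem translate_mem {ξ a : Dual k V} (h : ξ ∈ divisibleBy m a) (g : G) :
    ξ ∘ₗ (ρ g : V →ₗ[k] V) ∈ divisibleBy m (a ∘ₗ (ρ g : V →ₗ[k] V)) := by
  intro x y hx hy
  simpa [H.map_mul] using h (ρ g x) (ρ g y) hx hy

theorem finrank_le_translate (a : Dual k V) (g : G) :
    finrank k (divisibleBy m a) ≤ finrank k (divisibleBy m (a ∘ₗ (ρ g : V →ₗ[k] V))) := by
  have := H.finiteDimensional
  let f : Dual k V →ₗ[k] Dual k V := Dual.transpose (R := k) (ρ g : V →ₗ[k] V)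
  have hf : Function.Injective f := by
    intro ξ η h
    ext x
    have := LinearMap.congr_fun h ((ρ g).symm x)
    simpa [f, Dual.transpose_apply] using this
  refine LinearMap.finrank_le_finrank_of_injective
    (f := f.restrict (p := divisibleBy m a) (q := divisibleBy m (a ∘ₗ (ρ g : V →ₗ[k] V)))
      (fun ξ hξ => H.translate_mem hξ g)) ?_
  intro x y hxy
  apply Subtype.ext
  apply hf
  exact congrArg Subtype.val hxy

theorem translate_ne_zero {a : Dual k V} (ha : a ≠ 0) (g : G) :
    a ∘ₗ (ρ g : V →ₗ[k] V) ≠ 0 := by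
  intro h
  apply ha
  ext x
  simpa using LinearMap.congr_fun h ((ρ g).symm x)

theorem isCenter_translate {a : Dual k V} (ha : IsCenter m a) (g : G) :
    IsCenter m (a ∘ₗ (ρ g : V →ₗ[k] V)) :=
  ⟨H.translate_ne_zero ha.1 g, ha.2.trans (H.finrank_le_translate a g)⟩

theorem exists_finrank_sup_span {p : Submodule k V} (hp : finrank k p < 5) :
    ∃ v, v ∉ p ∧ finrank k (p ⊔ Submodule.span k {v} : Submodule k V) = finrank k p + 1 := by
  have := H.finiteDimensional
  have hne : p ≠ ⊤ := by
    rintro rfl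
    rw [finrank_top, H.finrank_eq] at hp
    omega
  obtain ⟨v, -, hv⟩ := SetLike.exists_of_lt (lt_top_iff_ne_top.2 hne)
  exact ⟨v, hv, Submodule.finrank_sup_span_singleton hv⟩

theorem eq_top_of_finrank {p : Submodule k V} (hp : 5 ≤ finrank k p) : p = ⊤ := by
  have := H.finiteDimensional
  apply Submodule.eq_top_of_finrank_eq
  have := p.finrank_le
  rw [H.finrank_eq] at *
  omega

theorem map_translate {X Y : Submodule k V} (h : ∀ x ∈ X, ∀ v, m x v ∈ Y) (g : G) :
    ∀ x ∈ X.map (ρ g : V →ₗ[k] V), ∀ v, m x v ∈ Y.map (ρ g : V →ₗ[k] V) := by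
  rintro _ ⟨x, hx, rfl⟩ v
  refine ⟨m x ((ρ g).symm v), h x hx _, ?_⟩
  simp [H.map_mul]

theorem false_of_finrank_eq_two {X Y : Submodule k V} (hX : finrank k X = 2)
    (hY : finrank k Y ≤ 2) (h : ∀ x ∈ X, ∀ v, m x v ∈ Y) : False := by
  have := H.finiteDimensional
  obtain ⟨g, x₀, hx₀, hgx₀⟩ : ∃ g, ∃ x ∈ X, ρ g x ∉ X := by
    by_contra! hcon
    rcases H.irred X hcon with rfl | rfl
    · simp at hX
    · rw [finrank_top, H.finrank_eq] at hX
      omega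
  set X' := X.map (ρ g : V →ₗ[k] V) with hX'
  set Y' := Y.map (ρ g : V →ₗ[k] V) with hY'
  have h' : ∀ x ∈ X', ∀ v, m x v ∈ Y' := H.map_translate h g
  have hx₁ : ρ g x₀ ∈ X' := ⟨x₀, hx₀, rfl⟩
  set x₁ := ρ g x₀
  have dY' : finrank k Y' ≤ 2 := (Submodule.finrank_map_le _ _).trans hY
  have dX' : finrank k X' = 2 := by
    rw [← hX]
    exact LinearEquiv.finrank_map_eq (ρ g) X
  have dsup := Submodule.finrank_sup_add_finrank_inf_eq Y Y'
  have step1 : Y ⊓ Y' = ⊥ := by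
    have d3 := Submodule.finrank_sup_span_singleton (K := k) hgx₀
    set S := X ⊔ Submodule.span k {x₁} with hS
    have hSm : ∀ u ∈ S, ∀ v, m u v ∈ Y ⊔ Y' := by
      intro u hu v
      obtain ⟨x, hx, y, hy, rfl⟩ := Submodule.mem_sup.1 hu
      obtain ⟨c, rfl⟩ := Submodule.mem_span_singleton.1 hy
      simp only [map_add, map_smul, LinearMap.add_apply, LinearMap.smul_apply]
      exact Submodule.add_mem_sup (h x hx v) (Submodule.smul_mem _ _ (h' _ hx₁ v))
    obtain ⟨v₁, -, d4⟩ := H.exists_finrank_sup_span (p := S) (by omega)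
    obtain ⟨v₂, -, d5⟩ := H.exists_finrank_sup_span (p := S ⊔ Submodule.span k {v₁}) (by omega)
    have htop := H.eq_top_of_finrank (p := S ⊔ Submodule.span k {v₁} ⊔ Submodule.span k {v₂})
      (by omega)
    have hdec : ∀ w, ∃ s ∈ S, ∃ c d : k, w = s + c • v₁ + d • v₂ := by
      intro w
      have hw : w ∈ S ⊔ Submodule.span k {v₁} ⊔ Submodule.span k {v₂} :=
        htop ▸ Submodule.mem_top
      obtain ⟨u, hu, y, hy, rfl⟩ := Submodule.mem_sup.1 hw
      obtain ⟨s, hs, z, hz, rfl⟩ := Submodule.mem_sup.1 hu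
      obtain ⟨c, rfl⟩ := Submodule.mem_span_singleton.1 hz
      obtain ⟨d, rfl⟩ := Submodule.mem_span_singleton.1 hy
      exact ⟨s, hs, c, d, rfl⟩
    have hZ := H.eq_top_of_forall_mem (Z := Y ⊔ Y' ⊔ Submodule.span k {m v₁ v₂}) (by
      intro w w'
      obtain ⟨s, hs, c, d, rfl⟩ := hdec w
      obtain ⟨s', hs', c', d', rfl⟩ := hdec w'
      have e : m (s + c • v₁ + d • v₂) (s' + c' • v₁ + d' • v₂) =
          (m s (s' + c' • v₁ + d' • v₂) - m s' (c • v₁ + d • v₂)) +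
            (c * d' - d * c') • m v₁ v₂ := by
        rw [H.anticomm s' (c • v₁ + d • v₂)]
        simp only [map_add, map_smul, LinearMap.add_apply, LinearMap.smul_apply, H.alt,
          H.anticomm v₂ v₁]
        module
      rw [e]
      exact Submodule.add_mem_sup (sub_mem (hSm s hs _) (hSm s' hs' _))
        (Submodule.smul_mem _ _ (Submodule.mem_span_singleton_self _)))
    have d1 := Submodule.finrank_add_le_finrank_add_finrank (Y ⊔ Y')
      (Submodule.span k {m v₁ v₂})
    have d2 := finrank_span_le_card (R := k) ({m v₁ v₂} : Set V)
    rw [hZ, finrank_top, H.finrank_eq] at d1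
    simp only [Set.toFinset_singleton, Finset.card_singleton] at d2
    exact Submodule.finrank_eq_zero.1 (by omega)
  have step2 : X ⊓ X' = ⊥ := by
    rw [eq_bot_iff]
    rintro x ⟨hx, hx'⟩
    rw [Submodule.mem_bot]
    apply H.eq_zero_of_mul
    intro v
    have : m x v ∈ Y ⊓ Y' := ⟨h x hx v, h' x hx' v⟩
    rwa [step1, Submodule.mem_bot] at this
  have dX := Submodule.finrank_sup_add_finrank_inf_eq X X'
  rw [step2, finrank_bot] at dX
  obtain ⟨v, -, d5⟩ := H.exists_finrank_sup_span (p := X ⊔ X') (by omega)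
  have htop := H.eq_top_of_finrank (p := X ⊔ X' ⊔ Submodule.span k {v}) (by omega)
  have hXm : ∀ u ∈ X ⊔ X', ∀ v, m u v ∈ Y ⊔ Y' := by
    intro u hu v
    obtain ⟨x, hx, y, hy, rfl⟩ := Submodule.mem_sup.1 hu
    simp only [map_add, LinearMap.add_apply]
    exact Submodule.add_mem_sup (h x hx v) (h' _ hy v)
  have hdec : ∀ w, ∃ s ∈ X ⊔ X', ∃ c : k, w = s + c • v := by
    intro w
    have hw : w ∈ X ⊔ X' ⊔ Submodule.span k {v} := htop ▸ Submodule.mem_top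
    obtain ⟨s, hs, z, hz, rfl⟩ := Submodule.mem_sup.1 hw
    obtain ⟨c, rfl⟩ := Submodule.mem_span_singleton.1 hz
    exact ⟨s, hs, c, rfl⟩
  have hZ := H.eq_top_of_forall_mem (Z := Y ⊔ Y') (by
    intro w w'
    obtain ⟨s, hs, c, rfl⟩ := hdec w
    obtain ⟨s', hs', c', rfl⟩ := hdec w'
    have e : m (s + c • v) (s' + c' • v) = m s (s' + c' • v) - m s' (c • v) := by
      rw [H.anticomm s' (c • v)]
      simp only [map_add, map_smul, LinearMap.add_apply, LinearMap.smul_apply, H.alt]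
      module
    rw [e]
    exact sub_mem (hXm s hs _) (hXm s' hs' _))
  rw [hZ, finrank_top, H.finrank_eq] at dsup
  omega

theorem false_of_mul_mem_span {x y : V} (hx : x ≠ 0)
    (h : ∀ v, m x v ∈ Submodule.span k {y}) : False := by
  have := H.finiteDimensional
  have hy : y ≠ 0 := by
    rintro rfl
    exact hx (H.eq_zero_of_mul fun v => by simpa using h v)
  obtain ⟨g, hg⟩ : ∃ g, ρ g y ∉ Submodule.span k {y} := by
    by_contra! hcon
    have d := finrank_span_singleton (K := k) hy
    rcases H.irred (Submodule.span k {y}) (fun g z hz => by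
      obtain ⟨c, rfl⟩ := Submodule.mem_span_singleton.1 hz
      rw [map_smul]
      exact Submodule.smul_mem _ _ (hcon g)) with e | e
    · rw [e, finrank_bot] at d
      omega
    · rw [e, finrank_top, H.finrank_eq] at d
      omega
  have h' : ∀ v, m (ρ g x) v ∈ Submodule.span k {ρ g y} := by
    intro v
    obtain ⟨c, hc⟩ := Submodule.mem_span_singleton.1 (h ((ρ g).symm v))
    refine Submodule.mem_span_singleton.2 ⟨c, ?_⟩
    rw [← map_smul, hc, H.map_mul, LinearEquiv.apply_symm_apply]
  have dy := Submodule.finrank_sup_span_singleton (K := k) hg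
  rw [finrank_span_singleton hy] at dy
  by_cases hgx : ρ g x ∈ Submodule.span k {x}
  · obtain ⟨c, hc⟩ := Submodule.mem_span_singleton.1 hgx
    have hc0 : c ≠ 0 := by
      rintro rfl
      rw [zero_smul] at hc
      exact hx ((ρ g).map_eq_zero_iff.1 hc.symm)
    apply hx
    apply H.eq_zero_of_mul
    intro v
    obtain ⟨d, hd⟩ := Submodule.mem_span_singleton.1 (h' v)
    rw [← hc, map_smul, LinearMap.smul_apply] at hd
    obtain ⟨e, he⟩ := Submodule.mem_span_singleton.1 (h v)
    by_cases hd0 : d = 0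
    · rw [hd0, zero_smul] at hd
      exact (smul_eq_zero.1 hd.symm).resolve_left hc0
    · exfalso
      apply hg
      refine Submodule.mem_span_singleton.2 ⟨d⁻¹ * c * e, ?_⟩
      rw [mul_smul, he, mul_smul, ← hd, smul_smul, inv_mul_cancel₀ hd0, one_smul]
  · have dx := Submodule.finrank_sup_span_singleton (K := k) hgx
    rw [finrank_span_singleton hx] at dx
    refine H.false_of_finrank_eq_two dx dy.le ?_
    intro z hz v
    obtain ⟨p, hp, q, hq, rfl⟩ := Submodule.mem_sup.1 hz
    obtain ⟨c, rfl⟩ := Submodule.mem_span_singleton.1 hp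
    obtain ⟨d, rfl⟩ := Submodule.mem_span_singleton.1 hq
    simp only [map_add, map_smul, LinearMap.add_apply, LinearMap.smul_apply]
    exact Submodule.add_mem_sup (Submodule.smul_mem _ _ (h v)) (Submodule.smul_mem _ _ (h' v))
end IsIrredAlt
end AlgebraOnModule

section AlgebraOnModule
variable {k V : Type*} [Field k] [AddCommGroup V] [Module k V]
variable {m : V →ₗ[k] V →ₗ[k] V}
theorem IsWedge.smul_smul {ξ a b : Dual k V} (h : IsWedge m ξ a b) (s t : k) :
    IsWedge m ((s * t) • ξ) (s • a) (t • b) := by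
  intro x y
  simp only [LinearMap.smul_apply, h x y, smul_eq_mul]
  ring

theorem divisibleBy_smul {a : Dual k V} {t : k} (ht : t ≠ 0) :
    divisibleBy m (t • a) = divisibleBy m a := by
  ext ξ
  simp [mem_divisibleBy, ht]

theorem IsCenter.smul {a : Dual k V} (ha : IsCenter m a) {t : k} (ht : t ≠ 0) :
    IsCenter m (t • a) :=
  ⟨smul_ne_zero ht ha.1, by rw [divisibleBy_smul ht]; exact ha.2⟩

theorem exists_dual_pair [FiniteDimensional k V] {a b : Dual k V}
    (h : LinearIndependent k ![a, b]) :
    ∃ u v, a u = 1 ∧ a v = 0 ∧ b u = 0 ∧ b v = 1 := by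
  obtain ⟨v, hv⟩ := exists_dual_family h
  exact ⟨v 0, v 1, by simpa using hv 0 0, by simpa using hv 0 1, by simpa using hv 1 0,
    by simpa using hv 1 1⟩

theorem two_le_finrank_of_pair {W : Type*} [AddCommGroup W] [Module k W] [FiniteDimensional k W]
    {S : Submodule k W} {x y : W}
    (hx : x ∈ S) (hy : y ∈ S) (h : LinearIndependent k ![x, y]) : 2 ≤ finrank k S := by
  have : LinearIndependent k ![(⟨x, hx⟩ : S), ⟨y, hy⟩] := by
    apply LinearIndependent.of_comp S.subtype
    convert h using 1
    ext i
    fin_cases i <;> rfl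
  simpa using this.fintype_card_le_finrank

namespace IsIrredAlt

variable {G : Type*} [Group G] {ρ : G →* (V ≃ₗ[k] V)} (H : IsIrredAlt ρ m)

include H

theorem exists_not_isWedge {s : Set (Dual k V)} (hs : Submodule.span k s = ⊤) :
    ∃ a ∈ s, ∃ b ∈ s, LinearIndependent k ![a, b] ∧ ∀ ξ, ¬ IsWedge m ξ a b := by
  have := H.finiteDimensional
  have hdim : finrank k (Dual k V) = 5 := by rw [Subspace.dual_finrank_eq, H.finrank_eq]
  by_contra! hcon
  obtain ⟨a, ha, has⟩ : ∃ a : Fin 5 → Dual k V, LinearIndependent k a ∧ ∀ i, a i ∈ s := by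
    let b := Basis.ofSpan (K := k) (s := s) hs.ge
    have : Fintype ((linearIndepOn_empty k (id : Dual k V → Dual k V)).extend
        (Set.empty_subset s)) := FiniteDimensional.fintypeBasisIndex b
    let e := Fintype.equivFinOfCardEq (by rw [← finrank_eq_card_basis b, hdim] :
      Fintype.card ((linearIndepOn_empty k (id : Dual k V → Dual k V)).extend
        (Set.empty_subset s)) = 5)
    refine ⟨b.reindex e, (b.reindex e).linearIndependent, fun i => ?_⟩
    rw [Basis.reindex_apply]
    exact Basis.ofSpan_subset hs.ge ⟨_, rfl⟩
  obtain ⟨v, hv⟩ := exists_dual_family ha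
  have hW : ∀ i j : Fin 5, i ≠ j → ∃ ξ, IsWedge m ξ (a i) (a j) := by
    intro i j hij
    refine hcon _ (has i) _ (has j) ?_
    have := ha.comp ![i, j] (by
      intro p q hpq
      fin_cases p <;> fin_cases q <;> simp_all)
    convert this using 1
    ext p
    fin_cases p <;> rfl
  choose! ξ hξ using hW
  let P := {p : Fin 5 × Fin 5 // p.1 < p.2}
  have hli : LinearIndependent k fun p : P => ξ p.1.1 p.1.2 := by
    rw [Fintype.linearIndependent_iff]
    rintro c hc ⟨⟨i, j⟩, hij⟩
    have h1 := LinearMap.congr_fun hc (m (v i) (v j))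
    rw [LinearMap.sum_apply, Finset.sum_eq_single (⟨⟨i, j⟩, hij⟩ : P)] at h1
    · have hne : i ≠ j := ne_of_lt hij
      simpa [hξ i j hne (v i) (v j), hv, hne] using h1
    · rintro ⟨⟨i', j'⟩, hij'⟩ - hne
      have h3 : i' < j' := hij'
      have h4 : i < j := hij
      have hne' : ¬ (i' = i ∧ j' = j) := fun h => hne (by simp [h.1, h.2])
      have h5 : ¬ (i' = j ∧ j' = i) := by
        rintro ⟨rfl, rfl⟩
        exact absurd h3 (not_lt_of_gt h4)
      simp only [LinearMap.smul_apply, hξ i' j' (ne_of_lt h3) (v i) (v j), hv, smul_eq_mul]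
      split_ifs <;> simp_all
    · simp
  have := hli.fintype_card_le_finrank
  rw [hdim] at this
  exact absurd this (by decide)

theorem exists_isWedge_of_inf {a b ξ : Dual k V} (hab : LinearIndependent k ![a, b])
    (h1 : ξ ∈ divisibleBy m a) (h2 : ξ ∈ divisibleBy m b) (hξ : ξ ≠ 0) :
    ∃ η, IsWedge m η a b := by
  have := H.finiteDimensional
  obtain ⟨c, hc⟩ := isWedge_of_mem_of_mem H.alt hab h1 h2
  have hc0 : c ≠ 0 := by
    rintro rfl
    exact hξ (H.dual_eq_zero fun x y => by rw [hc]; ring)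
  refine ⟨c⁻¹ • ξ, fun x y => ?_⟩
  rw [LinearMap.smul_apply, hc, smul_eq_mul, inv_mul_cancel_left₀ hc0]

theorem eq_zero_of_nonadj {a b ξ : Dual k V} (hab : LinearIndependent k ![a, b])
    (hW : ∀ η, ¬ IsWedge m η a b)
    (h1 : ξ ∈ divisibleBy m a) (h2 : ξ ∈ divisibleBy m b) : ξ = 0 := by
  by_contra hξ
  obtain ⟨η, hη⟩ := H.exists_isWedge_of_inf hab h1 h2 hξ
  exact hW η hη

theorem finrank_divisibleBy_le {a : Dual k V} (ha : a ≠ 0) :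
    finrank k (divisibleBy m a) ≤ 2 := by
  have := H.finiteDimensional
  by_contra! hcon
  obtain ⟨_, ⟨g, rfl⟩, _, ⟨g', rfl⟩, hli, hW⟩ := H.exists_not_isWedge (H.span_orbit ha)
  have h1 := H.finrank_le_translate a g
  have h2 := H.finrank_le_translate a g'
  have h3 := Submodule.finrank_sup_add_finrank_inf_eq
    (divisibleBy m (a ∘ₗ (ρ g : V →ₗ[k] V))) (divisibleBy m (a ∘ₗ (ρ g' : V →ₗ[k] V)))
  have h4 := Submodule.finrank_le
    (divisibleBy m (a ∘ₗ (ρ g : V →ₗ[k] V)) ⊔ divisibleBy m (a ∘ₗ (ρ g' : V →ₗ[k] V)))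
  rw [Subspace.dual_finrank_eq, H.finrank_eq] at h4
  have h5 : divisibleBy m (a ∘ₗ (ρ g : V →ₗ[k] V)) ⊓
      divisibleBy m (a ∘ₗ (ρ g' : V →ₗ[k] V)) ≠ ⊥ := by
    intro h
    rw [h, finrank_bot] at h3
    omega
  obtain ⟨ξ, ⟨h6, h7⟩, h8⟩ := Submodule.exists_mem_ne_zero_of_ne_bot h5
  exact h8 (H.eq_zero_of_nonadj hli hW h6 h7)

theorem exists_common_neighbour {a₁ a₂ : Dual k V} (h₁ : IsCenter m a₁) (h₂ : IsCenter m a₂)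
    (hli : LinearIndependent k ![a₁, a₂]) (hW : ∀ ξ, ¬ IsWedge m ξ a₁ a₂) :
    ∃ b ξ₁ ξ₂, IsCenter m b ∧ IsWedge m ξ₁ a₁ b ∧ IsWedge m ξ₂ a₂ b ∧ ξ₁ ≠ 0 ∧ ξ₂ ≠ 0 := by
  have := H.finiteDimensional
  obtain ⟨u₁, u₂, e11, e12, e21, e22⟩ := exists_dual_pair hli
  set K := LinearMap.ker a₁ ⊓ LinearMap.ker a₂ with hK
  have dK : finrank k K ≤ 3 := by
    let f : V →ₗ[k] k × k := a₁.prod a₂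
    have hf : LinearMap.ker f = K := LinearMap.ker_prod a₁ a₂
    have hs : Function.Surjective f := by
      rintro ⟨s, t⟩
      exact ⟨s • u₁ + t • u₂, by simp [f, e11, e12, e21, e22]⟩
    have := LinearMap.finrank_range_add_finrank_ker f
    rw [hf, LinearMap.range_eq_top.2 hs, finrank_top, H.finrank_eq] at this
    simp only [finrank_prod, finrank_self] at this
    omega
  let Φ : (divisibleBy m a₁ × divisibleBy m a₂) →ₗ[k] Dual k K :=
    LinearMap.coprod
      ((Dual.transpose (R := k) (m u₁ ∘ₗ K.subtype)) ∘ₗ (divisibleBy m a₁).subtype)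
      (-((Dual.transpose (R := k) (m u₂ ∘ₗ K.subtype)) ∘ₗ (divisibleBy m a₂).subtype))
  have hker : LinearMap.ker Φ ≠ ⊥ := by
    intro h
    have hinj : Function.Injective Φ := by
      rw [injective_iff_map_eq_zero]
      intro x hx
      have : x ∈ LinearMap.ker Φ := hx
      rwa [h, Submodule.mem_bot] at this
    have hle := LinearMap.finrank_le_finrank_of_injective hinj
    have f1 : Free k (divisibleBy m a₁) := Module.Free.of_divisionRing k (divisibleBy m a₁)
    have f2 : Free k (divisibleBy m a₂) := Module.Free.of_divisionRing k (divisibleBy m a₂)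
    rw [finrank_prod, Subspace.dual_finrank_eq] at hle
    have := h₁.2
    have := h₂.2
    omega
  obtain ⟨⟨⟨ξ₁, hξ₁⟩, ⟨ξ₂, hξ₂⟩⟩, hmem, hne⟩ := Submodule.exists_mem_ne_zero_of_ne_bot hker
  have hΦ : ∀ x ∈ K, ξ₁ (m u₁ x) = ξ₂ (m u₂ x) := by
    intro x hx
    have := LinearMap.congr_fun (LinearMap.mem_ker.1 hmem) ⟨x, hx⟩
    simp [Φ, Dual.transpose_apply] at this
    linear_combination this
  obtain ⟨b₁, hb₁⟩ := exists_isWedge H.alt h₁.1 hξ₁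
  obtain ⟨b₂, hb₂⟩ := exists_isWedge H.alt h₂.1 hξ₂
  have hK0 : ∀ x ∈ K, b₁ x = b₂ x := by
    intro x hx
    have h := hΦ x hx
    have hx1 : a₁ x = 0 := hx.1
    have hx2 : a₂ x = 0 := hx.2
    rw [hb₁, hb₂, hx1, hx2, e11, e22] at h
    linear_combination h
  have hdec : ∀ y, b₁ y - b₂ y = (b₁ u₁ - b₂ u₁) * a₁ y + (b₁ u₂ - b₂ u₂) * a₂ y := by
    intro y
    have := hK0 (y - a₁ y • u₁ - a₂ y • u₂) ⟨by
      change a₁ _ = 0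
      simp [e11, e12], by
      change a₂ _ = 0
      simp [e21, e22]⟩
    simp only [map_sub, map_smul, smul_eq_mul] at this
    linear_combination this
  set b := b₁ - (b₁ u₁ - b₂ u₁) • a₁ with hb
  have hw₁ : IsWedge m ξ₁ a₁ b := by
    intro x y
    rw [hb₁ x y, hb]
    simp only [LinearMap.sub_apply, LinearMap.smul_apply, smul_eq_mul]
    ring
  have hw₂ : IsWedge m ξ₂ a₂ b := by
    intro x y
    rw [hb₂ x y, hb]
    simp only [LinearMap.sub_apply, LinearMap.smul_apply, smul_eq_mul]
    linear_combination a₂ y * hdec x - a₂ x * hdec y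
  have aux : ∀ {x y : V}, a₁ x * b y - a₁ y * b x = ξ₁ (m x y) := fun {x y} => (hw₁ x y).symm
  have hn₁ : ξ₁ ≠ 0 := by
    intro h0
    have hbu : ∀ y, b y = b u₁ * a₁ y := by
      intro y
      have := hw₁ u₁ y
      rw [h0, e11, LinearMap.zero_apply] at this
      linear_combination -this
    have : ξ₂ ∈ divisibleBy m a₁ := by
      intro x y hx hy
      rw [hw₂ x y, hbu x, hbu y, hx, hy]
      ring
    have := H.eq_zero_of_nonadj hli hW this hξ₂
    exact hne (by simp [h0, this])
  have hn₂ : ξ₂ ≠ 0 := by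
    intro h0
    have hbu : ∀ y, b y = b u₂ * a₂ y := by
      intro y
      have := hw₂ u₂ y
      rw [h0, e22, LinearMap.zero_apply] at this
      linear_combination -this
    have : ξ₁ ∈ divisibleBy m a₂ := by
      intro x y hx hy
      rw [hw₁ x y, hbu x, hbu y, hx, hy]
      ring
    exact hn₁ (H.eq_zero_of_nonadj hli hW hξ₁ this)
  refine ⟨b, ξ₁, ξ₂, ⟨?_, ?_⟩, hw₁, hw₂, hn₁, hn₂⟩
  · intro h0
    apply hn₁
    refine H.dual_eq_zero fun x y => ?_
    rw [hw₁ x y, h0]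
    simp
  · refine two_le_finrank_of_pair hw₁.mem_right hw₂.mem_right ?_
    rw [LinearIndependent.pair_iff]
    intro s t hst
    have hs : s • ξ₁ = 0 := by
      refine H.eq_zero_of_nonadj hli hW (Submodule.smul_mem _ _ hξ₁) ?_
      rw [eq_neg_of_add_eq_zero_left hst]
      exact neg_mem (Submodule.smul_mem _ _ hξ₂)
    have hs0 := (smul_eq_zero.1 hs).resolve_right hn₁
    refine ⟨hs0, ?_⟩
    rw [hs0, zero_smul, zero_add] at hst
    exact (smul_eq_zero.1 hst).resolve_right hn₂

theorem eq_zero_of_four {ξ : Fin 4 → Dual k V} (hξ : LinearIndependent k ξ) {x : V}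
    (h : ∀ i v, ξ i (m x v) = 0) : x = 0 := by
  have := H.finiteDimensional
  by_contra hx
  have d := Subspace.finrank_add_finrank_dualCoannihilator_eq (Submodule.span k (Set.range ξ))
  rw [finrank_span_eq_card hξ, Fintype.card_fin, H.finrank_eq] at d
  have hm : ∀ v, m x v ∈ (Submodule.span k (Set.range ξ)).dualCoannihilator := by
    intro v
    rw [Submodule.mem_dualCoannihilator]
    intro φ hφ
    induction hφ using Submodule.span_induction with
    | mem z hz => obtain ⟨i, rfl⟩ := hz; exact h i v
    | zero => simp
    | add a b _ _ ha hb => simp [ha, hb]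
    | smul c a _ ha => simp [ha]
  obtain ⟨⟨y, hy⟩, -, hspan⟩ := finrank_eq_one_iff'.1
    (by omega : finrank k (Submodule.span k (Set.range ξ)).dualCoannihilator = 1)
  refine H.false_of_mul_mem_span hx (y := y) fun v => ?_
  obtain ⟨c, hc⟩ := hspan ⟨_, hm v⟩
  exact Submodule.mem_span_singleton.2 ⟨c, congrArg Subtype.val hc⟩

theorem linearIndependent_four {a b ξ₁ η₁ ξ₂ η₂ : Dual k V}
    (hab : LinearIndependent k ![a, b]) (hW : ∀ η, ¬ IsWedge m η a b)
    (h1 : ξ₁ ∈ divisibleBy m a) (h2 : η₁ ∈ divisibleBy m a) (h3 : ξ₂ ∈ divisibleBy m b)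
    (h4 : η₂ ∈ divisibleBy m b)
    (h5 : LinearIndependent k ![ξ₁, η₁]) (h6 : LinearIndependent k ![ξ₂, η₂]) :
    LinearIndependent k ![ξ₁, η₁, ξ₂, η₂] := by
  rw [Fintype.linearIndependent_iff]
  intro c hc
  simp only [Fin.sum_univ_four, Matrix.cons_val] at hc
  have e : c 0 • ξ₁ + c 1 • η₁ = 0 := by
    refine H.eq_zero_of_nonadj hab hW
      (add_mem (Submodule.smul_mem _ _ h1) (Submodule.smul_mem _ _ h2)) ?_
    have : c 0 • ξ₁ + c 1 • η₁ = -(c 2 • ξ₂ + c 3 • η₂) := by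
      rw [eq_neg_iff_add_eq_zero, ← hc]
      abel
    rw [this]
    exact neg_mem (add_mem (Submodule.smul_mem _ _ h3) (Submodule.smul_mem _ _ h4))
  have e' : c 2 • ξ₂ + c 3 • η₂ = 0 := by
    rw [e, zero_add] at hc
    exact hc
  have q1 := LinearIndependent.pair_iff.1 h5 _ _ e
  have q2 := LinearIndependent.pair_iff.1 h6 _ _ e'
  intro i
  fin_cases i
  exacts [q1.1, q1.2, q2.1, q2.2]

theorem unique_common_neighbour {a₁ a₂ b c ξ₁ ξ₂ η₁ η₂ : Dual k V}
    (hli : LinearIndependent k ![a₁, a₂]) (hW : ∀ ξ, ¬ IsWedge m ξ a₁ a₂)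
    (w1 : IsWedge m ξ₁ a₁ b) (w2 : IsWedge m ξ₂ a₂ b)
    (w3 : IsWedge m η₁ a₁ c) (w4 : IsWedge m η₂ a₂ c) : ¬ LinearIndependent k ![b, c] := by
  intro hbc
  have := H.finiteDimensional
  obtain ⟨u₁, u₂, e11, e12, e21, e22⟩ := exists_dual_pair hli
  have q1 : LinearIndependent k ![ξ₁, η₁] := by
    rw [LinearIndependent.pair_iff] at hbc ⊢
    intro s t hst
    apply hbc
    have h1 : ∀ y, s * b y + t * c y = (s * b u₁ + t * c u₁) * a₁ y := by
      intro y
      have h := LinearMap.congr_fun hst (m u₁ y)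
      simp only [LinearMap.add_apply, LinearMap.smul_apply, w1 u₁ y, w3 u₁ y, e11, smul_eq_mul,
        LinearMap.zero_apply] at h
      linear_combination h
    by_cases h0 : s * b u₁ + t * c u₁ = 0
    · ext y
      have h2 := h1 y
      rw [h0, zero_mul] at h2
      simpa using h2
    · exfalso
      apply hW (-((s * b u₁ + t * c u₁)⁻¹ • (s • ξ₂ + t • η₂)))
      intro x y
      have h2 := h1 x
      have h3 := h1 y
      simp only [LinearMap.neg_apply, LinearMap.smul_apply, LinearMap.add_apply, w2 x y, w4 x y,
        smul_eq_mul]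
      field_simp
      linear_combination a₂ y * h2 - a₂ x * h3
  have q2 : LinearIndependent k ![ξ₂, η₂] := by
    rw [LinearIndependent.pair_iff] at hbc ⊢
    intro s t hst
    apply hbc
    have h1 : ∀ y, s * b y + t * c y = (s * b u₂ + t * c u₂) * a₂ y := by
      intro y
      have h := LinearMap.congr_fun hst (m u₂ y)
      simp only [LinearMap.add_apply, LinearMap.smul_apply, w2 u₂ y, w4 u₂ y, e22, smul_eq_mul,
        LinearMap.zero_apply] at h
      linear_combination h
    by_cases h0 : s * b u₂ + t * c u₂ = 0
    · ext y
      have h2 := h1 y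
      rw [h0, zero_mul] at h2
      simpa using h2
    · exfalso
      apply hW ((s * b u₂ + t * c u₂)⁻¹ • (s • ξ₁ + t • η₁))
      intro x y
      have h2 := h1 x
      have h3 := h1 y
      simp only [LinearMap.smul_apply, LinearMap.add_apply, w1 x y, w3 x y,
        smul_eq_mul]
      field_simp
      linear_combination a₁ x * h3 - a₁ y * h2
  have q := H.linearIndependent_four hli hW w1.mem_left w3.mem_left w2.mem_left w4.mem_left q1 q2
  have hker : LinearMap.ker (LinearMap.pi ![a₁, a₂, b, c] : V →ₗ[k] Fin 4 → k) ≠ ⊥ := by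
    apply LinearMap.ker_ne_bot_of_finrank_lt
    rw [H.finrank_eq]
    simp
  obtain ⟨x, hx, hx0⟩ := Submodule.exists_mem_ne_zero_of_ne_bot hker
  have hx' : ∀ i, ![a₁, a₂, b, c] i x = 0 := fun i => congrFun (LinearMap.mem_ker.1 hx) i
  have f1 : a₁ x = 0 := hx' 0
  have f2 : a₂ x = 0 := hx' 1
  have f3 : b x = 0 := hx' 2
  have f4 : c x = 0 := hx' 3
  apply hx0
  refine H.eq_zero_of_four q fun i v => ?_
  fin_cases i
  · change ξ₁ _ = 0
    rw [w1 x v, f1, f3]; ring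
  · change η₁ _ = 0
    rw [w3 x v, f1, f4]; ring
  · change ξ₂ _ = 0
    rw [w2 x v, f2, f3]; ring
  · change η₂ _ = 0
    rw [w4 x v, f2, f4]; ring
end IsIrredAlt
end AlgebraOnModule

/-- A graph (up to an equivalence `E` of vertices) in which distinct nonadjacent vertices have a
unique common neighbour, with no dominating vertex, contains an induced pentagon. -/
theorem exists_induced_pentagon {P : Type*} (E Adj : P → P → Prop)
    (E_symm : ∀ {x y}, E x y → E y x) (A_symm : ∀ {x y}, Adj x y → Adj y x)
    (A_congr : ∀ {x y z}, Adj x y → E y z → Adj x z)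
    (hex : ∀ x y, ¬ E x y → ¬ Adj x y → ∃ z, Adj x z ∧ Adj y z)
    (huniq : ∀ x y z w, ¬ E x y → ¬ Adj x y → Adj x z → Adj y z → Adj x w → Adj y w → E z w)
    (hpair : ∃ x y, ¬ E x y ∧ ¬ Adj x y) (hdom : ∀ x, ∃ y, ¬ E x y ∧ ¬ Adj x y) :
    ∃ c : Fin 5 → P, (∀ i, Adj (c i) (c (i + 1))) ∧
      ∀ i, ¬ E (c i) (c (i + 2)) ∧ ¬ Adj (c i) (c (i + 2)) := by
  by_cases hC : ∀ m n x, ¬ E m n → ¬ Adj m n → Adj m x → Adj n x → ∀ y, Adj m y →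
      E x y ∨ Adj x y
  · exfalso
    obtain ⟨m, n, hE, hA⟩ := hpair
    obtain ⟨x, hmx, hnx⟩ := hex m n hE hA
    have hE' : ¬ E n m := fun h => hE (E_symm h)
    have hA' : ¬ Adj n m := fun h => hA (A_symm h)
    obtain ⟨z, hz, hz'⟩ := hdom x
    have zm : ¬ E m z := fun h => hz' (A_congr (A_symm hmx) h)
    have zn : ¬ E n z := fun h => hz' (A_congr (A_symm hnx) h)
    have zm' : ¬ Adj m z := fun h => (hC m n x hE hA hmx hnx z h).elim hz hz'
    have zn' : ¬ Adj n z := fun h => (hC n m x hE' hA' hnx hmx z h).elim hz hz'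
    obtain ⟨u, hmu, hzu⟩ := hex m z zm zm'
    obtain ⟨u', hnu, hzu'⟩ := hex n z zn zn'
    have hxu : Adj x u := by
      rcases hC m n x hE hA hmx hnx u hmu with h | h
      · exact absurd (A_symm (A_congr hzu (E_symm h))) hz'
      · exact h
    have hxu' : Adj x u' := by
      rcases hC n m x hE' hA' hnx hmx u' hnu with h | h
      · exact absurd (A_symm (A_congr hzu' (E_symm h))) hz'
      · exact h
    have huu := huniq x z u u' hz hz' hxu hzu hxu' hzu'
    have hnu2 : Adj n u := A_congr hnu (E_symm huu)
    have := huniq m n u x hE hA hmu hnu2 hmx hnx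
    exact hz' (A_symm (A_congr hzu this))
  · push Not at hC
    obtain ⟨m, n, x, hE, hA, hmx, hnx, y, hmy, hxy, hxy'⟩ := hC
    have hyn : ¬ Adj n y := fun h => hxy (huniq m n x y hE hA hmx hnx hmy h)
    have hyn' : ¬ E n y := fun h => hA (A_congr hmy (E_symm h))
    obtain ⟨w, hnw, hyw⟩ := hex n y hyn' hyn
    have hwm : ¬ Adj w m := by
      intro h
      have := huniq m n w x hE hA (A_symm h) hnw hmx hnx
      exact hxy' (A_symm (A_congr hyw this))
    have hwm' : ¬ E w m := fun h => hA (A_symm (A_congr hnw h))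
    have hxw' : ¬ E x w := fun h => hxy' (A_symm (A_congr hyw (E_symm h)))
    have hxw : ¬ Adj x w := by
      intro h
      have := huniq x y m w hxy hxy' (A_symm hmx) (A_symm hmy) h hyw
      exact hwm' (E_symm this)
    refine ⟨![m, x, n, w, y], ?_, ?_⟩
    · intro i
      fin_cases i
      exacts [hmx, A_symm hnx, hnw, A_symm hyw, A_symm hmy]
    · intro i
      fin_cases i
      exacts [⟨hE, hA⟩, ⟨hxw', hxw⟩, ⟨hyn', hyn⟩, ⟨hwm', hwm⟩,
        ⟨fun h => hxy (E_symm h), fun h => hxy' (A_symm h)⟩]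
section AlgebraOnModule
variable {k V : Type*} [Field k] [AddCommGroup V] [Module k V]
variable {m : V →ₗ[k] V →ₗ[k] V}
namespace IsIrredAlt

variable {G : Type*} [Group G] {ρ : G →* (V ≃ₗ[k] V)} (H : IsIrredAlt ρ m)

include H
theorem exists_pentagon {a₀ : Dual k V} (h₀ : IsCenter m a₀) :
    ∃ c : Fin 5 → Dual k V, (∀ i, ∃ ξ ≠ 0, IsWedge m ξ (c i) (c (i + 1))) ∧
      ∀ i, LinearIndependent k ![c i, c (i + 2)] ∧ ∀ ξ, ¬ IsWedge m ξ (c i) (c (i + 2)) := by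
  have := H.finiteDimensional
  have li_of : ∀ a b : {a : Dual k V // IsCenter m a}, (¬ ∃ t : k, t ≠ 0 ∧ b.1 = t • a.1) →
      LinearIndependent k ![a.1, b.1] := by
    rintro ⟨a, ha⟩ ⟨b, hb⟩ h
    rw [LinearIndependent.pair_iff]
    intro s t hst
    simp only at h hst
    have ht : t = 0 := by
      by_contra ht
      have e : b = (-(t⁻¹ * s)) • a := by
        ext v
        have := LinearMap.congr_fun hst v
        simp only [LinearMap.add_apply, LinearMap.smul_apply, smul_eq_mul,
          LinearMap.zero_apply] at this ⊢
        field_simp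
        linear_combination this
      refine h ⟨_, ?_, e⟩
      intro h0
      rw [h0, zero_smul] at e
      exact hb.1 e
    rw [ht, zero_smul, add_zero] at hst
    exact ⟨(smul_eq_zero.1 hst).resolve_right ha.1, ht⟩
  have not_prop : ∀ {a b : Dual k V}, LinearIndependent k ![a, b] →
      ¬ ∃ t : k, t ≠ 0 ∧ b = t • a := by
    rintro a b h ⟨t, ht, rfl⟩
    have := LinearIndependent.pair_iff.1 h t (-1) (by simp)
    exact ht this.1
  have nonadj : ∀ {a b : Dual k V}, LinearIndependent k ![a, b] →
      (¬ ∃ ξ ≠ 0, IsWedge m ξ a b) → ∀ ξ, ¬ IsWedge m ξ a b := by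
    intro a b hli h ξ hξ
    refine h ⟨ξ, ?_, hξ⟩
    rintro rfl
    obtain ⟨u, v, e1, e2, e3, e4⟩ := exists_dual_pair hli
    have := hξ u v
    simp [e1, e2, e3, e4] at this
  have span_top : Submodule.span k {a : Dual k V | IsCenter m a} = ⊤ := by
    rw [eq_top_iff, ← H.span_orbit h₀.1]
    apply Submodule.span_mono
    rintro _ ⟨g, rfl⟩
    exact H.isCenter_translate h₀ g
  obtain ⟨p, hp, q, hq, hpq, hpqW⟩ := H.exists_not_isWedge span_top
  suffices h : ∃ c : Fin 5 → {a : Dual k V // IsCenter m a},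
      (∀ i, ∃ ξ ≠ 0, IsWedge m ξ (c i).1 (c (i + 1)).1) ∧
      ∀ i, (¬ ∃ t : k, t ≠ 0 ∧ (c (i + 2)).1 = t • (c i).1) ∧
        ¬ ∃ ξ ≠ 0, IsWedge m ξ (c i).1 (c (i + 2)).1 by
    obtain ⟨c, hc1, hc2⟩ := h
    refine ⟨fun i => (c i).1, hc1, fun i => ?_⟩
    have hli := li_of _ _ (hc2 i).1
    exact ⟨hli, nonadj hli (hc2 i).2⟩
  refine exists_induced_pentagon
    (P := {a : Dual k V // IsCenter m a}) (fun a b => ∃ t : k, t ≠ 0 ∧ b.1 = t • a.1)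
    (fun a b => ∃ ξ ≠ 0, IsWedge m ξ a.1 b.1) ?_ ?_ ?_ ?_ ?_ ?_ ?_
  · rintro x y ⟨t, ht, h⟩
    exact ⟨t⁻¹, inv_ne_zero ht, by rw [h, smul_smul, inv_mul_cancel₀ ht, one_smul]⟩
  · rintro x y ⟨ξ, hξ, h⟩
    exact ⟨-ξ, neg_ne_zero.2 hξ, h.symm⟩
  · rintro x y z ⟨ξ, hξ, h⟩ ⟨t, ht, e⟩
    have := h.smul_smul 1 t
    rw [one_smul, one_mul, ← e] at this
    exact ⟨t • ξ, smul_ne_zero ht hξ, this⟩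
  · intro x y hE hA
    have hli := li_of x y hE
    obtain ⟨b, ξ₁, ξ₂, hb, w1, w2, n1, n2⟩ :=
      H.exists_common_neighbour x.2 y.2 hli (nonadj hli hA)
    exact ⟨⟨b, hb⟩, ⟨ξ₁, n1, w1⟩, ⟨ξ₂, n2, w2⟩⟩
  · rintro x y z w hE hA ⟨ξ₁, -, h1⟩ ⟨ξ₂, -, h2⟩ ⟨ξ₃, -, h3⟩ ⟨ξ₄, -, h4⟩
    have hli := li_of x y hE
    by_contra hzw
    exact H.unique_common_neighbour hli (nonadj hli hA) h1 h2 h3 h4 (li_of z w hzw)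
  · exact ⟨⟨p, hp⟩, ⟨q, hq⟩, not_prop hpq, fun ⟨ξ, _, h⟩ => hpqW ξ h⟩
  · by_contra! hdom
    obtain ⟨⟨x, hx⟩, hdom⟩ := hdom
    have hdom' : ∀ g : G, ∀ b, IsCenter m b →
        LinearIndependent k ![x ∘ₗ (ρ g : V →ₗ[k] V), b] →
        ∃ ξ ≠ 0, IsWedge m ξ (x ∘ₗ (ρ g : V →ₗ[k] V)) b := by
      intro g b hb hli
      have e : (b ∘ₗ (ρ g⁻¹ : V →ₗ[k] V)) ∘ₗ (ρ g : V →ₗ[k] V) = b := by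
        ext v
        simp
      obtain ⟨ξ, hξ, h⟩ := hdom ⟨b ∘ₗ (ρ g⁻¹ : V →ₗ[k] V), H.isCenter_translate hb _⟩ (by
        rintro t ht h
        apply not_prop hli
        refine ⟨t, ht, ?_⟩
        rw [← e, show b ∘ₗ (ρ g⁻¹ : V →ₗ[k] V) = t • x from h, LinearMap.smul_comp])
      have := H.isWedge_translate h g
      exact ⟨_, H.translate_ne_zero hξ g, by rwa [e] at this⟩
    have key : ∀ g : G, IsCenter m (x ∘ₗ (ρ g : V →ₗ[k] V)) ∧ 
        ∃ ξ₁ ξ₂, IsWedge m ξ₁ p (x ∘ₗ (ρ g : V →ₗ[k] V)) ∧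
          IsWedge m ξ₂ q (x ∘ₗ (ρ g : V →ₗ[k] V)) := by
      intro g
      have hxg := H.isCenter_translate hx g
      refine ⟨hxg, ?_⟩
      have aux : ∀ r r' : Dual k V, IsCenter m r → IsCenter m r' → 
          LinearIndependent k ![r, r'] → (∀ ξ, ¬ IsWedge m ξ r r') →
          ∃ ξ, IsWedge m ξ r (x ∘ₗ (ρ g : V →ₗ[k] V)) := by
        intro r r' hr hr' hli hn
        by_contra! hcon
        have h1 : ¬ LinearIndependent k ![x ∘ₗ (ρ g : V →ₗ[k] V), r] := by
          intro h
          obtain ⟨ξ, -, hξ⟩ := hdom' g r hr h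
          exact hcon _ hξ.symm
        have h2 : ∃ t : k, t ≠ 0 ∧ r = t • (x ∘ₗ (ρ g : V →ₗ[k] V)) := by
          by_contra h
          exact h1 (li_of ⟨_, hxg⟩ ⟨r, hr⟩ h)
        obtain ⟨t, ht, e⟩ := h2
        have h3 : LinearIndependent k ![x ∘ₗ (ρ g : V →ₗ[k] V), r'] := by
          rw [LinearIndependent.pair_iff] at hli ⊢
          intro s s' h
          have := hli (s * t⁻¹) s' (by
            rw [e, smul_smul, mul_assoc, inv_mul_cancel₀ ht, mul_one, h])
          exact ⟨by simpa [ht] using this.1, this.2⟩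
        obtain ⟨ξ, -, hξ⟩ := hdom' g r' hr' h3
        have := hξ.smul_smul t 1
        rw [one_smul, ← e] at this
        exact hn _ this
      obtain ⟨ξ₁, w1⟩ := aux p q hp hq hpq hpqW
      obtain ⟨ξ₂, w2⟩ := aux q p hq hp
        (by
          rw [LinearIndependent.pair_iff] at hpq ⊢
          intro s t h
          exact (hpq t s (by rw [add_comm, h])).symm)
        (fun ξ h => hpqW _ h.symm)
      exact ⟨ξ₁, ξ₂, w1, w2⟩
    obtain ⟨_, ⟨g, rfl⟩, _, ⟨g', rfl⟩, hli, -⟩ := H.exists_not_isWedge (H.span_orbit hx.1)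
    obtain ⟨-, ξ₁, ξ₂, w1, w2⟩ := key g
    obtain ⟨-, ξ₃, ξ₄, w3, w4⟩ := key g'
    exact H.unique_common_neighbour hpq hpqW w1 w2 w3 w4 hli
end IsIrredAlt
end AlgebraOnModule

/-- The automorphism group of the pentagon. -/
def pentagonAut : Subgroup (Equiv.Perm (Fin 5)) where
  carrier := {σ | ∀ i j, (σ j = σ i + 1 ∨ σ i = σ j + 1) ↔ (j = i + 1 ∨ i = j + 1)}
  mul_mem' := by
    intro σ τ hσ hτ i j
    rw [← hτ i j, ← hσ (τ i) (τ j)]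
    rfl
  one_mem' := by intro i j; rfl
  inv_mem' := by
    intro σ hσ i j
    have := hσ (σ⁻¹ i) (σ⁻¹ j)
    simpa using this.symm

theorem card_pentagonAut : Nat.card pentagonAut = 10 := by
  have : Nat.card pentagonAut = Fintype.card {σ : Equiv.Perm (Fin 5) //
      ∀ i j, (σ j = σ i + 1 ∨ σ i = σ j + 1) ↔ (j = i + 1 ∨ i = j + 1)} := by
    rw [← Nat.card_eq_fintype_card]
    rfl
  rw [this]
  decide +kernel
section AlgebraOnModule
variable {k V : Type*} [Field k] [AddCommGroup V] [Module k V]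
variable {m : V →ₗ[k] V →ₗ[k] V}
namespace IsIrredAlt

variable {G : Type*} [Group G] {ρ : G →* (V ≃ₗ[k] V)} (H : IsIrredAlt ρ m)

include H
theorem exists_dual_of_pentagon {c : Fin 5 → Dual k V}
    (hc : ∀ i, ∃ ξ ≠ 0, IsWedge m ξ (c i) (c (i + 1)))
    (hn : ∀ i, LinearIndependent k ![c i, c (i + 2)] ∧ ∀ ξ, ¬ IsWedge m ξ (c i) (c (i + 2))) :
    ∃ v : Fin 5 → V, ∀ i j, c i (v j) = if i = j then 1 else 0 := by
  have := H.finiteDimensional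
  choose ξ hξ hw using hc
  have li_pair : ∀ i, LinearIndependent k ![ξ i, ξ (i + 1)] := by
    intro i
    rw [LinearIndependent.pair_iff]
    intro s t hst
    have h0 : s • ξ i = 0 := by
      refine H.eq_zero_of_nonadj (hn i).1 (hn i).2 (Submodule.smul_mem _ _ (hw i).mem_left) ?_
      have e : s • ξ i = -(t • ξ (i + 1)) := eq_neg_of_add_eq_zero_left hst
      rw [e]
      have := (hw (i + 1)).mem_right
      rw [show i + 1 + 1 = i + 2 by clear * -; revert i; decide] at this
      exact neg_mem (Submodule.smul_mem _ _ this)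
    have hs := (smul_eq_zero.1 h0).resolve_right (hξ i)
    refine ⟨hs, ?_⟩
    rw [hs, zero_smul, zero_add] at hst
    exact (smul_eq_zero.1 hst).resolve_right (hξ _)
  have q := H.linearIndependent_four (hn 0).1 (hn 0).2
    (by simpa using (hw 4).mem_right) (hw 0).mem_left
    (by simpa using (hw 1).mem_right) (by simpa using (hw 2).mem_left)
    (li_pair 4) (li_pair 1)
  let f : V →ₗ[k] Fin 5 → k := LinearMap.pi c
  have hf : Function.Injective f := by
    rw [injective_iff_map_eq_zero]
    intro x hx
    have hx' : ∀ i, c i x = 0 := fun i => congrFun hx i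
    refine H.eq_zero_of_four q fun i v => ?_
    have hz : ∀ j, ξ j (m x v) = 0 := fun j => by
      rw [hw j, hx', hx']
      ring
    fin_cases i
    exacts [hz 4, hz _, hz _, hz _]
  have hs : Function.Surjective f :=
    (LinearMap.injective_iff_surjective_of_finrank_eq_finrank (by simp [H.finrank_eq])).1 hf
  choose v hv using fun j : Fin 5 => hs (Pi.single j 1)
  refine ⟨v, fun i j => ?_⟩
  have := congrFun (hv j) i
  rw [Pi.single_apply] at this
  exact this

theorem eq_smul_of_isCenter {c : Fin 5 → Dual k V}
    (hc : ∀ i, ∃ ξ ≠ 0, IsWedge m ξ (c i) (c (i + 1)))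
    {v : Fin 5 → V} (hv : ∀ i j, c i (v j) = if i = j then 1 else 0)
    {a : Dual k V} (ha : IsCenter m a) : ∃ i, ∃ t : k, t ≠ 0 ∧ a = t • c i := by
  have := H.finiteDimensional
  choose ξ hξ hw using hc
  have hliξ : LinearIndependent k ξ := by
    rw [Fintype.linearIndependent_iff]
    intro t ht i
    have h := LinearMap.congr_fun ht (m (v i) (v (i + 1)))
    rw [LinearMap.sum_apply, Finset.sum_eq_single i] at h
    · simpa [hw i (v i) (v (i + 1)), hv] using h
    · intro j _ hj
      have e1 : ¬ (j + 1 = i + 1) := fun h => hj (add_right_cancel h)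
      have e2 : ¬ (j = i + 1 ∧ j + 1 = i) := by
        clear * - hj
        revert i j; decide
      simp only [LinearMap.smul_apply, hw j (v i) (v (i + 1)), hv, smul_eq_mul]
      split_ifs <;> simp_all
    · simp
  have hspan : Submodule.span k (Set.range ξ) = ⊤ := by
    apply Submodule.eq_top_of_finrank_eq
    rw [finrank_span_eq_card hliξ, Subspace.dual_finrank_eq, H.finrank_eq, Fintype.card_fin]
  have hm0 : ∀ i, m (v i) (v (i + 2)) = 0 := by
    intro i
    have h1 : ∀ φ : Dual k V, φ (m (v i) (v (i + 2))) = 0 := by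
      intro φ
      have hφ : φ ∈ Submodule.span k (Set.range ξ) := hspan ▸ Submodule.mem_top
      induction hφ using Submodule.span_induction with
      | mem z hz =>
        obtain ⟨j, rfl⟩ := hz
        rw [hw j]
        simp only [hv]
        have e1 : ¬ (j = i ∧ j + 1 = i + 2) := by clear * -; revert i j; decide
        have e2 : ¬ (j = i + 2 ∧ j + 1 = i) := by clear * -; revert i j; decide
        split_ifs <;> simp_all
      | zero => simp
      | add a b _ _ ha hb => simp [ha, hb]
      | smul c a _ ha => simp [ha]
    exact (Module.forall_dual_apply_eq_zero_iff k _).1 h1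
  have hsum : ∀ x, x = ∑ i, c i x • v i := eq_sum_of_dual_basis H.finrank_eq hv
  have cyc : ∀ η ∈ divisibleBy m a, ∀ p q r,
      a r * η (m p q) + a p * η (m q r) + a q * η (m r p) = 0 := by
    intro η hη p q r
    obtain ⟨b, hb⟩ := exists_isWedge H.alt ha.1 hη
    rw [hb, hb, hb]
    ring
  set α := fun i => a (v i) with hα
  have r1 : ∀ η ∈ divisibleBy m a, ∀ i, α (i + 3) * η (m (v i) (v (i + 1))) = 0 := by
    intro η hη i
    have h := cyc η hη (v i) (v (i + 1)) (v (i + 3))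
    have e1 : m (v (i + 1)) (v (i + 3)) = 0 := by
      have := hm0 (i + 1)
      rwa [show i + 1 + 2 = i + 3 by clear * -; revert i; decide] at this
    have e2 : m (v (i + 3)) (v i) = 0 := by
      have := hm0 (i + 3)
      rwa [show i + 3 + 2 = i by clear * -; revert i; decide] at this
    rw [e1, e2, map_zero, mul_zero, mul_zero, add_zero, add_zero] at h
    exact h
  have r2 : ∀ η ∈ divisibleBy m a, ∀ i, α (i + 2) * η (m (v i) (v (i + 1))) +
      α i * η (m (v (i + 1)) (v (i + 2))) = 0 := by
    intro η hη i
    have h := cyc η hη (v i) (v (i + 1)) (v (i + 2))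
    rw [H.anticomm (v (i + 2)) (v i), hm0 i, neg_zero, map_zero, mul_zero, add_zero] at h
    exact h
  have haeq : a = ∑ i, α i • c i := by
    ext x
    conv_lhs => rw [hsum x]
    simp only [map_sum, map_smul, smul_eq_mul, LinearMap.sum_apply, LinearMap.smul_apply]
    exact Finset.sum_congr rfl fun i _ => mul_comm _ _
  obtain ⟨i, hi⟩ : ∃ i, α i ≠ 0 := by
    by_contra! hcon
    apply ha.1
    rw [haeq]
    simp [hcon]
  have hX : ∀ η, η ∈ divisibleBy m a →
      η (m (v i) (v (i + 1))) = 0 → η (m (v (i + 4)) (v i)) = 0 → η = 0 := by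
    intro η hη h0 h4
    have x2 : η (m (v (i + 2)) (v (i + 3))) = 0 := by
      have h := r1 η hη (i + 2)
      rw [show i + 2 + 3 = i by clear * -; revert i; decide,
        show i + 2 + 1 = i + 3 by clear * -; revert i; decide] at h
      exact (mul_eq_zero.1 h).resolve_left hi
    have x1 : η (m (v (i + 1)) (v (i + 2))) = 0 := by
      have h := r2 η hη i
      rw [h0, mul_zero, zero_add] at h
      exact (mul_eq_zero.1 h).resolve_left hi
    have x3 : η (m (v (i + 3)) (v (i + 4))) = 0 := by
      have h := r2 η hη (i + 3)
      rw [show i + 3 + 2 = i by clear * -; revert i; decide,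
        show i + 3 + 1 = i + 4 by clear * -; revert i; decide, h4, mul_zero,
        add_zero] at h
      exact (mul_eq_zero.1 h).resolve_left hi
    have hall : ∀ j, η (m (v j) (v (j + 1))) = 0 := by
      intro j
      have : j = i ∨ j = i + 1 ∨ j = i + 2 ∨ j = i + 3 ∨ j = i + 4 := by
        clear * -
        revert i j; decide
      rcases this with rfl | rfl | rfl | rfl | rfl
      · exact h0
      · rwa [show i + 1 + 1 = i + 2 by clear * -; revert i; decide]
      · rwa [show i + 2 + 1 = i + 3 by clear * -; revert i; decide]
      · rwa [show i + 3 + 1 = i + 4 by clear * -; revert i; decide]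
      · rwa [show i + 4 + 1 = i by clear * -; revert i; decide]
    refine H.dual_eq_zero fun x y => ?_
    have hij : ∀ p q, η (m (v p) (v q)) = 0 := by
      intro p q
      have : q = p ∨ q = p + 1 ∨ q = p + 2 ∨ p = q + 1 ∨ p = q + 2 := by
        clear * -
        revert p q; decide
      rcases this with rfl | rfl | rfl | rfl | rfl
      · simp [H.alt]
      · exact hall _
      · simp [hm0]
      · rw [H.anticomm, map_neg, hall, neg_zero]
      · rw [H.anticomm, hm0]; simp
    rw [hsum x, hsum y]
    simp only [map_sum, map_smul, LinearMap.sum_apply, LinearMap.smul_apply, hij, smul_zero,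
      Finset.sum_const_zero]
  let Ψ : divisibleBy m a →ₗ[k] k × k :=
    (Dual.eval k V (m (v i) (v (i + 1))) ∘ₗ (divisibleBy m a).subtype).prod
      (Dual.eval k V (m (v (i + 4)) (v i)) ∘ₗ (divisibleBy m a).subtype)
  have hinj : Function.Injective Ψ := by
    rw [injective_iff_map_eq_zero]
    rintro ⟨η, hη⟩ h
    have h1 := congrArg Prod.fst h
    have h2 := congrArg Prod.snd h
    exact Subtype.ext (hX η hη h1 h2)
  have hsurj : Function.Surjective Ψ := by
    rw [← LinearMap.range_eq_top]
    apply Submodule.eq_top_of_finrank_eq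
    rw [LinearMap.finrank_range_of_inj hinj, finrank_prod, finrank_self]
    exact le_antisymm (H.finrank_divisibleBy_le ha.1) ha.2
  obtain ⟨⟨η, hη⟩, hη1⟩ := hsurj (1, 0)
  obtain ⟨⟨θ, hθ⟩, hθ1⟩ := hsurj (0, 1)
  have η0 : η (m (v i) (v (i + 1))) = 1 := congrArg Prod.fst hη1
  have η4 : η (m (v (i + 4)) (v i)) = 0 := congrArg Prod.snd hη1
  have θ0 : θ (m (v i) (v (i + 1))) = 0 := congrArg Prod.fst hθ1
  have θ4 : θ (m (v (i + 4)) (v i)) = 1 := congrArg Prod.snd hθ1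
  have a3 : α (i + 3) = 0 := by
    have := r1 η hη i
    rwa [η0, mul_one] at this
  have a4 : α (i + 4) = 0 := by
    have := r2 η hη (i + 4)
    rwa [show i + 4 + 1 = i by clear * -; revert i; decide, η4, mul_zero, zero_add,
      show i + 4 + 2 = i + 1 by clear * -; revert i; decide, η0, mul_one] at this
  have a2 : α (i + 2) = 0 := by
    have := r1 θ hθ (i + 4)
    rwa [show i + 4 + 1 = i by clear * -; revert i; decide, θ4, mul_one,
      show i + 4 + 3 = i + 2 by clear * -; revert i; decide] at this
  have a1 : α (i + 1) = 0 := by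
    have := r2 θ hθ (i + 4)
    rwa [show i + 4 + 1 = i by clear * -; revert i; decide, θ4, mul_one,
      show i + 4 + 2 = i + 1 by clear * -; revert i; decide, θ0, mul_zero, add_zero] at this
  refine ⟨i, α i, hi, ?_⟩
  conv_lhs => rw [haeq]
  rw [Finset.sum_eq_single i]
  · intro j _ hj
    have : j = i + 1 ∨ j = i + 2 ∨ j = i + 3 ∨ j = i + 4 := by
      clear * - hj
      revert i j; decide
    rcases this with rfl | rfl | rfl | rfl
    · rw [a1, zero_smul]
    · rw [a2, zero_smul]
    · rw [a3, zero_smul]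
    · rw [a4, zero_smul]
  · simp

theorem exists_hom_pentagonAut {a₀ : Dual k V} (h₀ : IsCenter m a₀) :
    ∃ (f : G →* pentagonAut), f.ker ≠ ⊤ := by
  have := H.finiteDimensional
  obtain ⟨c, hc, hn⟩ := H.exists_pentagon h₀
  obtain ⟨v, hv⟩ := H.exists_dual_of_pentagon hc hn
  have hcen : ∀ i, IsCenter m (c i) := by
    intro i
    obtain ⟨ξ, hξ, hw⟩ := hc i
    obtain ⟨η, hη, hw'⟩ := hc (i + 4)
    rw [show i + 4 + 1 = i by clear * -; revert i; decide] at hw'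
    have hni := hn (i + 4)
    rw [show i + 4 + 2 = i + 1 by clear * -; revert i; decide] at hni
    refine ⟨?_, two_le_finrank_of_pair hw.mem_left hw'.mem_right ?_⟩
    · intro h
      have := hv i i
      rw [h] at this
      simp at this
    · rw [LinearIndependent.pair_iff]
      intro s t hst
      have h0 : s • ξ = 0 := by
        refine H.eq_zero_of_nonadj hni.1 hni.2 ?_ (Submodule.smul_mem _ _ hw.mem_right)
        rw [eq_neg_of_add_eq_zero_left hst]
        exact neg_mem (Submodule.smul_mem _ _ hw'.mem_left)
      have hs := (smul_eq_zero.1 h0).resolve_right hξ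
      refine ⟨hs, ?_⟩
      rw [hs, zero_smul, zero_add] at hst
      exact (smul_eq_zero.1 hst).resolve_right hη
  have huniq : ∀ {i j : Fin 5} {s t : k}, s ≠ 0 → s • c i = t • c j → i = j := by
    intro i j s t hs h
    by_contra hij
    have := LinearMap.congr_fun h (v i)
    simp [hv, hs, Ne.symm hij] at this
  have hadj : ∀ i j, (∃ ξ ≠ 0, IsWedge m ξ (c i) (c j)) ↔ (j = i + 1 ∨ i = j + 1) := by
    intro i j
    have : j = i ∨ j = i + 1 ∨ j = i + 2 ∨ i = j + 1 ∨ i = j + 2 := by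
      clear * -
      revert i j; decide
    have d : ∀ i : Fin 5, ¬ (i + 2 = i + 1 ∨ i = i + 2 + 1) := by decide
    have d0 : ∀ i : Fin 5, ¬ (i = i + 1 ∨ i = i + 1) := by decide
    rcases this with rfl | rfl | rfl | rfl | rfl
    · refine iff_of_false ?_ (d0 j)
      rintro ⟨ξ, hξ, h⟩
      exact hξ (H.dual_eq_zero fun x y => by rw [h x y]; ring)
    · exact iff_of_true (hc i) (Or.inl rfl)
    · exact iff_of_false (fun ⟨ξ, _, h⟩ => (hn i).2 ξ h) (d i)
    · obtain ⟨ξ, hξ, h⟩ := hc j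
      exact iff_of_true ⟨_, neg_ne_zero.2 hξ, h.symm⟩ (Or.inr rfl)
    · exact iff_of_false (fun ⟨ξ, _, h⟩ => (hn j).2 _ h.symm) (fun h => d j h.symm)
  have hex : ∀ g : G, ∀ i, ∃ j, ∃ t : k, t ≠ 0 ∧ c i ∘ₗ (ρ g⁻¹ : V →ₗ[k] V) = t • c j :=
    fun g i => H.eq_smul_of_isCenter hc hv (H.isCenter_translate (hcen i) g⁻¹)
  choose τ s hs hτ using hex
  have τ_one : ∀ i, τ 1 i = i := by
    intro i
    have h := hτ 1 i
    have e : c i ∘ₗ (ρ (1 : G)⁻¹ : V →ₗ[k] V) = (1 : k) • c i := by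
      ext x
      simp
    rw [e] at h
    exact (huniq one_ne_zero h).symm
  have τ_mul : ∀ g g' i, τ (g * g') i = τ g (τ g' i) := by
    intro g g' i
    have h1 := hτ (g * g') i
    have e : c i ∘ₗ (ρ (g * g')⁻¹ : V →ₗ[k] V) =
        (s g' i * s g (τ g' i)) • c (τ g (τ g' i)) := by
      ext x
      have h2 := LinearMap.congr_fun (hτ g' i) (ρ g⁻¹ x)
      have h3 := LinearMap.congr_fun (hτ g (τ g' i)) x
      simp only [LinearMap.comp_apply, LinearEquiv.coe_coe, LinearMap.smul_apply,
        smul_eq_mul] at h2 h3 ⊢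
      rw [h3] at h2
      rw [mul_inv_rev, _root_.map_mul, mul_assoc]
      exact h2
    rw [e] at h1
    exact (huniq (mul_ne_zero (hs _ _) (hs _ _)) h1).symm
  let f₀ : G →* Equiv.Perm (Fin 5) :=
    { toFun := fun g => ⟨τ g, τ g⁻¹, fun i => by rw [← τ_mul, inv_mul_cancel, τ_one],
        fun i => by rw [← τ_mul, mul_inv_cancel, τ_one]⟩
      map_one' := Equiv.ext τ_one
      map_mul' := fun g g' => Equiv.ext (τ_mul g g') }
  have hmem : ∀ g, f₀ g ∈ pentagonAut := by
    have one_dir : ∀ g i j, (j = i + 1 ∨ i = j + 1) →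
        (τ g j = τ g i + 1 ∨ τ g i = τ g j + 1) := by
      intro g i j hij
      rw [← hadj] at hij ⊢
      obtain ⟨ξ, hξ, h⟩ := hij
      have h1 := H.isWedge_translate h g⁻¹
      rw [hτ, hτ] at h1
      have h2 := h1.smul_smul (s g i)⁻¹ (s g j)⁻¹
      rw [smul_smul, smul_smul, inv_mul_cancel₀ (hs _ _), inv_mul_cancel₀ (hs _ _), one_smul,
        one_smul] at h2
      exact ⟨_, smul_ne_zero (mul_ne_zero (inv_ne_zero (hs _ _)) (inv_ne_zero (hs _ _)))
        (H.translate_ne_zero hξ _), h2⟩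
    intro g i j
    refine ⟨fun h => ?_, one_dir g i j⟩
    have := one_dir g⁻¹ _ _ h
    have e : ∀ i, τ g⁻¹ (f₀ g i) = i := fun i => by
      change τ g⁻¹ (τ g i) = i
      rw [← τ_mul, inv_mul_cancel, τ_one]
    rwa [e, e] at this
  refine ⟨f₀.codRestrict pentagonAut hmem, fun hker => ?_⟩
  have htriv : ∀ g, τ g 0 = 0 := by
    intro g
    have : g ∈ (f₀.codRestrict pentagonAut hmem).ker := hker ▸ Subgroup.mem_top g
    rw [MonoidHom.mem_ker] at this
    exact congrArg (fun σ : pentagonAut => (σ : Equiv.Perm (Fin 5)) 0) this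
  have hspan := H.span_orbit (hcen 0).1
  have hle : (⊤ : Submodule k (Dual k V)) ≤ Submodule.span k {c 0} := by
    rw [← hspan, Submodule.span_le]
    rintro _ ⟨g, rfl⟩
    have := hτ g⁻¹ 0
    rw [inv_inv, htriv] at this
    change c 0 ∘ₗ (ρ g : V →ₗ[k] V) ∈ _
    rw [this]
    exact Submodule.smul_mem _ _ (Submodule.mem_span_singleton_self _)
  obtain ⟨t, ht⟩ := Submodule.mem_span_singleton.1 (hle (Submodule.mem_top (x := c 1)))
  have := LinearMap.congr_fun ht (v 1)
  simp [hv] at this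
end IsIrredAlt
end AlgebraOnModule

theorem IsPGroup.mul_comm_of_isSimpleGroup {G : Type*} [Group G] [Finite G]
    [IsSimpleGroup G] {p : ℕ}
    [Fact p.Prime] (h : IsPGroup p G) (a b : G) : a * b = b * a :=
  have := h.isNilpotent
  IsSimpleGroup.comm_iff_isSolvable.2 inferInstance a b

theorem mul_comm_of_card_dvd_forty {G : Type*} [Group G] [Finite G] [IsSimpleGroup G]
    (h : Nat.card G ∣ 40) (a b : G) : a * b = b * a := by
  have f5 : Fact (Nat.Prime 5) := ⟨by norm_num⟩
  have f2 : Fact (Nat.Prime 2) := ⟨by norm_num⟩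
  obtain ⟨P⟩ : Nonempty (Sylow 5 G) := inferInstance
  have hn : Nat.card (Sylow 5 G) = 1 := by
    have h1 : Nat.card (Sylow 5 G) ∣ 40 :=
      (Sylow.card_dvd_index P).trans ((Subgroup.index_dvd_card _).trans h)
    have h2 : Nat.card (Sylow 5 G) % 5 = 1 := card_sylow_modEq_one 5 G
    have h3 : Nat.card (Sylow 5 G) ≤ 40 := Nat.le_of_dvd (by norm_num) h1
    generalize Nat.card (Sylow 5 G) = n at h1 h2 h3
    interval_cases n <;> omega
  have hs : Subsingleton (Sylow 5 G) := (Nat.card_eq_one_iff_unique.1 hn).1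
  have hN : (P : Subgroup G).Normal := Sylow.normal_of_subsingleton P
  rcases hN.eq_bot_or_eq_top with hb | ht
  · have h5 : ¬ 5 ∣ Nat.card G := by
      have := P.not_dvd_index
      rwa [hb, Subgroup.index_bot] at this
    have h8 : Nat.card G ∣ 2 ^ 3 := by
      have : Nat.Coprime (Nat.card G) 5 := ((Nat.Prime.coprime_iff_not_dvd f5.1).2 h5).symm
      exact this.dvd_of_dvd_mul_right (by simpa using h)
    obtain ⟨j, -, hj⟩ := (Nat.dvd_prime_pow f2.1).1 h8
    exact (IsPGroup.of_card hj).mul_comm_of_isSimpleGroup a b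
  · have := P.isPGroup'
    rw [ht] at this
    exact (this.of_equiv Subgroup.topEquiv).mul_comm_of_isSimpleGroup a b
section AlgebraOnModule
variable {k V : Type*} [Field k] [AddCommGroup V] [Module k V]
variable {m : V →ₗ[k] V →ₗ[k] V}
namespace IsIrredAlt
variable {G : Type*} [Group G] {ρ : G →* (V ≃ₗ[k] V)} (H : IsIrredAlt ρ m)
include H
theorem not_isCenter [Finite G] [IsSimpleGroup G] (hG : ¬ ∀ a b : G, a * b = b * a) {a : Dual k V} :
    ¬ IsCenter m a := by
  intro ha
  obtain ⟨f, hf⟩ := H.exists_hom_pentagonAut ha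
  refine hG (mul_comm_of_card_dvd_forty ?_)
  have hb := (IsSimpleGroup.eq_bot_or_eq_top_of_normal f.ker inferInstance).resolve_right hf
  have := Subgroup.card_dvd_of_injective f ((MonoidHom.ker_eq_bot_iff f).1 hb)
  rw [card_pentagonAut] at this
  exact this.trans (by norm_num)
end IsIrredAlt
end AlgebraOnModule

section AlgebraOnModule
variable {k V : Type*} [Field k] [AddCommGroup V] [Module k V]
variable {m : V →ₗ[k] V →ₗ[k] V}
/-- The basis `b` consists of eigenvectors, with eigenvalues `lam` of product one, of an
automorphism of the alternating product `m`, and `m` has no center. -/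
structure IsGraded (m : V →ₗ[k] V →ₗ[k] V) (b : Basis (Fin 5) k V) (lam : Fin 5 → k) : Prop where
  alt : ∀ x, m x x = 0
  coord_eq_zero : ∀ i j l, lam i * lam j ≠ lam l → b.coord l (m (b i) (b j)) = 0
  dual_eq_zero : ∀ ξ : Dual k V, (∀ x y, ξ (m x y) = 0) → ξ = 0
  not_isCenter : ∀ a, ¬ IsCenter m a
  prod_eq_one : ∏ i, lam i = 1

namespace IsGraded

variable {b : Basis (Fin 5) k V} {lam : Fin 5 → k} (B : IsGraded m b lam)
include B

theorem reindex (σ : Equiv.Perm (Fin 5)) : IsGraded m (b.reindex σ.symm) (lam ∘ σ) where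
  alt := B.alt
  coord_eq_zero i j l h := by
    have := B.coord_eq_zero (σ i) (σ j) (σ l) h
    simpa using this
  dual_eq_zero := B.dual_eq_zero
  not_isCenter := B.not_isCenter
  prod_eq_one := by
    rw [← B.prod_eq_one]
    exact Equiv.prod_comp σ lam

theorem lam_ne_zero (i : Fin 5) : lam i ≠ 0 := by
  intro h
  have := B.prod_eq_one
  rw [Finset.prod_eq_zero (Finset.mem_univ i) h] at this
  exact zero_ne_one this

theorem exists_mul_eq (l : Fin 5) : ∃ i j, i ≠ j ∧ lam i * lam j = lam l := by
  by_contra! hcon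
  have h0 : b.coord l = 0 := by
    refine B.dual_eq_zero _ fun x y => ?_
    have : m.compr₂ (b.coord l) = 0 := by
      refine b.ext fun i => b.ext fun j => ?_
      rw [LinearMap.compr₂_apply]
      rcases eq_or_ne i j with rfl | hij
      · simp [B.alt]
      · exact B.coord_eq_zero i j l (hcon i j hij)
    exact LinearMap.congr_fun (LinearMap.congr_fun this x) y
  have := LinearMap.congr_fun h0 (b l)
  simp at this

theorem false_of_pair {ξ ξ' a : Dual k V} (ha : a ≠ 0) (hξ : LinearIndependent k ![ξ, ξ'])
    (h : ∀ x y, a x = 0 → a y = 0 → ξ (m x y) = 0)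
    (h' : ∀ x y, a x = 0 → a y = 0 → ξ' (m x y) = 0) : False := by
  have : FiniteDimensional k V := b.finiteDimensional_of_finite
  exact B.not_isCenter a ⟨ha,
    two_le_finrank_of_pair (mem_divisibleBy.2 h) (mem_divisibleBy.2 h') hξ⟩

omit B in
theorem apply_eq_sum (ξ : Dual k V) (x y : V) :
    ξ (m x y) = ∑ i, ∑ j, b.coord i x * b.coord j y * ξ (m (b i) (b j)) := by
  conv_lhs => rw [← b.sum_repr x, ← b.sum_repr y]
  simp only [map_sum, map_smul, LinearMap.sum_apply, LinearMap.smul_apply, smul_eq_mul,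
    Basis.coord_apply, Finset.mul_sum, mul_assoc]
  rw [Finset.sum_comm]
  refine Finset.sum_congr rfl fun i _ => Finset.sum_congr rfl fun j _ => by ring

theorem vanish_of_coord {ξ : Dual k V} {c : Fin 5}
    (h : ∀ i j, i ≠ j → i ≠ c → j ≠ c → ξ (m (b i) (b j)) = 0) (x y : V)
    (hx : b.coord c x = 0) (hy : b.coord c y = 0) : ξ (m x y) = 0 := by
  rw [apply_eq_sum (b := b)]
  refine Finset.sum_eq_zero fun i _ => Finset.sum_eq_zero fun j _ => ?_
  rcases eq_or_ne i c with rfl | hi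
  · rw [hx]; ring
  rcases eq_or_ne j c with rfl | hj
  · rw [hy]; ring
  rcases eq_or_ne i j with rfl | hij
  · rw [B.alt, map_zero, mul_zero]
  · rw [h i j hij hi hj, mul_zero]

omit B in
theorem linearIndependent_pair {ξ ξ' : Dual k V}
    (h : ∀ s t : k, (∀ i, s * ξ (b i) + t * ξ' (b i) = 0) → s = 0 ∧ t = 0) :
    LinearIndependent k ![ξ, ξ'] := by
  rw [LinearIndependent.pair_iff]
  intro s t hst
  refine h s t fun i => ?_
  have := LinearMap.congr_fun hst (b i)
  simpa using this

omit B in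
theorem coord_ne_zero (i : Fin 5) : b.coord i ≠ 0 := fun h => by
  have := LinearMap.congr_fun h (b i)
  simp at this

theorem false_of_common {s t c : Fin 5} (hst : s ≠ t)
    (h : ∀ i j, i ≠ j → i ≠ c → j ≠ c → lam i * lam j ≠ lam s ∧ lam i * lam j ≠ lam t) :
    False := by
  refine B.false_of_pair (ξ := b.coord s) (ξ' := b.coord t) (a := b.coord c) (coord_ne_zero c)
    (linearIndependent_pair (b := b) fun u v huv => ?_)
    (B.vanish_of_coord fun i j hij hi hj => B.coord_eq_zero _ _ _ (h i j hij hi hj).1)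
    (B.vanish_of_coord fun i j hij hi hj => B.coord_eq_zero _ _ _ (h i j hij hi hj).2)
  have h1 := huv s
  have h2 := huv t
  simp [hst, hst.symm] at h1 h2
  exact ⟨h1, h2⟩

theorem false_of_two_ones (h0 : lam 0 = 1) (h1 : lam 1 = 1) (h2 : lam 2 ≠ 1) (h3 : lam 3 ≠ 1)
    (h4 : lam 4 ≠ 1) : False := by
  have hp := B.prod_eq_one
  rw [Fin.prod_univ_five, h0, h1] at hp
  refine B.false_of_common (s := 0) (t := 1) (c := 0) (by decide) ?_
  simp only [h0, h1, and_self]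
  have key : ∀ i j, i ≠ j → i ≠ 0 → j ≠ 0 → lam i * lam j ≠ 1 := by
    intro i j hij hi hj
    fin_cases i <;> fin_cases j <;> simp at hij hi hj ⊢ <;> grind
  exact key

omit B in
theorem exists_pair_orthogonal (c : Fin 3 → k) : ∃ p q : Fin 3 → k,
    p 0 * c 0 + p 1 * c 1 + p 2 * c 2 = 0 ∧ q 0 * c 0 + q 1 * c 1 + q 2 * c 2 = 0 ∧
      ∀ s t : k, (∀ i, s * p i + t * q i = 0) → s = 0 ∧ t = 0 := by
  simp only [Fin.forall_fin_succ, IsEmpty.forall_iff, and_true]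
  by_cases h0 : c 0 = 0
  · by_cases h1 : c 1 = 0
    · refine ⟨![1, 0, 0], ![0, 1, 0], ?_, ?_, fun s t => ?_⟩ <;> simp [h0, h1]
    · refine ⟨![1, 0, 0], ![0, c 2, - c 1], ?_, ?_, fun s t => ?_⟩ <;> simp [h0, h1] <;> grind
  · refine ⟨![c 1, - c 0, 0], ![c 2, 0, - c 0], ?_, ?_, fun s t => ?_⟩ <;> simp [h0] <;> grind

omit B in
theorem exists_orthogonal (w w' : Fin 3 → k) : ∃ a : Fin 3 → k, a ≠ 0 ∧
    a 0 * w 0 + a 1 * w 1 + a 2 * w 2 = 0 ∧ a 0 * w' 0 + a 1 * w' 1 + a 2 * w' 2 = 0 := by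
  obtain ⟨a, ha, h⟩ := (Submodule.ne_bot_iff _).1 (LinearMap.ker_ne_bot_of_finrank_lt
    (f := Matrix.toLin' !![w 0, w 1, w 2; w' 0, w' 1, w' 2]) (by simp))
  refine ⟨a, h, ?_⟩
  rw [LinearMap.mem_ker] at ha
  have h0 := congrFun ha 0
  have h1 := congrFun ha 1
  simp [Matrix.mulVec, dotProduct, Fin.sum_univ_three] at h0 h1
  exact ⟨by linear_combination h0, by linear_combination h1⟩

theorem vanish_of_three {ξ a : Dual k V} {p : Fin 3 → k} (hp : p ≠ 0)
    (ha : a = p 0 • b.coord 0 + p 1 • b.coord 1 + p 2 • b.coord 2)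
    (hξ : p 0 * ξ (m (b 1) (b 2)) + p 1 * ξ (m (b 2) (b 0)) + p 2 * ξ (m (b 0) (b 1)) = 0)
    (h : ∀ i j, i ≠ j → (j = 3 ∨ j = 4) → ξ (m (b i) (b j)) = 0) (x y : V)
    (hx : a x = 0) (hy : a y = 0) : ξ (m x y) = 0 := by
  have anti : ∀ i j, ξ (m (b i) (b j)) = - ξ (m (b j) (b i)) := fun i j => by
    rw [anticomm_of_alt B.alt, map_neg]
  have h' : ∀ i j, i ≠ j → (j = 3 ∨ j = 4) → ξ (m (b j) (b i)) = 0 := fun i j hij hj => by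
    rw [anti, h i j hij hj, neg_zero]
  have e : ξ (m x y) =
      (b.coord 1 x * b.coord 2 y - b.coord 2 x * b.coord 1 y) * ξ (m (b 1) (b 2)) +
      (b.coord 2 x * b.coord 0 y - b.coord 0 x * b.coord 2 y) * ξ (m (b 2) (b 0)) +
      (b.coord 0 x * b.coord 1 y - b.coord 1 x * b.coord 0 y) * ξ (m (b 0) (b 1)) := by
    rw [apply_eq_sum (b := b)]
    simp only [Fin.sum_univ_five, B.alt, map_zero]
    rw [h 0 3 (by decide) (by decide), h 0 4 (by decide) (by decide), h 1 3 (by decide) (by decide),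
      h 1 4 (by decide) (by decide), h 2 3 (by decide) (by decide), h 2 4 (by decide) (by decide),
      h 3 4 (by decide) (by decide), h' 0 3 (by decide) (by decide), h' 0 4 (by decide) (by decide),
      h' 1 3 (by decide) (by decide), h' 1 4 (by decide) (by decide),
      h' 2 3 (by decide) (by decide),
      h' 2 4 (by decide) (by decide), h' 3 4 (by decide) (by decide), anti 0 2, anti 1 0, anti 2 1]
    ring
  have hx' : p 0 * b.coord 0 x + p 1 * b.coord 1 x + p 2 * b.coord 2 x = 0 := by
    rw [ha] at hx; exact hx
  have hy' : p 0 * b.coord 0 y + p 1 * b.coord 1 y + p 2 * b.coord 2 y = 0 := by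
    rw [ha] at hy; exact hy
  rw [e]
  generalize b.coord 0 x = x0, b.coord 1 x = x1, b.coord 2 x = x2, b.coord 0 y = y0,
    b.coord 1 y = y1, b.coord 2 y = y2, ξ (m (b 1) (b 2)) = w0, ξ (m (b 2) (b 0)) = w1,
    ξ (m (b 0) (b 1)) = w2 at *
  by_contra hne
  refine hp (funext fun i => ?_)
  refine (mul_eq_zero.1 ?_).resolve_right hne
  fin_cases i
  · change p 0 * _ = 0
    linear_combination (x1 * y2 - x2 * y1) * hξ + (y2 * w1 - y1 * w2) * (-hx') +
      (x2 * w1 - x1 * w2) * hy'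
  · change p 1 * _ = 0
    linear_combination (x2 * y0 - x0 * y2) * hξ + (y2 * w0 - y0 * w2) * hx' -
      (x2 * w0 - x0 * w2) * hy'
  · change p 2 * _ = 0
    linear_combination (x0 * y1 - x1 * y0) * hξ + (y0 * w1 - y1 * w0) * hx' -
      (x0 * w1 - x1 * w0) * hy'

theorem false_of_three_ones (h0 : lam 0 = 1) (h1 : lam 1 = 1) (h2 : lam 2 = 1) (h3 : lam 3 ≠ 1) :
    False := by
  have hp := B.prod_eq_one
  rw [Fin.prod_univ_five, h0, h1, h2] at hp
  have h4 : lam 4 ≠ 1 := by grind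
  obtain ⟨p, q, hp, hq, hpq⟩ := exists_pair_orthogonal
    ![b.coord 0 (m (b 3) (b 4)), b.coord 1 (m (b 3) (b 4)), b.coord 2 (m (b 3) (b 4))]
  let ξ : (Fin 3 → k) → Dual k V := fun p =>
    p 0 • b.coord 0 + p 1 • b.coord 1 + p 2 • b.coord 2
  let w : (Fin 3 → k) → Fin 3 → k := fun p =>
    ![ξ p (m (b 1) (b 2)), ξ p (m (b 2) (b 0)), ξ p (m (b 0) (b 1))]
  obtain ⟨r, hr, hrp, hrq⟩ := exists_orthogonal (w p) (w q)
  have hv : ∀ p : Fin 3 → k, ξ p (m (b 3) (b 4)) = 0 →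
      ∀ i j, i ≠ j → (j = 3 ∨ j = 4) → ξ p (m (b i) (b j)) = 0 := by
    intro p hp i j hij hj
    have key : ∀ i, lam i = 1 → ξ p (m (b i) (b j)) = 0 := by
      intro i hi
      have e : ∀ l, lam l = 1 → b.coord l (m (b i) (b j)) = 0 := fun l hl =>
        B.coord_eq_zero _ _ _ (by rw [hi, hl, one_mul]; rcases hj with rfl | rfl <;> assumption)
      simp only [ξ, LinearMap.add_apply, LinearMap.smul_apply, e 0 h0, e 1 h1, e 2 h2, smul_zero,
        add_zero]
    fin_cases i
    · exact key 0 h0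
    · exact key 1 h1
    · exact key 2 h2
    · rcases hj with rfl | rfl
      · exact absurd rfl hij
      · exact hp
    · rcases hj with rfl | rfl
      · change ξ p (m (b 4) (b 3)) = 0
        rw [anticomm_of_alt B.alt, map_neg, hp, neg_zero]
      · exact absurd rfl hij
  have hb : ∀ p : Fin 3 → k, ξ p (b 0) = p 0 ∧ ξ p (b 1) = p 1 ∧ ξ p (b 2) = p 2 := by
    intro p
    simp [ξ]
  refine B.false_of_pair (ξ := ξ p) (ξ' := ξ q) (a := ξ r) (fun h => hr (funext fun i => ?_))
    (linearIndependent_pair (b := b) fun s t hst => hpq s t fun i => ?_)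
    (B.vanish_of_three hr rfl hrp (hv p hp)) (B.vanish_of_three hr rfl hrq (hv q hq))
  · have := hb r
    rw [h] at this
    fin_cases i
    · exact this.1.symm
    · exact this.2.1.symm
    · exact this.2.2.symm
  · fin_cases i
    · have := hst 0
      rwa [(hb p).1, (hb q).1] at this
    · have := hst 1
      rwa [(hb p).2.1, (hb q).2.1] at this
    · have := hst 2
      rwa [(hb p).2.2, (hb q).2.2] at this

theorem false_of_cube_roots (h0 : lam 0 = 1) (h1 : lam 1 = lam 3 ^ 2) (h2 : lam 2 = lam 3)
    (h4 : lam 4 = lam 3 ^ 2) (h : lam 3 ^ 3 = 1) (h3 : lam 3 ≠ 1) : False := by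
  obtain ⟨x, y, hxy, h14⟩ : ∃ x y : k, ¬ (x = 0 ∧ y = 0) ∧
      (x • b.coord 1 + y • b.coord 4) (m (b 2) (b 3)) = 0 := by
    by_cases hc : b.coord 1 (m (b 2) (b 3)) = 0
    · exact ⟨1, 0, by simp, by simp only [LinearMap.add_apply, LinearMap.smul_apply, hc]; simp⟩
    · refine ⟨b.coord 4 (m (b 2) (b 3)), - b.coord 1 (m (b 2) (b 3)),
        by simpa using fun _ => hc, ?_⟩
      simp only [LinearMap.add_apply, LinearMap.smul_apply, smul_eq_mul]
      ring
  obtain ⟨x', y', hxy', h23⟩ : ∃ x y : k, ¬ (x = 0 ∧ y = 0) ∧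
      (x • b.coord 2 + y • b.coord 3) (m (b 1) (b 4)) = 0 := by
    by_cases hc : b.coord 2 (m (b 1) (b 4)) = 0
    · exact ⟨1, 0, by simp, by simp only [LinearMap.add_apply, LinearMap.smul_apply, hc]; simp⟩
    · refine ⟨b.coord 3 (m (b 1) (b 4)), - b.coord 2 (m (b 1) (b 4)),
        by simpa using fun _ => hc, ?_⟩
      simp only [LinearMap.add_apply, LinearMap.smul_apply, smul_eq_mul]
      ring
  have key : ∀ l i j, l ≠ 0 → i ≠ 0 → j ≠ 0 → i ≠ j →
      (lam i = lam l ∨ lam j = lam l) → b.coord l (m (b i) (b j)) = 0 := by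
    intro l i j hl hi hj hij h
    refine B.coord_eq_zero _ _ _ fun h' => ?_
    have hn : ∀ i, i ≠ 0 → lam i ≠ 1 := by
      intro i hi
      fin_cases i <;> simp at hi ⊢ <;> grind
    rcases h with h | h
    · rw [← h] at h'
      exact hn j hj (mul_left_cancel₀ (B.lam_ne_zero i) (h'.trans (mul_one _).symm))
    · rw [← h] at h'
      exact hn i hi (mul_right_cancel₀ (B.lam_ne_zero j) (h'.trans (one_mul _).symm))
  have key' : ∀ (s t i j : Fin 5) (x y : k), s ≠ 0 → t ≠ 0 → i ≠ 0 → j ≠ 0 → i ≠ j → lam s = lam t →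
      (lam i = lam s ∨ lam j = lam s) → (x • b.coord s + y • b.coord t) (m (b i) (b j)) = 0 := by
    intro s t i j x y hs ht hi hj hij hst hl
    simp only [LinearMap.add_apply, LinearMap.smul_apply, key s i j hs hi hj hij hl,
      key t i j ht hi hj hij (by rwa [← hst]), smul_zero, add_zero]
  have anti : ∀ (ξ : Dual k V) i j, ξ (m (b i) (b j)) = 0 → ξ (m (b j) (b i)) = 0 :=
    fun ξ i j h => by rw [anticomm_of_alt B.alt, map_neg, h, neg_zero]
  refine B.false_of_pair (ξ := x • b.coord 1 + y • b.coord 4)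
    (ξ' := x' • b.coord 2 + y' • b.coord 3) (a := b.coord 0) (coord_ne_zero 0)
    (linearIndependent_pair (b := b) fun s t hst => ?_)
    (B.vanish_of_coord fun i j hij hi hj => ?_) (B.vanish_of_coord fun i j hij hi hj => ?_)
  · have e1 := hst 1
    have e2 := hst 2
    have e3 := hst 3
    have e4 := hst 4
    simp at e1 e2 e3 e4
    grind
  · by_cases hl : lam i = lam 1 ∨ lam j = lam 1
    · exact key' 1 4 i j x y (by decide) (by decide) hi hj hij (by rw [h1, h4]) hl
    · fin_cases i <;> fin_cases j <;> simp [h1, h4] at hij hi hj hl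
      · exact h14
      · exact anti _ _ _ h14
  · by_cases hl : lam i = lam 2 ∨ lam j = lam 2
    · exact key' 2 3 i j x' y' (by decide) (by decide) hi hj hij h2 hl
    · fin_cases i <;> fin_cases j <;> simp [h2] at hij hi hj hl
      · exact h23
      · exact anti _ _ _ h23

end IsGraded
end AlgebraOnModule

theorem exists_pair_of_prime_le_eleven {r : ℕ} (hr : r = 2 ∨ r = 3 ∨ r = 5 ∨ r = 7 ∨ r = 11)
    (y z : ZMod r) (e : Fin 5 → ZMod r) (he : e = ![1 + y, 1, y, z, -2 - 2 * y - z])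
    (h0 : ∀ i, e i ≠ 0) (h : ∀ l, ∃ i j, i ≠ j ∧ e i + e j = e l) :
    ∃ s t c : Fin 5, s ≠ t ∧
      ∀ i j, i ≠ j → i ≠ c → j ≠ c → e i + e j ≠ e s ∧ e i + e j ≠ e t := by
  subst he
  rcases hr with rfl | rfl | rfl | rfl | rfl <;> revert y z <;> decide +kernel

theorem false_of_sums_aux {K : Type*} [Field K] (h2 : (2 : K) ≠ 0) (h3 : (3 : K) ≠ 0)
    (h5 : (5 : K) ≠ 0) (h7 : (7 : K) ≠ 0) (h11 : (11 : K) ≠ 0) (y z : K) (hy : y ≠ 0) (hz : z ≠ 0)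
    (hw : 1 + y ≠ 0) (hu : -2 - 2 * y - z ≠ 0)
    (e1 : z = - y ∨ z = - 2 - y ∨ z = 1 - y ∨ z = - 3 - y ∨ 3 = - 2 * y)
    (e2 : z = - 1 ∨ z = - 1 - 2 * y ∨ z = y - 1 ∨ z = - 1 - 3 * y ∨ 3 * y = - 2)
    (e3 : z = 2 + y ∨ z = 1 + 2 * y ∨ z = 1 + y ∨ 2 * z = - 1 - y ∨ 2 * z = - 1 - 2 * y ∨
      2 * z = - 2 - y)
    (e4 : -2 - 2 * y - z = 2 + y ∨ -2 - 2 * y - z = 1 + 2 * y ∨ -2 - 2 * y - z = 1 + y ∨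
      2 * (-2 - 2 * y - z) = - 1 - y ∨ 2 * (-2 - 2 * y - z) = - 1 - 2 * y ∨
      2 * (-2 - 2 * y - z) = - 2 - y) : False := by
  have h4 : (4 : K) ≠ 0 := fun h => h2 (by
    simpa using (show (2 : K) ^ 2 = 0 by linear_combination h))
  have h8 : (8 : K) ≠ 0 := fun h => h2 (by
    simpa using (show (2 : K) ^ 3 = 0 by linear_combination h))
  have h9 : (9 : K) ≠ 0 := fun h => h3 (by
    simpa using (show (3 : K) ^ 2 = 0 by linear_combination h))
  have h6 : (6 : K) ≠ 0 := fun h => mul_ne_zero h2 h3 (by linear_combination h)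
  rcases e1 with e1 | e1 | e1 | e1 | e1 <;> rcases e2 with e2 | e2 | e2 | e2 | e2 <;> grind

theorem false_of_sums {K : Type*} [Field K] (h2 : (2 : K) ≠ 0) (h3 : (3 : K) ≠ 0)
    (h5 : (5 : K) ≠ 0) (h7 : (7 : K) ≠ 0) (h11 : (11 : K) ≠ 0) (y z : K) (e : Fin 5 → K)
    (he : e = ![1 + y, 1, y, z, -2 - 2 * y - z])
    (h0 : ∀ i, e i ≠ 0) (h : ∀ l, ∃ i j, i < j ∧ e i + e j = e l) : False := by
  have hy : y ≠ 0 := by simpa [he] using h0 2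
  have hz : z ≠ 0 := by simpa [he] using h0 3
  have hw : 1 + y ≠ 0 := by simpa [he] using h0 0
  have hu : -2 - 2 * y - z ≠ 0 := by simpa [he] using h0 4
  refine false_of_sums_aux h2 h3 h5 h7 h11 y z hy hz hw hu ?_ ?_ ?_ ?_
  · obtain ⟨i, j, hij, hs⟩ := h 1
    fin_cases i <;> fin_cases j <;> simp [he] at hij hs <;> grind
  · obtain ⟨i, j, hij, hs⟩ := h 2
    fin_cases i <;> fin_cases j <;> simp [he] at hij hs <;> grind
  · obtain ⟨i, j, hij, hs⟩ := h 3
    fin_cases i <;> fin_cases j <;> simp [he] at hij hs <;> grind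
  · obtain ⟨i, j, hij, hs⟩ := h 4
    fin_cases i <;> fin_cases j <;> simp [he] at hij hs <;> grind

theorem exists_perm_fin_five : ∀ i j l : Fin 5, i ≠ j → i ≠ l → j ≠ l →
    ∃ σ : Equiv.Perm (Fin 5), σ 0 = i ∧ σ 1 = j ∧ σ 2 = l := by
  decide +kernel
section AlgebraOnModule
variable {k V : Type*} [Field k] [AddCommGroup V] [Module k V]
variable {m : V →ₗ[k] V →ₗ[k] V}
namespace IsGraded
variable {b : Basis (Fin 5) k V} {lam : Fin 5 → k} (B : IsGraded m b lam)
include B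
theorem pow_five_of_one_of_mul_eq_one (h0 : lam 0 = 1) (hne : ∀ i, i ≠ 0 → lam i ≠ 1)
    (h12 : lam 1 * lam 2 = 1) :
    Function.Injective lam ∧ ∀ i, lam i ^ 5 = 1 := by
  have hp := B.prod_eq_one
  rw [Fin.prod_univ_five, h0] at hp
  have h34 : lam 3 * lam 4 = 1 := by
    rw [one_mul, h12, one_mul] at hp
    exact hp
  have n1 := hne 1 (by decide)
  have n2 := hne 2 (by decide)
  have n3 := hne 3 (by decide)
  have n4 := hne 4 (by decide)
  have z1 := B.lam_ne_zero 1
  have z2 := B.lam_ne_zero 2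
  have z3 := B.lam_ne_zero 3
  have z4 := B.lam_ne_zero 4
  have A : lam 1 = lam 3 ^ 2 ∨ lam 1 = lam 4 ^ 2 := by
    by_contra! hcon
    refine B.false_of_common (s := 3) (t := 4) (c := 0) (by decide) fun i j hij hi hj => ?_
    clear B hne hp
    fin_cases i <;> fin_cases j <;> simp at hij hi hj ⊢ <;> clear hij hi hj <;> grind
  have A' : lam 3 = lam 1 ^ 2 ∨ lam 3 = lam 2 ^ 2 := by
    by_contra! hcon
    refine B.false_of_common (s := 1) (t := 2) (c := 0) (by decide) fun i j hij hi hj => ?_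
    clear B hne hp
    fin_cases i <;> fin_cases j <;> simp at hij hi hj ⊢ <;> clear hij hi hj <;> grind
  have five : lam 3 ^ 5 = 1 → lam 1 = lam 3 ^ 2 ∨ lam 1 = lam 3 ^ 3 →
      Function.Injective lam ∧ ∀ i, lam i ^ 5 = 1 := by
    intro h5 h1
    have f5 : Fact (Nat.Prime 5) := ⟨by norm_num⟩
    have hprim : IsPrimitiveRoot (lam 3) 5 :=
      IsPrimitiveRoot.iff_orderOf.2 (orderOf_eq_prime h5 n3)
    have h4 : lam 4 = lam 3 ^ 4 := by
      refine mul_left_cancel₀ z3 ?_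
      rw [h34, ← pow_succ', h5]
    have : ∃ e : Fin 5 → ℕ, Function.Injective e ∧ (∀ i, e i < 5) ∧ ∀ i, lam i = lam 3 ^ e i := by
      rcases h1 with h1 | h1
      · have h2 : lam 2 = lam 3 ^ 3 := by
          refine mul_left_cancel₀ z1 ?_
          rw [h12, h1, ← pow_add, h5]
        refine ⟨![0, 2, 3, 1, 4], by decide, by decide, fun i => ?_⟩
        fin_cases i <;> simp [h0, h1, h2, h4]
      · have h2 : lam 2 = lam 3 ^ 2 := by
          refine mul_left_cancel₀ z1 ?_
          rw [h12, h1, ← pow_add, h5]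
        refine ⟨![0, 3, 2, 1, 4], by decide, by decide, fun i => ?_⟩
        fin_cases i <;> simp [h0, h1, h2, h4]
    obtain ⟨e, he, he5, h⟩ := this
    refine ⟨fun i j hij => he (hprim.pow_inj (he5 i) (he5 j) ?_), fun i => ?_⟩
    · rw [← h, ← h, hij]
    · rw [h, ← pow_mul, mul_comm, pow_mul, h5, one_pow]
  rcases A with A | A <;> rcases A' with A' | A'
  · have h3 : lam 3 ^ 3 = 1 := by
      refine mul_left_cancel₀ z3 ?_
      rw [← pow_succ', mul_one]
      conv_rhs => rw [A', A]
      ring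
    have h2 : lam 2 = lam 3 := by
      refine mul_left_cancel₀ z1 ?_
      rw [h12, A, ← pow_succ, h3]
    have h4 : lam 4 = lam 3 ^ 2 := by
      refine mul_left_cancel₀ z3 ?_
      rw [h34, ← pow_succ', h3]
    exact (B.false_of_cube_roots h0 A h2 h4 h3 n3).elim
  · refine five ?_ (Or.inl A)
    calc lam 3 ^ 5 = (lam 3 ^ 2) ^ 2 * lam 3 := by ring
      _ = lam 1 ^ 2 * lam 2 ^ 2 := congrArg₂ _ (by rw [A]) A'
      _ = 1 := by rw [← mul_pow, h12, one_pow]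
  · have h5 : lam 3 ^ 5 = 1 := by
      have : lam 4 ^ 4 = lam 3 := by rw [A', A]; ring
      calc lam 3 ^ 5 = lam 3 ^ 4 * lam 3 := by ring
        _ = (lam 3 * lam 4) ^ 4 := by rw [mul_pow, this]
        _ = 1 := by rw [h34, one_pow]
    refine five h5 (Or.inr ?_)
    refine mul_right_cancel₀ (pow_ne_zero 2 z3) ?_
    rw [← pow_add, h5, A, ← mul_pow, mul_comm, h34, one_pow]
  · have e : lam 4 ^ 4 * lam 3 = 1 := by
      calc lam 4 ^ 4 * lam 3 = (lam 4 ^ 2) ^ 2 * lam 3 := by ring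
        _ = lam 1 ^ 2 * lam 2 ^ 2 := congrArg₂ _ (by rw [A]) A'
        _ = 1 := by rw [← mul_pow, h12, one_pow]
    have h3 : lam 3 ^ 3 = 1 := by
      calc lam 3 ^ 3 = (lam 4 ^ 4 * lam 3) * lam 3 ^ 3 := by rw [e, one_mul]
        _ = (lam 3 * lam 4) ^ 4 := by ring
        _ = 1 := by rw [h34, one_pow]
    have h1 : lam 1 = lam 3 := by
      calc lam 1 = lam 4 ^ 2 * lam 3 ^ 3 := by rw [A, h3, mul_one]
        _ = (lam 3 * lam 4) ^ 2 * lam 3 := by ring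
        _ = lam 3 := by rw [h34, one_pow, one_mul]
    have h2 : lam 2 = lam 3 ^ 2 := by
      refine mul_left_cancel₀ z1 ?_
      rw [h12, h1, ← pow_succ', h3]
    have h4 : lam 4 = lam 3 ^ 2 := by
      refine mul_left_cancel₀ z3 ?_
      rw [h34, ← pow_succ', h3]
    refine ((B.reindex (Equiv.swap 1 2)).false_of_cube_roots ?_ ?_ ?_ ?_ ?_ ?_).elim
    · exact h0
    · exact h2
    · exact h1
    · exact h4
    · exact h3
    · exact n3

theorem pow_five_of_eigenvalue_one (h1 : ∃ i, lam i = 1) (hne : ∃ i, lam i ≠ 1) :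
    Function.Injective lam ∧ ∀ i, lam i ^ 5 = 1 := by
  by_cases h2 : ∃ i j, i ≠ j ∧ lam i = 1 ∧ lam j = 1
  · exfalso
    obtain ⟨i, j, hij, hi, hj⟩ := h2
    by_cases h3 : ∃ l, i ≠ l ∧ j ≠ l ∧ lam l = 1
    · obtain ⟨l, hil, hjl, hl⟩ := h3
      obtain ⟨σ, rfl, rfl, rfl⟩ := exists_perm_fin_five i j l hij hil hjl
      have B' := B.reindex σ
      refine B'.false_of_three_ones hi hj hl fun h3 => ?_
      have hp := B'.prod_eq_one
      rw [Fin.prod_univ_five, show (lam ∘ σ) 0 = 1 from hi, show (lam ∘ σ) 1 = 1 from hj,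
        show (lam ∘ σ) 2 = 1 from hl, h3] at hp
      simp only [one_mul] at hp
      obtain ⟨u, hu⟩ := hne
      obtain ⟨v, rfl⟩ := σ.surjective u
      fin_cases v
      · exact hu hi
      · exact hu hj
      · exact hu hl
      · exact hu h3
      · exact hu hp
    · push Not at h3
      obtain ⟨l, hil, hjl⟩ : ∃ l, i ≠ l ∧ j ≠ l := by clear * -; revert i j; decide
      obtain ⟨σ, rfl, rfl, rfl⟩ := exists_perm_fin_five i j l hij hil hjl
      exact (B.reindex σ).false_of_two_ones hi hj (h3 _ (by simp) (by simp))
        (h3 _ (by simp) (by simp)) (h3 _ (by simp) (by simp))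
  · push Not at h2
    obtain ⟨i, hi⟩ := h1
    have hu : ∀ u, u ≠ i → lam u ≠ 1 := fun u hu => h2 i u hu.symm hi
    obtain ⟨j, l, hjl, h⟩ := B.exists_mul_eq i
    rw [hi] at h
    have hj : i ≠ j := by
      rintro rfl
      rw [hi, one_mul] at h
      exact hu l hjl.symm h
    have hl : i ≠ l := by
      rintro rfl
      rw [hi, mul_one] at h
      exact hu j hjl h
    obtain ⟨σ, rfl, rfl, rfl⟩ := exists_perm_fin_five i j l hj hl hjl
    have := (B.reindex σ).pow_five_of_one_of_mul_eq_one hi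
      (fun u h => hu _ fun h' => h (σ.injective h')) h
    refine ⟨?_, fun u => ?_⟩
    · have h' := this.1.comp σ.symm.injective
      rwa [Function.comp_assoc, Equiv.self_comp_symm, Function.comp_id] at h'
    · simpa using this.2 (σ.symm u)

theorem exists_eigenvalue_one {r : ℕ} (hr : r.Prime) (h : ∀ i, lam i ^ r = 1) :
    ∃ i, lam i = 1 := by
  by_contra! hne
  have fr : Fact r.Prime := ⟨hr⟩
  obtain ⟨i, j, hij, hs⟩ := B.exists_mul_eq 0
  have hi : (0 : Fin 5) ≠ i := by
    rintro rfl
    exact hne j (mul_left_cancel₀ (B.lam_ne_zero 0) (hs.trans (mul_one _).symm))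
  have hj : (0 : Fin 5) ≠ j := by
    rintro rfl
    exact hne i (mul_right_cancel₀ (B.lam_ne_zero 0) (hs.trans (one_mul _).symm))
  obtain ⟨σ, h0, h1, h2⟩ := exists_perm_fin_five 0 i j hi hj hij
  have B' := B.reindex σ
  have hs' : (lam ∘ σ) 1 * (lam ∘ σ) 2 = (lam ∘ σ) 0 := by
    simp only [Function.comp_apply, h0, h1, h2, hs]
  have h' : ∀ i, (lam ∘ σ) i ^ r = 1 := fun i => h _
  have hne' : ∀ i, (lam ∘ σ) i ≠ 1 := fun i => hne _
  generalize lam ∘ σ = μ at B' hs' h' hne'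
  have hord : orderOf (μ 1) = r := orderOf_eq_prime (h' 1) (hne' 1)
  have hprim : IsPrimitiveRoot (μ 1) r := IsPrimitiveRoot.iff_orderOf.2 hord
  have hpow : ∀ a c : ℕ, (a : ZMod r) = c ↔ μ 1 ^ a = μ 1 ^ c := fun a c => by
    have h0 : IsUnit (μ 1) := (B'.lam_ne_zero 1).isUnit
    rw [ZMod.natCast_eq_natCast_iff, ← hord, ← h0.unit_spec, orderOf_units,
      ← Units.val_pow_eq_pow_val,
      ← Units.val_pow_eq_pow_val, Units.val_inj, pow_eq_pow_iff_modEq]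
  have hex : ∀ i, ∃ e : ℕ, μ i = μ 1 ^ e := fun i => by
    obtain ⟨e, -, he⟩ := hprim.eq_pow_of_pow_eq_one (h' i)
    exact ⟨e, he.symm⟩
  choose e he using hex
  let E : Fin 5 → ZMod r := fun i => e i
  have hE : ∀ i j l, E i + E j = E l ↔ μ i * μ j = μ l := fun i j l => by
    simp only [E]
    rw [← Nat.cast_add, hpow, pow_add, ← he, ← he, ← he]
  have hE0 : ∀ i, E i ≠ 0 := fun i hi => hne' i <| by
    rw [he, ← pow_zero (μ 1), ← hpow, Nat.cast_zero]
    exact hi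
  have hE1 : E 1 = 1 := by
    simp only [E]
    rw [← Nat.cast_one, hpow, pow_one, ← he]
  have hsum : E 0 + E 1 + E 2 + E 3 + E 4 = 0 := by
    simp only [E]
    rw [← Nat.cast_add, ← Nat.cast_add, ← Nat.cast_add, ← Nat.cast_add, ← Nat.cast_zero, hpow,
      pow_add, pow_add, pow_add, pow_add, ← he, ← he, ← he, ← he, ← he, pow_zero,
      ← B'.prod_eq_one, Fin.prod_univ_five]
  have hE2 : E 0 = E 1 + E 2 := ((hE 1 2 0).2 hs').symm
  have hform : E = ![1 + E 2, 1, E 2, E 3, -2 - 2 * E 2 - E 3] := by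
    funext i
    fin_cases i
    · exact hE2.trans (by rw [hE1]; rfl)
    · exact hE1
    · rfl
    · rfl
    · change E 4 = -2 - 2 * E 2 - E 3
      rw [hE2, hE1] at hsum
      linear_combination hsum
  have hexE : ∀ l, ∃ i j, i ≠ j ∧ E i + E j = E l := fun l => by
    obtain ⟨i, j, hij, h⟩ := B'.exists_mul_eq l
    exact ⟨i, j, hij, (hE i j l).2 h⟩
  by_cases hsmall : r = 2 ∨ r = 3 ∨ r = 5 ∨ r = 7 ∨ r = 11
  · obtain ⟨s, t, c, hst, h⟩ := exists_pair_of_prime_le_eleven hsmall (E 2) (E 3) E hform hE0 hexE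
    exact B'.false_of_common hst fun i j hij hi hj =>
      ⟨fun h' => (h i j hij hi hj).1 ((hE _ _ _).2 h'),
        fun h' => (h i j hij hi hj).2 ((hE _ _ _).2 h')⟩
  · push Not at hsmall
    obtain ⟨n2, n3, n5, n7, n11⟩ := hsmall
    have hz : ∀ s : ℕ, s.Prime → r ≠ s → (s : ZMod r) ≠ 0 := fun s hs hrs h =>
      hrs ((Nat.prime_dvd_prime_iff_eq hr hs).1 ((ZMod.natCast_eq_zero_iff _ _).1 h))
    refine false_of_sums (by exact_mod_cast hz 2 (by norm_num) n2)
      (by exact_mod_cast hz 3 (by norm_num) n3) (by exact_mod_cast hz 5 (by norm_num) n5)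
      (by exact_mod_cast hz 7 (by norm_num) n7) (by exact_mod_cast hz 11 (by norm_num) n11)
      (E 2) (E 3) E hform hE0 fun l => ?_
    obtain ⟨i, j, hij, h⟩ := hexE l
    rcases lt_or_gt_of_ne hij with hlt | hlt
    · exact ⟨i, j, hlt, h⟩
    · exact ⟨j, i, hlt, by rwa [add_comm]⟩

theorem injective_of_prime_pow {r : ℕ} (hr : r.Prime) (h : ∀ i, lam i ^ r = 1)
    (hne : ∃ i, lam i ≠ 1) : r = 5 ∧ Function.Injective lam := by
  obtain ⟨hinj, h5⟩ := B.pow_five_of_eigenvalue_one (B.exists_eigenvalue_one hr h) hne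
  obtain ⟨i, hi⟩ := hne
  have fr : Fact r.Prime := ⟨hr⟩
  have f5 : Fact (Nat.Prime 5) := ⟨by norm_num⟩
  exact ⟨(orderOf_eq_prime (h i) hi).symm.trans (orderOf_eq_prime (h5 i) hi), hinj⟩
end IsGraded
end AlgebraOnModule

theorem exists_eigenbasis_of_pow_eq_one {k V : Type*} [Field k] [IsAlgClosed k] [AddCommGroup V]
    [Module k V] (hV : finrank k V = 5) {f : V →ₗ[k] V} {n : ℕ} (hn : (n : k) ≠ 0)
    (hf : f ^ n = 1) :
    ∃ (b : Basis (Fin 5) k V) (lam : Fin 5 → k), ∀ i, f (b i) = lam i • b i := by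
  classical
  have fd : FiniteDimensional k V := FiniteDimensional.of_finrank_pos (by omega)
  have hss : Module.End.IsSemisimple f := by
    refine Module.End.isSemisimple_of_squarefree_aeval_eq_zero
      (p := Polynomial.X ^ n - 1) (Polynomial.X_pow_sub_one_separable_iff.2 hn).squarefree ?_
    simp [hf]
  let D := DirectSum.isInternal_submodule_of_iSupIndep_of_iSup_eq_top
    (End.eigenspaces_iSupIndep f) hss.iSup_eigenspace_eq_top
  let v := D.collectedBasis fun μ => finBasis k (End.eigenspace f μ)
  have := FiniteDimensional.fintypeBasisIndex v
  have hc := Module.finrank_eq_card_basis v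
  rw [hV] at hc
  let e := Fintype.equivFinOfCardEq hc.symm
  refine ⟨v.reindex e, fun i => (e.symm i).1, fun i => ?_⟩
  rw [Basis.reindex_apply]
  exact End.mem_eigenspace_iff.1 (D.collectedBasis_mem _ _)

theorem MonoidHom.eq_one_of_isSimpleGroup {G A : Type*} [Group G] [IsSimpleGroup G] [CommGroup A]
    (hG : ¬ ∀ a b : G, a * b = b * a) (f : G →* A) (g : G) : f g = 1 := by
  rcases IsSimpleGroup.eq_bot_or_eq_top_of_normal f.ker inferInstance with h | h
  · refine absurd (fun a b => ?_) hG
    exact (MonoidHom.ker_eq_bot_iff f).1 h (by rw [_root_.map_mul, _root_.map_mul, mul_comm])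
  · exact MonoidHom.mem_ker.1 (h ▸ Subgroup.mem_top g)
section AlgebraOnModule
variable {k V : Type*} [Field k] [AddCommGroup V] [Module k V]
variable {m : V →ₗ[k] V →ₗ[k] V}
namespace IsIrredAlt
variable {G : Type*} [Group G] {ρ : G →* (V ≃ₗ[k] V)} (H : IsIrredAlt ρ m)
include H
theorem det_eq_one [IsSimpleGroup G] (hG : ¬ ∀ a b : G, a * b = b * a) (g : G) :
    LinearMap.det (ρ g : V →ₗ[k] V) = 1 := by
  have h := MonoidHom.eq_one_of_isSimpleGroup hG (LinearEquiv.det.comp ρ) g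
  simpa using congrArg Units.val h

theorem isGraded [Finite G] [IsSimpleGroup G] (hG : ¬ ∀ a b : G, a * b = b * a) {g : G}
    {b : Basis (Fin 5) k V} {lam : Fin 5 → k} (hb : ∀ i, ρ g (b i) = lam i • b i) :
    IsGraded m b lam where
  alt := H.alt
  coord_eq_zero i j l h := by
    have h1 : ∀ x, b.coord l (ρ g x) = lam l * b.coord l x := by
      intro x
      have : (b.coord l).comp (ρ g : V →ₗ[k] V) = lam l • b.coord l := by
        refine b.ext fun i => ?_
        by_cases hi : i = l
        · subst hi; simp [hb]
        · simp [hb, hi]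
      exact LinearMap.congr_fun this x
    have h2 := h1 (m (b i) (b j))
    rw [H.map_mul, hb, hb] at h2
    simp only [map_smul, LinearMap.smul_apply, smul_eq_mul] at h2
    have h3 : (lam i * lam j - lam l) * b.coord l (m (b i) (b j)) = 0 := by
      linear_combination h2
    exact (mul_eq_zero.1 h3).resolve_left (sub_ne_zero.2 h)
  dual_eq_zero _ h := H.dual_eq_zero h
  not_isCenter _ := H.not_isCenter hG
  prod_eq_one := by
    have h := H.det_eq_one hG g
    have hm : LinearMap.toMatrix b b (ρ g : V →ₗ[k] V) = Matrix.diagonal lam := by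
      ext i j
      rw [LinearMap.toMatrix_apply]
      by_cases hij : j = i
      · subst hij; simp [hb]
      · simp [hb, Ne.symm hij]
    rw [← LinearMap.det_toMatrix b, hm, Matrix.det_diagonal] at h
    exact h
end IsIrredAlt
end AlgebraOnModule

theorem coord_map_of_eigenbasis {k V ι : Type*} [Field k] [AddCommGroup V] [Module k V]
    {b : Basis ι k V} {lam : ι → k} {f : V →ₗ[k] V} (hb : ∀ i, f (b i) = lam i • b i) (l : ι)
    (x : V) : b.coord l (f x) = lam l * b.coord l x := by
  classical
  have : (b.coord l).comp f = lam l • b.coord l := by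
    refine b.ext fun i => ?_
    by_cases hi : i = l
    · subst hi; simp [hb]
    · simp [hb, hi]
  exact LinearMap.congr_fun this x

/-- For an eigenbasis with distinct eigenvalues, every eigenvector is a multiple of a basis
vector. -/
theorem exists_eq_smul_of_eigenvector {k V ι : Type*} [Field k] [AddCommGroup V] [Module k V]
    {b : Basis ι k V} {lam : ι → k} {f : V →ₗ[k] V} (hb : ∀ i, f (b i) = lam i • b i)
    (hinj : Function.Injective lam) {x : V} {t : k} (hx : f x = t • x) (hx0 : x ≠ 0) :
    ∃ j, lam j = t ∧ x = b.coord j x • b j := by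
  classical
  have h1 : ∀ l, (lam l - t) * b.coord l x = 0 := by
    intro l
    have := coord_map_of_eigenbasis hb l x
    rw [hx, map_smul, smul_eq_mul] at this
    linear_combination -this
  obtain ⟨j, hj⟩ : ∃ j, b.coord j x ≠ 0 := by
    by_contra! hcon
    exact hx0 (b.forall_coord_eq_zero_iff.1 hcon)
  have hjt : lam j = t := sub_eq_zero.1 ((mul_eq_zero.1 (h1 j)).resolve_right hj)
  refine ⟨j, hjt, b.ext_elem fun l => ?_⟩
  by_cases hl : l = j
  · subst hl; simp
  · have h2 : b.coord l x = 0 :=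
      (mul_eq_zero.1 (h1 l)).resolve_left fun h => hl (hinj ((sub_eq_zero.1 h).trans hjt.symm))
    have h3 : b.repr x l = 0 := h2
    simp [h3, Ne.symm hl]

theorem Equiv.Perm.fixes_two_or_of_prime_pow {s : ℕ} (hs : s.Prime) (hs5 : s ≠ 5)
    (σ : Equiv.Perm (Fin 5)) (hσ : σ ^ s = 1) :
    (∃ i j, i ≠ j ∧ σ i = i ∧ σ j = j) ∨
      (s = 2 ∧ ∃ i j l, i ≠ j ∧ j ≠ l ∧ σ i = i ∧ σ j = l ∧ σ l = j) := by
  have h120 : orderOf σ ∣ 120 := by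
    have := orderOf_dvd_card (x := σ)
    rwa [Fintype.card_perm] at this
  have h1 := (Nat.dvd_prime hs).1 (orderOf_dvd_of_pow_eq_one hσ)
  rcases h1 with h1 | h1
  · rw [orderOf_eq_one_iff] at h1
    subst h1
    exact Or.inl ⟨0, 1, by decide, rfl, rfl⟩
  · rw [h1] at h120
    have h2 : s ∣ 2 ^ 3 * (3 * 5) := h120
    rcases (hs.dvd_mul).1 h2 with h | h
    · have := (Nat.prime_dvd_prime_iff_eq hs Nat.prime_two).1 (hs.dvd_of_dvd_pow h)
      subst this
      clear h1 h120
      revert σ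
      decide +kernel
    · rcases (hs.dvd_mul).1 h with h | h
      · have := (Nat.prime_dvd_prime_iff_eq hs Nat.prime_three).1 h
        subst this
        left
        clear h1 h120
        revert σ
        decide +kernel
      · exact absurd ((Nat.prime_dvd_prime_iff_eq hs Nat.prime_five).1 h) hs5

/-- A finite group all of whose prime-order elements have order `r` is an `r`-group. -/
theorem IsPGroup.of_forall_prime {G : Type*} [Group G] [Finite G] {r : ℕ} [Fact r.Prime]
    (h : ∀ (s : ℕ) (x : G), s.Prime → orderOf x = s → s = r) : IsPGroup r G := by
  refine IsPGroup.of_card (n := (Nat.card G).primeFactorsList.length) ?_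
  refine Nat.eq_prime_pow_of_unique_prime_dvd Nat.card_pos.ne' fun {d} hd hdvd => ?_
  have : Fact d.Prime := ⟨hd⟩
  obtain ⟨x, hx⟩ := exists_prime_orderOf_dvd_card' d hdvd
  exact h d x hd hx

/-- The diagonal coefficients of `ρ x` in the basis `b`. -/
noncomputable def diagCoeff {k V G ι : Type*} [Field k] [AddCommGroup V] [Module k V] [Group G]
    (ρ : G →* (V ≃ₗ[k] V)) (b : Basis ι k V) (x : G) (i : ι) : k :=
  b.coord i (ρ x (b i))

section Faithful

variable {k V G ι : Type*} [Field k] [AddCommGroup V] [Module k V] [Group G]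
  {ρ : G →* (V ≃ₗ[k] V)} {b : Basis ι k V}

theorem eq_one_of_forall_basis (hρ : Function.Injective ρ) {x : G}
    (h : ∀ i, ρ x (b i) = b i) : x = 1 := by
  refine hρ (LinearEquiv.toLinearMap_injective (b.ext fun i => ?_))
  simpa using h i

theorem eq_of_forall_basis (hρ : Function.Injective ρ) {x y : G}
    (h : ∀ i, ρ x (b i) = ρ y (b i)) : x = y :=
  hρ (LinearEquiv.toLinearMap_injective (b.ext fun i => h i))

theorem map_basis_eq_diagCoeff_smul {lam : ι → k} {g c : G} (hb : ∀ i, ρ g (b i) = lam i • b i)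
    (hinj : Function.Injective lam) (hc : c * g = g * c) (i : ι) :
    ρ c (b i) = diagCoeff ρ b c i • b i := by
  have h1 : ρ g (ρ c (b i)) = lam i • ρ c (b i) := by
    have : ρ g * ρ c = ρ c * ρ g := by rw [← map_mul, ← map_mul, hc]
    have h2 : ρ g (ρ c (b i)) = ρ c (ρ g (b i)) := LinearEquiv.congr_fun this (b i)
    rw [h2, hb, map_smul]
  obtain ⟨j, hj, hx⟩ := exists_eq_smul_of_eigenvector (f := (ρ g : V →ₗ[k] V)) hb hinj h1
    ((ρ c).map_ne_zero_iff.2 (b.ne_zero i))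
  have := hinj hj
  subst this
  exact hx

theorem diagCoeff_eq {t : k} {x : G} {i : ι} (h : ρ x (b i) = t • b i) :
    diagCoeff ρ b x i = t := by
  simp [diagCoeff, h]

theorem diagCoeff_mul {x y : G} (hx : ∀ i, ρ x (b i) = diagCoeff ρ b x i • b i)
    (hy : ∀ i, ρ y (b i) = diagCoeff ρ b y i • b i) (i : ι) :
    diagCoeff ρ b (x * y) i = diagCoeff ρ b x i * diagCoeff ρ b y i := by
  refine diagCoeff_eq ?_
  rw [map_mul, LinearEquiv.mul_apply, hy, map_smul, hx, smul_smul, mul_comm]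

theorem map_pow_basis {x : G} {mu : ι → k} (hx : ∀ i, ρ x (b i) = mu i • b i) (n : ℕ) (i : ι) :
    ρ (x ^ n) (b i) = mu i ^ n • b i := by
  induction n with
  | zero => simp
  | succ n ih =>
    rw [pow_succ, map_mul, LinearEquiv.mul_apply, hx, map_smul, ih, smul_smul, pow_succ, mul_comm]

theorem pow_eq_one_of_map_basis {x : G} {mu : ι → k} (hx : ∀ i, ρ x (b i) = mu i • b i) {n : ℕ}
    (h : x ^ n = 1) (i : ι) : mu i ^ n = 1 := by
  have h1 := map_pow_basis hx n i
  rw [h, map_one] at h1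
  have h2 := congrArg (b.coord i) h1
  simpa using h2.symm

theorem exists_perm_of_eigenvectors [Finite ι] {h : G}
    (hx : ∀ i, ∃ j, ∃ t : k, ρ h (b i) = t • b j) :
    ∃ (σ : Equiv.Perm ι) (τ : ι → k), (∀ i, τ i ≠ 0) ∧ ∀ i, ρ h (b i) = τ i • b (σ i) := by
  choose σ τ hστ using hx
  have hτ : ∀ i, τ i ≠ 0 := by
    intro i h0
    have := hστ i
    rw [h0, zero_smul] at this
    exact b.ne_zero i ((ρ h).map_eq_zero_iff.1 this)
  have hinj : Function.Injective σ := by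
    intro i j hij
    by_contra hne
    have h1 : ρ h (τ j • b i - τ i • b j) = 0 := by
      rw [map_sub, map_smul, map_smul, hστ, hστ, hij, smul_smul, smul_smul, mul_comm, sub_self]
    have h2 := congrArg (b.coord i) ((ρ h).map_eq_zero_iff.1 h1)
    simp [Ne.symm hne, hτ j] at h2
  exact ⟨Equiv.ofBijective σ (Finite.injective_iff_bijective.1 hinj), τ, hτ, hστ⟩

theorem exists_map_pow_eq_smul_perm {h : G} {σ : Equiv.Perm ι} {τ : ι → k}
    (hτ : ∀ i, τ i ≠ 0) (hσ : ∀ i, ρ h (b i) = τ i • b (σ i)) (n : ℕ) (i : ι) :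
    ∃ t : k, t ≠ 0 ∧ ρ (h ^ n) (b i) = t • b ((σ ^ n) i) := by
  induction n with
  | zero => exact ⟨1, one_ne_zero, by simp⟩
  | succ n ih =>
    obtain ⟨t, ht, h1⟩ := ih
    refine ⟨t * τ ((σ ^ n) i), mul_ne_zero ht (hτ _), ?_⟩
    rw [pow_succ', map_mul, LinearEquiv.mul_apply, h1, map_smul, hσ, smul_smul, pow_succ',
      Equiv.Perm.mul_apply]

theorem perm_pow_eq_one {h : G} {σ : Equiv.Perm ι} {τ : ι → k}
    (hτ : ∀ i, τ i ≠ 0) (hσ : ∀ i, ρ h (b i) = τ i • b (σ i)) {n : ℕ} (hn : h ^ n = 1) :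
    σ ^ n = 1 := by
  classical
  ext i
  obtain ⟨t, ht, h1⟩ := exists_map_pow_eq_smul_perm hτ hσ n i
  rw [hn, map_one, LinearEquiv.coe_one, id_eq] at h1
  by_contra hne
  have h2 := congrArg (b.coord ((σ ^ n) i)) h1
  have h3 : i ≠ (σ ^ n) i := fun h => hne (by simpa using h.symm)
  simp [h3, ht.symm] at h2

/-- How the diagonal coefficients change under conjugation by a monomial element. -/
theorem diagCoeff_conj {h x : G} {σ : Equiv.Perm ι} {τ : ι → k}
    (hτ : ∀ i, τ i ≠ 0) (hσ : ∀ i, ρ h (b i) = τ i • b (σ i))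
    (hx : ∀ i, ρ x (b i) = diagCoeff ρ b x i • b i) (i : ι) :
    diagCoeff ρ b (h * x * h⁻¹) (σ i) = diagCoeff ρ b x i := by
  refine diagCoeff_eq ?_
  have h1 : b (σ i) = (τ i)⁻¹ • ρ h (b i) := by rw [hσ, smul_smul, inv_mul_cancel₀ (hτ i), one_smul]
  have h2 : ρ (h * x * h⁻¹) (ρ h (b i)) = ρ h (ρ x (b i)) := by
    rw [← LinearEquiv.mul_apply, ← map_mul, ← LinearEquiv.mul_apply, ← map_mul]
    simp
  rw [h1, map_smul, h2, hx, map_smul, smul_comm]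

end Faithful
section AlgebraOnModule
variable {k V : Type*} [Field k] [AddCommGroup V] [Module k V]
variable {m : V →ₗ[k] V →ₗ[k] V}
namespace IsIrredAlt
variable {G : Type*} [Group G] {ρ : G →* (V ≃ₗ[k] V)} (H : IsIrredAlt ρ m)
include H
theorem exists_eigenbasis [IsAlgClosed k] {g : G} {n : ℕ} (hn : (n : k) ≠ 0) (hg : g ^ n = 1) :
    ∃ (b : Basis (Fin 5) k V) (lam : Fin 5 → k), ∀ i, ρ g (b i) = lam i • b i := by
  refine exists_eigenbasis_of_pow_eq_one H.finrank_eq (f := (ρ g : V →ₗ[k] V)) hn ?_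
  have h1 : ρ g ^ n = 1 := by rw [← map_pow, hg, map_one]
  have h2 := congrArg LinearEquiv.automorphismGroup.toLinearMapMonoidHom h1
  rwa [_root_.map_pow, _root_.map_one] at h2

variable [Finite G] [IsSimpleGroup G] (hG : ¬ ∀ a b : G, a * b = b * a)
  (hρ : Function.Injective ρ)
include hG hρ

theorem injective_of_orderOf_prime {g : G} {b : Basis (Fin 5) k V} {lam : Fin 5 → k}
    (hb : ∀ i, ρ g (b i) = lam i • b i) (hg : (orderOf g).Prime) :
    orderOf g = 5 ∧ Function.Injective lam := by
  refine (H.isGraded hG hb).injective_of_prime_pow hg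
    (fun i => pow_eq_one_of_map_basis hb (pow_orderOf_eq_one g) i) ?_
  by_contra! hcon
  have : g = 1 := eq_one_of_forall_basis (b := b) hρ fun i => by rw [hb, hcon, one_smul]
  rw [this, orderOf_one] at hg
  exact Nat.not_prime_one hg

theorem exists_eigenbasis_of_prime [IsAlgClosed k] {g : G} (hg : (orderOf g).Prime)
    (hk : ((orderOf g : ℕ) : k) ≠ 0) :
    orderOf g = 5 ∧ ∃ (b : Basis (Fin 5) k V) (lam : Fin 5 → k),
      (∀ i, ρ g (b i) = lam i • b i) ∧ Function.Injective lam := by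
  obtain ⟨b, lam, hb⟩ := H.exists_eigenbasis hk (pow_orderOf_eq_one g)
  obtain ⟨h1, h2⟩ := H.injective_of_orderOf_prime hG hρ hb hg
  exact ⟨h1, b, lam, hb, h2⟩

theorem eq_one_of_diagCoeff_eq {y : G} {b : Basis (Fin 5) k V} {mu : Fin 5 → k}
    (hb : ∀ i, ρ y (b i) = mu i • b i) {i j : Fin 5} (hij : i ≠ j) (h : mu i = mu j) : y = 1 := by
  by_contra hy
  have hne : orderOf y ≠ 1 := fun h => hy (orderOf_eq_one_iff.1 h)
  obtain ⟨r, hr, n, hn⟩ := Nat.exists_prime_and_dvd hne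
  have h0 : n ≠ 0 := by
    rintro rfl
    exact (orderOf_pos y).ne' (by simpa using hn)
  have h1 : orderOf (y ^ n) = r := by
    rw [orderOf_pow_of_dvd h0 ⟨r, by rw [hn, mul_comm]⟩, hn, Nat.mul_div_cancel _ (by omega)]
  have := (H.injective_of_orderOf_prime hG hρ (map_pow_basis hb n) (by rwa [h1])).2
  exact hij (this (by simp [h]))

theorem pow_five_eq_one_of_diagCoeff_eq_one {y : G} {b : Basis (Fin 5) k V} {mu : Fin 5 → k}
    (hb : ∀ i, ρ y (b i) = mu i • b i) {i : Fin 5} (h : mu i = 1) : y ^ 5 = 1 := by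
  by_cases hne : ∃ i, mu i ≠ 1
  · refine eq_one_of_forall_basis (b := b) hρ fun j => ?_
    rw [map_pow_basis hb, ((H.isGraded hG hb).pow_five_of_eigenvalue_one ⟨i, h⟩ hne).2, one_smul]
  · push Not at hne
    have : y = 1 := eq_one_of_forall_basis (b := b) hρ fun i => by rw [hb, hne, one_smul]
    rw [this, one_pow]
end IsIrredAlt
end AlgebraOnModule

/-- In a nonabelian finite simple group, an abelian Sylow `r`-subgroup `R ≠ 1` has a normalizer
containing elements of prime order different from `r`. -/
theorem Sylow.exists_mem_normalizer_orderOf_prime {G : Type*} [Group G] [Finite G]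
    [IsSimpleGroup G] (hG : ¬ ∀ a b : G, a * b = b * a) {r : ℕ} [Fact r.Prime]
    (hr : r ∣ Nat.card G) (R : Sylow r G) (hR : ∀ x ∈ R, ∀ y ∈ R, x * y = y * x) :
    ∃ h ∈ Subgroup.normalizer (R : Set G), (orderOf h).Prime ∧ orderOf h ≠ r := by
  by_contra! hcon
  have h1 : IsPGroup r (Subgroup.normalizer (R : Set G)) := by
    refine IsPGroup.of_forall_prime fun s x hs hx => ?_
    rw [← hcon x x.2 (by rwa [Subgroup.orderOf_coe, hx]), Subgroup.orderOf_coe, hx]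
  have h2 := R.is_maximal' h1 Subgroup.le_normalizer
  have hP : Subgroup.normalizer (R : Set G) ≤ Subgroup.centralizer (R : Set G) := by
    intro x hx
    rw [h2] at hx
    exact Subgroup.mem_centralizer_iff.2 fun y hy => hR y hy x hx
  have hc := MonoidHom.ker_transferSylow_isComplement' R hP
  rcases IsSimpleGroup.eq_bot_or_eq_top_of_normal (MonoidHom.transferSylow R hP).ker
    inferInstance with h | h
  · rw [h, Subgroup.isComplement'_bot_left] at hc
    have := R.isPGroup'
    rw [hc] at this
    exact hG (this.of_equiv Subgroup.topEquiv).mul_comm_of_isSimpleGroup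
  · rw [h, Subgroup.isComplement'_top_left] at hc
    have := R.dvd_card_of_dvd_card hr
    rw [hc, Subgroup.card_bot] at this
    exact (Fact.out : r.Prime).one_lt.ne' (Nat.dvd_one.1 this)

theorem card_dvd_forty_of_card_eq {G : Type*} [Group G] [Finite G] [IsSimpleGroup G] {d : ℕ}
    (h : Nat.card G = 5 * 2 ^ d) : Nat.card G ∣ 40 := by
  have f2 : Fact (Nat.Prime 2) := ⟨Nat.prime_two⟩
  obtain ⟨T⟩ : Nonempty (Sylow 2 G) := inferInstance
  have hT : Nat.card T = 2 ^ d := by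
    rw [T.card_eq_multiplicity, h, Nat.factorization_mul (by norm_num) (by positivity)]
    simp [Nat.factorization_eq_zero_of_not_dvd (show ¬ 2 ∣ 5 by norm_num),
      Nat.prime_two.factorization_self]
  have hi : (T : Subgroup G).index = 5 := by
    have := (T : Subgroup G).card_mul_index
    rw [h] at this
    have h2 : (2 : ℕ) ^ d * (T : Subgroup G).index = 2 ^ d * 5 := by
      rw [mul_comm _ 5, ← this]; congr 1; exact hT.symm
    exact Nat.eq_of_mul_eq_mul_left (by positivity) h2
  rcases IsSimpleGroup.eq_bot_or_eq_top_of_normal (MulAction.toPermHom G (G ⧸ (T : Subgroup G))).ker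
    inferInstance with hk | hk
  · have h1 := Subgroup.card_dvd_of_injective _ ((MonoidHom.ker_eq_bot_iff _).1 hk)
    rw [Nat.card_perm, ← Subgroup.index, hi, h] at h1
    rw [h]
    have h2 : 2 ^ d ∣ 24 := Nat.dvd_of_mul_dvd_mul_left (k := 5) (by norm_num)
      (by simpa [Nat.factorial] using h1)
    have h3 : 2 ^ d ∣ 8 := by
      have : Nat.Coprime (2 ^ d) 3 := Nat.Coprime.pow_left _ (by norm_num)
      exact this.dvd_of_dvd_mul_right (by simpa using h2)
    exact Nat.mul_dvd_mul_left 5 h3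
  · rw [← Subgroup.normalCore_eq_ker] at hk
    have : (T : Subgroup G) = ⊤ := top_le_iff.1 (hk ▸ Subgroup.normalCore_le _)
    rw [this, Subgroup.index_top] at hi
    omega
section AlgebraOnModule
variable {k V : Type*} [Field k] [AddCommGroup V] [Module k V]
variable {m : V →ₗ[k] V →ₗ[k] V}
namespace IsIrredAlt
variable {G : Type*} [Group G] {ρ : G →* (V ≃ₗ[k] V)} (H : IsIrredAlt ρ m)
include H
variable [Finite G] [IsSimpleGroup G] (hG : ¬ ∀ a b : G, a * b = b * a)
  (hρ : Function.Injective ρ)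
include hG hρ
theorem isPGroup_centralizer [IsAlgClosed k] {p : ℕ} [Fact p.Prime] [CharP k p] {g : G}
    {b : Basis (Fin 5) k V} {lam : Fin 5 → k} (hb : ∀ i, ρ g (b i) = lam i • b i)
    (hinj : Function.Injective lam) : IsPGroup 5 (Subgroup.centralizer {g}) := by
  have f5 : Fact (Nat.Prime 5) := ⟨Nat.prime_five⟩
  refine IsPGroup.of_forall_prime fun s x hs hx => ?_
  rw [← Subgroup.orderOf_coe] at hx
  by_cases hk : (s : k) = 0
  · exfalso
    have hsp : p = s :=
      (Nat.prime_dvd_prime_iff_eq Fact.out hs).1 ((CharP.cast_eq_zero_iff k p s).1 hk)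
    subst hsp
    have hd := map_basis_eq_diagCoeff_smul hb hinj (Subgroup.mem_centralizer_singleton_iff.1 x.2)
    have h1 : (x : G) = 1 := by
      refine eq_one_of_forall_basis (b := b) hρ fun i => ?_
      have h2 := pow_eq_one_of_map_basis hd (hx ▸ pow_orderOf_eq_one (x : G)) i
      have h3 : diagCoeff ρ b (x : G) i = 1 :=
        frobenius_inj k p (by rw [frobenius_def, frobenius_def, h2, one_pow])
      rw [hd, h3, one_smul]
    rw [h1, orderOf_one] at hx
    exact Nat.not_prime_one (hx ▸ hs)
  · exact hx ▸ (H.exists_eigenbasis_of_prime hG hρ (hx ▸ hs) (by rwa [hx])).1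

theorem exists_sylow_eq_centralizer [IsAlgClosed k] {p : ℕ} [Fact p.Prime] [CharP k p]
    [Fact (Nat.Prime 5)] (h5 : 5 ∣ Nat.card G) (hp : (5 : k) ≠ 0) :
    ∃ (R : Sylow 5 G) (g : G) (b : Basis (Fin 5) k V) (lam : Fin 5 → k),
      orderOf g = 5 ∧ (∀ i, ρ g (b i) = lam i • b i) ∧ Function.Injective lam ∧
      ∀ x, x ∈ R ↔ x * g = g * x := by
  obtain ⟨R⟩ : Nonempty (Sylow 5 G) := inferInstance
  have h1 := R.dvd_card_of_dvd_card h5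
  have h2 : Nontrivial R := by
    rw [← Finite.one_lt_card_iff_nontrivial]
    exact lt_of_lt_of_le (by norm_num) (Nat.le_of_dvd Nat.card_pos h1)
  have h3 : Nontrivial (Subgroup.center R) := R.isPGroup'.center_nontrivial
  have h4 : 5 ∣ Nat.card (Subgroup.center R) := by
    obtain ⟨n, hn, h⟩ := (IsPGroup.nontrivial_iff_card (R.isPGroup'.to_subgroup _)).1 h3
    exact h ▸ dvd_pow_self 5 (by omega)
  obtain ⟨x, hx⟩ := exists_prime_orderOf_dvd_card' 5 h4
  have hg : orderOf ((x : R) : G) = 5 := by rw [Subgroup.orderOf_coe, Subgroup.orderOf_coe, hx]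
  obtain ⟨-, b, lam, hb, hinj⟩ := H.exists_eigenbasis_of_prime hG hρ (g := ((x : R) : G))
    (by rw [hg]; norm_num) (by rw [hg]; exact_mod_cast hp)
  refine ⟨R, (x : R), b, lam, hg, hb, hinj, fun y => ?_⟩
  have hle : (R : Subgroup G) ≤ Subgroup.centralizer {((x : R) : G)} := fun y hy =>
    Subgroup.mem_centralizer_singleton_iff.2
      (congrArg Subtype.val (Subgroup.mem_center_iff.1 x.2 ⟨y, hy⟩))
  have h6 := R.is_maximal' (H.isPGroup_centralizer (p := p) hG hρ hb hinj) hle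
  rw [← Subgroup.mem_centralizer_singleton_iff, h6]
  rfl

theorem five_dvd_card [IsAlgClosed k] {p : ℕ} [Fact p.Prime] [CharP k p] :
    5 ∣ Nat.card G ∧ p ≠ 5 ∧ ∀ x : G, (orderOf x).Prime → orderOf x = 5 ∨ orderOf x = p := by
  have h1 : ∀ x : G, (orderOf x).Prime → orderOf x = 5 ∨ orderOf x = p := by
    intro x hx
    by_cases hk : ((orderOf x : ℕ) : k) = 0
    · exact Or.inr ((Nat.prime_dvd_prime_iff_eq Fact.out hx).1
        ((CharP.cast_eq_zero_iff k p _).1 hk)).symm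
    · exact Or.inl (H.exists_eigenbasis_of_prime hG hρ hx hk).1
  have h2 : ∃ x : G, (orderOf x).Prime ∧ orderOf x ≠ p := by
    by_contra! hcon
    exact hG (IsPGroup.of_forall_prime (r := p)
      fun s x hs hx => hx ▸ hcon x (hx ▸ hs)).mul_comm_of_isSimpleGroup
  obtain ⟨x, hx, hxp⟩ := h2
  have h5 := (h1 x hx).resolve_right hxp
  exact ⟨h5 ▸ orderOf_dvd_natCard x, fun h => hxp (h5.trans h.symm), h1⟩

theorem false_of_isSimpleGroup [IsAlgClosed k] {p : ℕ} [Fact p.Prime] [CharP k p] : False := by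
  have f5 : Fact (Nat.Prime 5) := ⟨Nat.prime_five⟩
  obtain ⟨h5, hp5, hord⟩ := H.five_dvd_card (p := p) hG hρ
  have hk5 : (5 : k) ≠ 0 := fun h => hp5 ((Nat.prime_dvd_prime_iff_eq Fact.out Nat.prime_five).1
    ((CharP.cast_eq_zero_iff k p 5).1 (by exact_mod_cast h)))
  obtain ⟨R, g, b, lam, hg, hb, hinj, hR⟩ := H.exists_sylow_eq_centralizer (p := p) hG hρ h5 hk5
  have hd : ∀ x ∈ R, ∀ i, ρ x (b i) = diagCoeff ρ b x i • b i := fun x hx =>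
    map_basis_eq_diagCoeff_smul hb hinj ((hR x).1 hx)
  have hgR : g ∈ R := (hR g).2 rfl
  have hcomm : ∀ x ∈ R, ∀ y ∈ R, x * y = y * x := by
    intro x hx y hy
    refine eq_of_forall_basis (b := b) hρ fun i => ?_
    simp only [_root_.map_mul, LinearEquiv.mul_apply, hd x hx, hd y hy, map_smul, smul_smul,
      mul_comm]
  obtain ⟨h, hhN, hhs, hh5⟩ := R.exists_mem_normalizer_orderOf_prime hG h5 hcomm
  have hhR : h ∉ R := by
    intro hmem
    obtain ⟨n, hn⟩ := R.isPGroup' ⟨h, hmem⟩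
    have hn' : h ^ 5 ^ n = 1 := congrArg Subtype.val hn
    exact hh5 ((Nat.prime_dvd_prime_iff_eq hhs Nat.prime_five).1
      (hhs.dvd_of_dvd_pow (orderOf_dvd_of_pow_eq_one hn')))
  have hconj : ∀ x ∈ R, h * x * h⁻¹ ∈ R := fun x hx => (Subgroup.mem_normalizer_iff.1 hhN x).1 hx
  have hconj' : h⁻¹ * g * h ∈ R := (Subgroup.mem_normalizer_iff''.1 hhN g).1 hgR
  obtain ⟨σ, τ, hτ, hσ⟩ := exists_perm_of_eigenvectors (ρ := ρ) (b := b) (h := h) fun i => by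
    have h1 : ρ g (ρ h (b i)) = diagCoeff ρ b (h⁻¹ * g * h) i • ρ h (b i) := by
      rw [← map_smul, ← hd _ hconj', ← LinearEquiv.mul_apply, ← LinearEquiv.mul_apply,
        ← _root_.map_mul, ← _root_.map_mul]
      congr 2
      group
    obtain ⟨j, -, hj⟩ := exists_eq_smul_of_eigenvector (f := (ρ g : V →ₗ[k] V)) hb hinj h1
      ((ρ h).map_ne_zero_iff.2 (b.ne_zero i))
    exact ⟨j, _, hj⟩
  have hcf := fun x (hx : x ∈ R) => diagCoeff_conj hτ hσ (hd x hx)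
  rcases Equiv.Perm.fixes_two_or_of_prime_pow hhs hh5 σ
    (perm_pow_eq_one hτ hσ (pow_orderOf_eq_one h)) with ⟨i, j, hij, hi, hj⟩ |
    ⟨h2, i, j, l, hij, hjl, hi, hj, hl⟩
  · apply hhR
    rw [hR]
    have hg' := R.inv_mem hgR
    have hm := R.mul_mem (hconj g hgR) hg'
    have hval : ∀ i, σ i = i → diagCoeff ρ b (h * g * h⁻¹ * g⁻¹) i = 1 := by
      intro i hi
      have h1 := diagCoeff_mul (hd _ hgR) (hd _ hg') i
      rw [diagCoeff_mul (hd _ (hconj g hgR)) (hd _ hg')]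
      have h2 := hcf g hgR i
      rw [hi] at h2
      rw [h2, ← h1, mul_inv_cancel]
      exact diagCoeff_eq (by simp)
    have := H.eq_one_of_diagCoeff_eq hG hρ (hd _ hm) hij ((hval i hi).trans (hval j hj).symm)
    rw [mul_inv_eq_one, mul_inv_eq_iff_eq_mul] at this
    exact this
  · have hp2 : p = 2 := h2 ▸ ((hord h hhs).resolve_left hh5).symm
    subst hp2
    have hy : ∀ x ∈ R, x * (h * x * h⁻¹) = 1 := by
      intro x hx
      have h1 := hcf x hx j
      have h3 := hcf x hx l
      rw [hj] at h1
      rw [hl] at h3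
      refine H.eq_one_of_diagCoeff_eq hG hρ (hd _ (R.mul_mem hx (hconj x hx))) hjl ?_
      rw [diagCoeff_mul (hd x hx) (hd _ (hconj x hx)), diagCoeff_mul (hd x hx) (hd _ (hconj x hx)),
        h1, h3, mul_comm]
    have hone : ∀ x ∈ R, diagCoeff ρ b x i = 1 := by
      intro x hx
      have h1 := hcf x hx i
      rw [hi] at h1
      have h3 := diagCoeff_mul (hd x hx) (hd _ (hconj x hx)) i
      rw [hy x hx, h1, diagCoeff_eq (t := 1) (by simp)] at h3
      exact frobenius_inj k 2 (by rw [frobenius_def, frobenius_def, one_pow, pow_two, ← h3])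
    have hgl : ∀ i, diagCoeff ρ b g i = lam i := fun i => diagCoeff_eq (hb i)
    have hprim : IsPrimitiveRoot (lam j) 5 := by
      refine IsPrimitiveRoot.iff_orderOf.2 (orderOf_eq_prime
        (pow_eq_one_of_map_basis hb (hg ▸ pow_orderOf_eq_one g) j) fun h1 => ?_)
      exact hij (hinj (by rw [h1, ← hgl, hone g hgR]))
    have hz : (R : Subgroup G) = Subgroup.zpowers g := by
      refine le_antisymm (fun x hx => ?_) (Subgroup.zpowers_le.2 hgR)
      have h1 := H.pow_five_eq_one_of_diagCoeff_eq_one hG hρ (hd x hx) (hone x hx)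
      obtain ⟨n, -, hn⟩ := hprim.eq_pow_of_pow_eq_one (pow_eq_one_of_map_basis (hd x hx) h1 j)
      have hgn : g ^ n ∈ R := R.pow_mem hgR n
      have hgn' := R.inv_mem hgn
      have h3 : x * (g ^ n)⁻¹ = 1 := by
        refine H.eq_one_of_diagCoeff_eq hG hρ (hd _ (R.mul_mem hx hgn')) hij ?_
        rw [hone _ (R.mul_mem hx hgn'), diagCoeff_mul (hd x hx) (hd _ hgn'), ← hn,
          ← diagCoeff_eq (map_pow_basis hb n j), ← diagCoeff_mul (hd _ hgn) (hd _ hgn'),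
          mul_inv_cancel]
        exact (diagCoeff_eq (by simp)).symm
      rw [mul_inv_eq_one.1 h3]
      exact Subgroup.npow_mem_zpowers g n
    have hcR : Nat.card R = 5 := by
      have : Nat.card (R : Subgroup G) = 5 := by rw [hz, Nat.card_zpowers, hg]
      exact this
    have hidx : ∃ d, (R : Subgroup G).index = 2 ^ d := by
      refine ⟨_, Nat.eq_prime_pow_of_unique_prime_dvd Subgroup.index_ne_zero_of_finite
        fun {d} hd' hdvd => ?_⟩
      have fd : Fact d.Prime := ⟨hd'⟩
      obtain ⟨x, hx⟩ := exists_prime_orderOf_dvd_card' d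
        (hdvd.trans (Subgroup.index_dvd_card (R : Subgroup G)))
      rcases hord x (hx ▸ hd') with h1 | h1
      · refine absurd ?_ R.not_dvd_index
        exact (h1.symm.trans hx).dvd.trans hdvd
      · exact hx.symm.trans h1
    obtain ⟨d, hd2⟩ := hidx
    have hcG : Nat.card G = 5 * 2 ^ d := by
      rw [← (R : Subgroup G).card_mul_index, hd2]
      congr 1
    exact hG (mul_comm_of_card_dvd_forty (card_dvd_forty_of_card_eq hcG))
end IsIrredAlt
end AlgebraOnModule

theorem exists_zsmul_of_cyclic_relation_aux (A : Type*) [AddCommGroup A] {i j : Fin 5}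
    (hij : i < j) : ∃ n : ℤ, ∀ y : Fin 5 → A, (∀ t, y (i + t) + y (j + t) = y t) →
      (11 : ℤ) • y 0 = 0 ∧ y 1 = n • y 0 := by
  have hi : i = 0 ∨ (i = 1 ∧ j = 2) ∨ (i = 1 ∧ j = 3) ∨ (i = 1 ∧ j = 4) ∨ (i = 2 ∧ j = 3) ∨
      (i = 2 ∧ j = 4) ∨ (i = 3 ∧ j = 4) := by
    revert i j; decide
  rcases hi with rfl | ⟨rfl, rfl⟩ | ⟨rfl, rfl⟩ | ⟨rfl, rfl⟩ | ⟨rfl, rfl⟩ | ⟨rfl, rfl⟩ | ⟨rfl, rfl⟩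
  · refine ⟨0, fun y h => ?_⟩
    have h1 : ∀ t, y t = 0 := by
      intro t
      have := h (t - j)
      simpa using this
    simp [h1]
  · refine ⟨3, fun y h => ?_⟩
    have h0 : y 1 + y 2 = y 0 := h 0
    have h1 : y 2 + y 3 = y 1 := h 1
    have h2 : y 3 + y 4 = y 2 := h 2
    have h3 : y 4 + y 0 = y 3 := h 3
    have h4 : y 0 + y 1 = y 4 := h 4
    constructor
    · linear_combination (norm := module)
        (-2 : ℤ) • h0 + (3 : ℤ) • h1 + h2 + (4 : ℤ) • h3 + (5 : ℤ) • h4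
    · linear_combination (norm := module) h0 - h1 - h3 - h4
  · refine ⟨9, fun y h => ?_⟩
    have h0 : y 1 + y 3 = y 0 := h 0
    have h1 : y 2 + y 4 = y 1 := h 1
    have h2 : y 3 + y 0 = y 2 := h 2
    have h3 : y 4 + y 1 = y 3 := h 3
    have h4 : y 0 + y 2 = y 4 := h 4
    constructor
    · linear_combination (norm := module)
        (-2 : ℤ) • h0 + h1 + (5 : ℤ) • h2 + (3 : ℤ) • h3 + (4 : ℤ) • h4
    · linear_combination (norm := module)
        (2 : ℤ) • h0 - h1 - (4 : ℤ) • h2 - (2 : ℤ) • h3 - (3 : ℤ) • h4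
  · refine ⟨0, fun y h => ?_⟩
    have h0 : y 1 + y 4 = y 0 := h 0
    have h1 : y 2 + y 0 = y 1 := h 1
    have h2 : y 3 + y 1 = y 2 := h 2
    have h3 : y 4 + y 2 = y 3 := h 3
    have h4 : y 0 + y 3 = y 4 := h 4
    constructor
    · linear_combination (norm := module) (-11 : ℤ) • h0 + (11 : ℤ) • h2 + (11 : ℤ) • h3
    · linear_combination (norm := module) - h1 + h3 + h4
  · refine ⟨0, fun y h => ?_⟩
    have h0 : y 2 + y 3 = y 0 := h 0
    have h1 : y 3 + y 4 = y 1 := h 1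
    have h2 : y 4 + y 0 = y 2 := h 2
    have h3 : y 0 + y 1 = y 3 := h 3
    have h4 : y 1 + y 2 = y 4 := h 4
    constructor
    · linear_combination (norm := module) (-11 : ℤ) • h0 + (11 : ℤ) • h1 + (11 : ℤ) • h4
    · linear_combination (norm := module) h0 - h1 + h2
  · refine ⟨5, fun y h => ?_⟩
    have h0 : y 2 + y 4 = y 0 := h 0
    have h1 : y 3 + y 0 = y 1 := h 1
    have h2 : y 4 + y 1 = y 2 := h 2
    have h3 : y 0 + y 2 = y 3 := h 3
    have h4 : y 1 + y 3 = y 4 := h 4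
    constructor
    · linear_combination (norm := module)
        (-2 : ℤ) • h0 + (4 : ℤ) • h1 + (3 : ℤ) • h2 + (5 : ℤ) • h3 + h4
    · linear_combination (norm := module) h0 - (2 : ℤ) • h1 - h2 - (2 : ℤ) • h3
  · refine ⟨4, fun y h => ?_⟩
    have h0 : y 3 + y 4 = y 0 := h 0
    have h1 : y 4 + y 0 = y 1 := h 1
    have h2 : y 0 + y 1 = y 2 := h 2
    have h3 : y 1 + y 2 = y 3 := h 3
    have h4 : y 2 + y 3 = y 4 := h 4
    constructor
    · linear_combination (norm := module)
        (-2 : ℤ) • h0 + (5 : ℤ) • h1 + (4 : ℤ) • h2 + h3 + (3 : ℤ) • h4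
    · linear_combination (norm := module) h0 - (2 : ℤ) • h1 - h2 - h4

theorem exists_zsmul_of_cyclic_relation (A : Type*) [AddCommGroup A] {i j : Fin 5} (hij : i ≠ j) :
    ∃ n : ℤ, ∀ y : Fin 5 → A, (∀ t, y (i + t) + y (j + t) = y t) →
      ∀ t, (11 : ℤ) • y t = 0 ∧ y (t + 1) = n • y t := by
  have h : ∃ n : ℤ, ∀ y : Fin 5 → A, (∀ t, y (i + t) + y (j + t) = y t) →
      (11 : ℤ) • y 0 = 0 ∧ y 1 = n • y 0 := by
    rcases lt_or_gt_of_ne hij with h | h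
    · exact exists_zsmul_of_cyclic_relation_aux A h
    · obtain ⟨n, hn⟩ := exists_zsmul_of_cyclic_relation_aux A h
      exact ⟨n, fun y hy => hn y fun t => by rw [add_comm, hy]⟩
  obtain ⟨n, hn⟩ := h
  refine ⟨n, fun y hy t => ?_⟩
  have := hn (fun s => y (s + t)) fun s => by simpa [add_assoc] using hy (s + t)
  simpa [add_comm] using this

/-- A cyclic sequence of period five with `x (i + t) * x (j + t) = x t` consists of eleventh roots
of unity, and is determined by any one of its terms. -/
theorem pow_eleven_of_cyclic_relation {k : Type*} [Field k] {x : Fin 5 → k} (hx : ∀ t, x t ≠ 0)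
    {i j : Fin 5} (hij : i ≠ j) (h : ∀ t, x (i + t) * x (j + t) = x t) :
    (∀ t, x t ^ 11 = 1) ∧ ∀ s, x s = 1 → ∀ t, x t = 1 := by
  obtain ⟨n, hn⟩ := exists_zsmul_of_cyclic_relation (Additive kˣ) hij
  have h1 := hn (fun t => Additive.ofMul (Units.mk0 (x t) (hx t))) fun t => by
    rw [← ofMul_mul, ← Units.mk0_mul]
    · simp [h]
    · exact mul_ne_zero (hx _) (hx _)
  have h2 : ∀ t, Units.mk0 (x t) (hx t) ^ 11 = 1 := fun t => by
    have := (h1 t).1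
    rw [← ofMul_zpow, ofMul_eq_zero] at this
    exact_mod_cast this
  have h3 : ∀ t, Units.mk0 (x (t + 1)) (hx _) = Units.mk0 (x t) (hx t) ^ n := fun t => by
    have := (h1 t).2
    rw [← ofMul_zpow] at this
    exact Additive.ofMul.injective this
  refine ⟨fun t => by simpa using congrArg Units.val (h2 t), fun s hs => ?_⟩
  have h4 : ∀ t, x t = 1 → x (t + 1) = 1 := by
    intro t ht
    have h5 : Units.mk0 (x t) (hx t) = 1 := Units.ext ht
    have h6 := h3 t
    rw [h5, one_zpow] at h6
    simpa using congrArg Units.val h6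
  have h5 : ∀ n : ℕ, x (s + n • 1) = 1 := by
    intro n
    induction n with
    | zero => simpa using hs
    | succ n ih => simpa [add_assoc, succ_nsmul] using h4 _ ih
  intro t
  have h6 : ∀ s t : Fin 5, s + (t - s).val • 1 = t := by decide
  rw [← h6 s t]
  exact h5 _

theorem alt_of_basis {k V ι : Type*} [Field k] [AddCommGroup V] [Module k V]
    {m : V →ₗ[k] V →ₗ[k] V} (b : Basis ι k V) (h0 : ∀ i, m (b i) (b i) = 0)
    (h : ∀ i j, m (b i) (b j) = - m (b j) (b i)) (x : V) : m x x = 0 := by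
  have h1 : m = - m.flip := b.ext fun i => b.ext fun j => by simpa using h i j
  have h2 : ∀ x y, m x y = - m y x := fun x y => by
    have := congrArg (fun f => f x y) h1
    simpa using this
  induction b.mem_span x using Submodule.span_induction with
  | zero => simp
  | add x y _ _ hx hy => simp [hx, hy, h2 x y]
  | smul c x _ hx => simp [hx]
  | mem x hx =>
    obtain ⟨i, rfl⟩ := hx
    exact h0 i

/-- A submodule stable under diagonal operators separating the basis vectors contains all basis
vectors occurring in its elements. -/
theorem basis_mem_of_coord_ne_zero {k V ι D : Type*} [Field k] [AddCommGroup V] [Module k V]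
    {b : Basis ι k V} {f : D → V →ₗ[k] V} {chi : D → ι → k}
    (hf : ∀ d i, f d (b i) = chi d i • b i) (hchi : ∀ i j, i ≠ j → ∃ d, chi d i ≠ chi d j)
    {S : Submodule k V} (hS : ∀ d, ∀ x ∈ S, f d x ∈ S) {x : V} (hx : x ∈ S) {i : ι}
    (hi : b.coord i x ≠ 0) : b i ∈ S := by
  classical
  induction hn : (b.repr x).support.card using Nat.strong_induction_on generalizing x with
  | _ n ih =>
    by_cases hj : ∃ j, j ≠ i ∧ b.coord j x ≠ 0
    · obtain ⟨j, hji, hj⟩ := hj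
      obtain ⟨d, hd⟩ := hchi i j hji.symm
      have hc : ∀ l, b.coord l (f d x - chi d j • x) = (chi d l - chi d j) * b.coord l x := by
        intro l
        rw [map_sub, coord_map_of_eigenbasis (hf d), map_smul, smul_eq_mul, sub_mul]
      refine ih _ ?_ (S.sub_mem (hS d x hx) (S.smul_mem _ hx))
        (by rw [hc]; exact mul_ne_zero (sub_ne_zero.2 hd) hi) rfl
      rw [← hn]
      refine Finset.card_lt_card (Finset.ssubset_iff_of_subset (fun l hl => ?_) |>.2 ⟨j, ?_, ?_⟩)
      · rw [Finsupp.mem_support_iff] at hl ⊢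
        intro h0
        exact hl ((hc l).trans (by rw [Basis.coord_apply, h0, mul_zero]))
      · exact Finsupp.mem_support_iff.2 hj
      · rw [Finsupp.mem_support_iff, not_not]
        exact (hc j).trans (by rw [sub_self, zero_mul])
    · push Not at hj
      have h1 : x = b.coord i x • b i := b.ext_elem fun l => by
        by_cases hl : l = i
        · subst hl; simp
        · have h3 : b.repr x l = 0 := hj l hl
          simp [h3, Ne.symm hl]
      rw [h1] at hx
      exact (S.smul_mem_iff hi).1 hx

theorem eq_bot_or_eq_top_of_diag_of_perm {k V ι D : Type*} [Field k] [AddCommGroup V] [Module k V]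
    {b : Basis ι k V} {f : D → V →ₗ[k] V} {chi : D → ι → k}
    (hf : ∀ d i, f d (b i) = chi d i • b i) (hchi : ∀ i j, i ≠ j → ∃ d, chi d i ≠ chi d j)
    {S : Submodule k V} (hS : ∀ d, ∀ x ∈ S, f d x ∈ S)
    (htrans : ∀ i j, b i ∈ S → b j ∈ S) : S = ⊥ ∨ S = ⊤ := by
  by_cases hS0 : S = ⊥
  · exact Or.inl hS0
  · right
    obtain ⟨x, hx, hx0⟩ := S.ne_bot_iff.1 hS0
    obtain ⟨i, hi⟩ : ∃ i, b.coord i x ≠ 0 := by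
      by_contra! hcon
      exact hx0 (b.forall_coord_eq_zero_iff.1 hcon)
    have hbi := basis_mem_of_coord_ne_zero hf hchi hS hx hi
    rw [eq_top_iff, ← b.span_eq, Submodule.span_le]
    rintro _ ⟨j, rfl⟩
    exact htrans i j hbi

/-- If a space is spanned by submodules of dimension `d` that are minimal for a property closed
under sums and intersections, then `d` divides its dimension. -/
theorem dvd_finrank_of_sSup_eq_top {k V : Type*} [Field k] [AddCommGroup V] [Module k V]
    [FiniteDimensional k V] {P : Submodule k V → Prop} (hbot : P ⊥)
    (hinf : ∀ S T, P S → P T → P (S ⊓ T)) (hsup : ∀ S T, P S → P T → P (S ⊔ T))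
    {W : Set (Submodule k V)} {d : ℕ} (hd : 0 < d) (hWd : ∀ S ∈ W, finrank k S = d)
    (hWP : ∀ S ∈ W, P S) (hmin : ∀ S ∈ W, ∀ T, P T → T ≤ S → T = ⊥ ∨ T = S)
    (htop : sSup W = ⊤) : d ∣ finrank k V := by
  by_contra hcon
  have h : ∀ n : ℕ, ∃ U, P U ∧ finrank k U = n * d := by
    intro n
    induction n with
    | zero => exact ⟨⊥, hbot, by simp⟩
    | succ n ih =>
      obtain ⟨U, hU, hUd⟩ := ih
      obtain ⟨S, hS, hSU⟩ : ∃ S ∈ W, ¬ S ≤ U := by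
        by_contra! hle
        have hUtop : U = ⊤ := top_le_iff.1 (htop ▸ sSup_le hle)
        rw [hUtop, finrank_top] at hUd
        exact hcon ⟨n, by rw [hUd, mul_comm]⟩
      have hbot' : U ⊓ S = ⊥ := by
        refine (hmin S hS _ (hinf _ _ hU (hWP S hS)) inf_le_right).resolve_right fun h => hSU ?_
        exact h ▸ inf_le_left
      refine ⟨U ⊔ S, hsup _ _ hU (hWP S hS), ?_⟩
      have := Submodule.finrank_sup_add_finrank_inf_eq U S
      rw [hbot', finrank_bot, hUd, hWd S hS] at this
      rw [Nat.add_mul, one_mul]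
      exact this
  obtain ⟨U, -, hU⟩ := h (finrank k V + 1)
  have h1 := Submodule.finrank_le U
  rw [hU] at h1
  nlinarith

/-- Existence of minimal nonzero submodules with a given property. -/
theorem exists_minimal_submodule {k V : Type*} [Field k] [AddCommGroup V] [Module k V]
    [FiniteDimensional k V] {P : Submodule k V → Prop} {S : Submodule k V} (hP : P S)
    (hS : S ≠ ⊥) : ∃ W ≤ S, P W ∧ W ≠ ⊥ ∧ ∀ T, P T → T ≤ W → T = ⊥ ∨ T = W := by
  induction hn : finrank k S using Nat.strong_induction_on generalizing S with
  | _ n ih =>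
    by_cases h : ∃ T, P T ∧ T < S ∧ T ≠ ⊥
    · obtain ⟨T, hT, hlt, hT0⟩ := h
      obtain ⟨W, hW, h1⟩ := ih _ (hn ▸ Submodule.finrank_lt_finrank_of_lt hlt) hT hT0 rfl
      exact ⟨W, hW.trans hlt.le, h1⟩
    · push Not at h
      refine ⟨S, le_rfl, hP, hS, fun T hT hle => ?_⟩
      rcases hle.eq_or_lt with h1 | h1
      · exact Or.inr h1
      · exact Or.inl (h T hT h1)

theorem exists_basis_of_span_range_eq_top {k V ι : Type*} [Field k] [AddCommGroup V] [Module k V]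
    {n : ℕ} [FiniteDimensional k V] (hV : finrank k V = n) {v : ι → V}
    (hv : Submodule.span k (Set.range v) = ⊤) :
    ∃ (b : Basis (Fin n) k V) (a : Fin n → ι), ∀ i, b i = v (a i) := by
  obtain ⟨κ, a, -, hspan, hli⟩ := exists_linearIndependent' k v
  let B : Basis κ k V := Basis.mk hli (by rw [hspan, hv])
  have : Finite κ := Module.Finite.finite_basis B
  have hcard : Nat.card κ = n := by rw [← Module.finrank_eq_nat_card_basis B, hV]
  let e : κ ≃ Fin n := (Finite.equivFin κ).trans (finCongr hcard)
  exact ⟨B.reindex e, fun i => a (e.symm i), fun i => by simp [B]⟩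

/-- Fibres of equal size on five points: the map is injective or constant. -/
theorem injective_or_const_of_card_fiber {ψ : Type*} {χ : Fin 5 → ψ}
    (h : ∀ i j, Nat.card {l // χ l = χ i} = Nat.card {l // χ l = χ j}) :
    Function.Injective χ ∨ ∀ i j, χ i = χ j := by
  classical
  have h1 : ∀ i, (Finset.univ.filter fun l => χ l = χ i).card = Nat.card {l // χ l = χ 0} := by
    intro i
    rw [← h i 0, Nat.card_eq_fintype_card, Fintype.card_subtype]
  have h2 : (5 : ℕ) = (Finset.univ.image χ).card * Nat.card {l // χ l = χ 0} := by
    have h3 := Finset.card_eq_sum_card_fiberwise (s := (Finset.univ : Finset (Fin 5)))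
      (t := Finset.univ.image χ) (f := χ) (fun x _ => by simp)
    rw [Finset.sum_congr rfl (g := fun _ => Nat.card {l // χ l = χ 0}) ?_, Finset.sum_const,
      smul_eq_mul] at h3
    · simpa using h3
    · intro y hy
      obtain ⟨i, -, rfl⟩ := Finset.mem_image.1 hy
      exact h1 i
  have h3 : (Finset.univ.image χ).card ∣ 5 := ⟨_, h2⟩
  rcases (Nat.dvd_prime (by norm_num)).1 h3 with h4 | h4
  · right
    intro i j
    obtain ⟨y, hy⟩ := Finset.card_eq_one.1 h4
    have h5 : ∀ i, χ i = y := fun i => by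
      have : χ i ∈ Finset.univ.image χ := Finset.mem_image_of_mem _ (Finset.mem_univ i)
      rwa [hy, Finset.mem_singleton] at this
    rw [h5, h5]
  · left
    rw [← Set.injOn_univ, ← Finset.coe_univ]
    exact Finset.card_image_iff.1 (by rw [h4]; rfl)

/-- A transitive group on five points contains a
five-cycle, conjugate to the standard one. -/
theorem Equiv.Perm.exists_conj_finRotate {P : Subgroup (Equiv.Perm (Fin 5))}
    (hP : ∀ i j, ∃ σ ∈ P, σ i = j) : ∃ σ ∈ P, ∃ c : Equiv.Perm (Fin 5),
      ∀ i, σ (c i) = c (i + 1) := by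
  have : MulAction.IsPretransitive P (Fin 5) := ⟨fun i j => by
    obtain ⟨σ, hσ, h⟩ := hP i j
    exact ⟨⟨σ, hσ⟩, h⟩⟩
  have h5 : 5 ∣ Nat.card P := by
    have := MulAction.index_stabilizer_of_transitive P (0 : Fin 5)
    rw [Nat.card_eq_fintype_card, Fintype.card_fin] at this
    have h := Subgroup.index_dvd_card (MulAction.stabilizer P (0 : Fin 5))
    rwa [this] at h
  have : Fact (Nat.Prime 5) := ⟨by norm_num⟩
  obtain ⟨⟨σ, hσ⟩, ho⟩ := exists_prime_orderOf_dvd_card' 5 h5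
  rw [Subgroup.orderOf_mk] at ho
  have hcyc : σ.IsCycle := Equiv.Perm.isCycle_of_prime_order' (by rw [ho]; norm_num)
    (by rw [ho]; simp)
  have hconj : IsConj (finRotate 5) σ := by
    refine (Equiv.Perm.IsCycle.isConj_iff isCycle_finRotate hcyc).2 ?_
    rw [← hcyc.orderOf, ho, support_finRotate]
    rfl
  obtain ⟨c, hc⟩ := isConj_iff.1 hconj
  refine ⟨σ, hσ, c, fun i => ?_⟩
  rw [← hc]
  simp
section AlgebraOnModule
variable {k V : Type*} [Field k] [AddCommGroup V] [Module k V]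
variable {m : V →ₗ[k] V →ₗ[k] V}
namespace IsIrredAlt
variable {G : Type*} [Group G] {ρ : G →* (V ≃ₗ[k] V)} (H : IsIrredAlt ρ m)
include H
theorem eq_one_of_scalar (hρ : Function.Injective ρ) {g : G} {t : k}
    (h : ∀ x, ρ g x = t • x) : g = 1 := by
  have ht0 : t ≠ 0 := by
    rintro rfl
    obtain ⟨x, y, hxy⟩ := H.ne_zero
    exact hxy ((ρ g).map_eq_zero_iff.1 (by rw [h, zero_smul]))
  have ht : t = 1 := by
    obtain ⟨x, y, hxy⟩ := H.ne_zero
    have h1 := H.map_mul g x y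
    rw [h, h, h, _root_.map_smul, _root_.map_smul, LinearMap.smul_apply, smul_smul] at h1
    have h2 : (t - t * t) • m x y = 0 := by rw [sub_smul, h1, sub_self]
    have h3 := (smul_eq_zero.1 h2).resolve_right hxy
    have h4 : t * (1 - t) = 0 := by linear_combination h3
    linear_combination -(mul_eq_zero.1 h4).resolve_left ht0
  refine hρ (LinearEquiv.ext fun x => ?_)
  rw [h, ht, one_smul, _root_.map_one, LinearEquiv.coe_one, id_eq]

/-- Clifford's theorem in dimension five: a reducible normal subgroup is diagonalisable, and the
group permutes an eigenbasis up to scalars. -/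
theorem exists_basis_of_normal_of_reducible {N : Subgroup G} [hN : N.Normal]
    (hred : ∃ S : Submodule k V, (∀ g ∈ N, ∀ x ∈ S, ρ g x ∈ S) ∧ S ≠ ⊥ ∧ S ≠ ⊤) :
    ∃ (b : Basis (Fin 5) k V) (χ : Fin 5 → N → k), (∀ (n : N) i, ρ (n : G) (b i) = χ i n • b i) ∧
      ∀ i j, ∃ g, ρ g (b i) = b j := by
  have := H.finiteDimensional
  obtain ⟨S, hS, hS0, hS1⟩ := hred
  obtain ⟨W, hWS, hW, hW0, hWmin⟩ :=
    exists_minimal_submodule (P := fun S => ∀ g ∈ N, ∀ x ∈ S, ρ g x ∈ S) hS hS0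
  have hinv : ∀ (a c : G) (x : V), ρ a (ρ c x) = ρ (a * c) x := fun a c x => by
    rw [_root_.map_mul, LinearEquiv.mul_apply]
  have htr : ∀ (g : G) (T : Submodule k V), (∀ n ∈ N, ∀ x ∈ T, ρ n x ∈ T) →
      ∀ n ∈ N, ∀ x ∈ T.map (ρ g : V →ₗ[k] V), ρ n x ∈ T.map (ρ g : V →ₗ[k] V) := by
    rintro g T hT n hn _ ⟨x, hx, rfl⟩
    refine ⟨ρ (g⁻¹ * n * g) x, hT _ ?_ x hx, ?_⟩
    · have := hN.conj_mem n hn g⁻¹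
      rwa [inv_inv] at this
    · simp only [LinearEquiv.coe_coe, hinv]
      congr 2
      group
  have hgg : ∀ (g : G) (T : Submodule k V),
      (T.map (ρ g⁻¹ : V →ₗ[k] V)).map (ρ g : V →ₗ[k] V) = T := by
    intro g T
    rw [← Submodule.map_comp]
    convert Submodule.map_id T
    ext x
    simp
  have hsup : sSup (Set.range fun g : G => W.map (ρ g : V →ₗ[k] V)) = ⊤ := by
    refine (H.irred _ fun g => ?_).resolve_left fun h => hW0 ?_
    · intro x hx
      have : (sSup (Set.range fun g : G => W.map (ρ g : V →ₗ[k] V))).map (ρ g : V →ₗ[k] V) ≤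
          sSup (Set.range fun g : G => W.map (ρ g : V →ₗ[k] V)) := by
        rw [sSup_range, Submodule.map_iSup]
        refine iSup_le fun a => ?_
        refine le_trans (le_of_eq ?_) (le_iSup _ (g * a))
        rw [← Submodule.map_comp]
        congr 1
        ext x
        exact hinv g a x
      exact this ⟨x, hx, rfl⟩
    · rw [eq_bot_iff, ← h]
      refine le_trans (le_of_eq ?_) (le_sSup ⟨1, rfl⟩)
      simp only [_root_.map_one]
      exact (Submodule.map_id W).symm
  have hd : finrank k W ∣ finrank k V := by
    refine dvd_finrank_of_sSup_eq_top (P := fun S => ∀ g ∈ N, ∀ x ∈ S, ρ g x ∈ S) ?_ ?_ ?_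
      ?_ ?_ ?_ ?_ hsup
    · intro g _ x hx
      rw [Submodule.mem_bot] at hx ⊢
      rw [hx, _root_.map_zero]
    · exact fun A B hA hB g hg x hx => ⟨hA g hg x hx.1, hB g hg x hx.2⟩
    · intro A B hA hB g hg x hx
      obtain ⟨y, hy, z, hz, rfl⟩ := Submodule.mem_sup.1 hx
      rw [_root_.map_add]
      exact Submodule.add_mem_sup (hA g hg y hy) (hB g hg z hz)
    · exact Nat.pos_of_ne_zero fun h => hW0 (Submodule.finrank_eq_zero.1 h)
    · rintro _ ⟨g, rfl⟩
      exact LinearEquiv.finrank_map_eq (ρ g) W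
    · rintro _ ⟨g, rfl⟩
      exact htr g W hW
    · rintro _ ⟨g, rfl⟩ T hT hle
      have h1 := hWmin _ (htr g⁻¹ T hT) (by
        refine (Submodule.map_mono hle).trans (le_of_eq ?_)
        have := hgg g⁻¹ W
        rwa [inv_inv] at this)
      rcases h1 with h1 | h1
      · left
        rw [← hgg g T, h1, Submodule.map_bot]
      · right
        rw [← hgg g T, h1]
  rw [H.finrank_eq, Nat.dvd_prime (by norm_num)] at hd
  have hW1 : finrank k W = 1 := by
    refine hd.resolve_right fun h5 => hS1 ?_
    rw [eq_top_iff]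
    refine le_trans (le_of_eq ?_) hWS
    exact (Submodule.eq_top_of_finrank_eq (by rw [h5, H.finrank_eq])).symm
  obtain ⟨⟨w, hw⟩, hw0, hwW⟩ := finrank_eq_one_iff'.1 hW1
  have hwW' : ∀ x ∈ W, ∃ c : k, x = c • w := fun x hx => by
    obtain ⟨c, hc⟩ := hwW ⟨x, hx⟩
    exact ⟨c, (congrArg Subtype.val hc).symm⟩
  have hspan : Submodule.span k (Set.range fun g : G => ρ g w) = ⊤ := by
    rw [eq_top_iff, ← hsup]
    refine sSup_le ?_
    rintro _ ⟨g, rfl⟩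
    rintro _ ⟨x, hx, rfl⟩
    obtain ⟨c, rfl⟩ := hwW' x hx
    simp only [LinearEquiv.coe_coe, _root_.map_smul]
    exact Submodule.smul_mem _ _ (Submodule.subset_span ⟨g, rfl⟩)
  obtain ⟨b, a, hb⟩ := exists_basis_of_span_range_eq_top H.finrank_eq hspan
  have hex : ∀ (i : Fin 5) (n : N), ∃ t : k, ρ (n : G) (b i) = t • b i := by
    intro i n
    have h1 := htr (a i) W hW n n.2 (b i) ⟨w, hw, (hb i).symm⟩
    obtain ⟨x, hx, h2⟩ := h1
    obtain ⟨c, rfl⟩ := hwW' x hx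
    refine ⟨c, ?_⟩
    rw [← h2, hb, LinearEquiv.coe_coe, _root_.map_smul]
  choose χ hχ using hex
  refine ⟨b, χ, fun n i => hχ i n, fun i j => ⟨a j * (a i)⁻¹, ?_⟩⟩
  rw [hb, hb, hinv, inv_mul_cancel_right]
/-- The eigencharacters of a nontrivial reducible normal subgroup are pairwise distinct. -/
theorem injective_of_normal (hρ : Function.Injective ρ) {N : Subgroup G} [hN : N.Normal]
    (hN0 : N ≠ ⊥) {b : Basis (Fin 5) k V} {χ : Fin 5 → N → k}
    (hχ : ∀ (n : N) i, ρ (n : G) (b i) = χ i n • b i) (htr : ∀ i j, ∃ g, ρ g (b i) = b j) :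
    Function.Injective χ := by
  classical
  have := H.finiteDimensional
  let E : Fin 5 → Submodule k V := fun i =>
    { carrier := {x | ∀ n : N, ρ (n : G) x = χ i n • x}
      add_mem' := fun {x y} hx hy n => by rw [_root_.map_add, hx, hy, smul_add]
      zero_mem' := fun n => by rw [_root_.map_zero, smul_zero]
      smul_mem' := fun c x hx n => by rw [_root_.map_smul, hx, smul_comm] }
  have hE : ∀ i, E i = Submodule.span k (Set.range fun l : {l // χ l = χ i} => b l) := by
    intro i
    apply le_antisymm
    · intro x hx
      rw [← b.sum_repr x]
      refine Submodule.sum_mem _ fun l _ => ?_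
      by_cases hl : χ l = χ i
      · exact Submodule.smul_mem _ _ (Submodule.subset_span ⟨⟨l, hl⟩, rfl⟩)
      · obtain ⟨n, hn⟩ : ∃ n, χ l n ≠ χ i n := by
          by_contra! h
          exact hl (funext h)
        have h1 : b.coord l (ρ (n : G) x) = χ l n * b.coord l x :=
          coord_map_of_eigenbasis (f := (ρ (n : G) : V →ₗ[k] V)) (fun i => hχ n i) l x
        rw [hx n, _root_.map_smul, smul_eq_mul] at h1
        have h2 : (χ i n - χ l n) * b.coord l x = 0 := by rw [sub_mul, h1, sub_self]
        have h3 := (mul_eq_zero.1 h2).resolve_left (sub_ne_zero.2 hn.symm)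
        rw [Basis.coord_apply] at h3
        rw [h3, zero_smul]
        exact Submodule.zero_mem _
    · rw [Submodule.span_le]
      rintro _ ⟨⟨l, hl⟩, rfl⟩ n
      rw [hχ, hl]
  have hfin : ∀ i, finrank k (E i) = Nat.card {l // χ l = χ i} := by
    intro i
    rw [hE, Nat.card_eq_fintype_card]
    exact finrank_span_eq_card (b.linearIndependent.comp _ Subtype.val_injective)
  have hle : ∀ i j, finrank k (E i) ≤ finrank k (E j) := by
    intro i j
    obtain ⟨g, hg⟩ := htr i j
    have hconj : ∀ (n : N), χ j n = χ i ⟨g⁻¹ * n * g, by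
        have := hN.conj_mem n n.2 g⁻¹
        rwa [inv_inv] at this⟩ := by
      intro n
      have h1 : ρ (n : G) (ρ g (b i)) = ρ g (ρ (g⁻¹ * n * g) (b i)) := by
        rw [← LinearEquiv.mul_apply, ← LinearEquiv.mul_apply, ← _root_.map_mul, ← _root_.map_mul]
        congr 2
        group
      have h2 := hχ ⟨g⁻¹ * n * g, by
        have := hN.conj_mem n n.2 g⁻¹
        rwa [inv_inv] at this⟩ i
      rw [h2, _root_.map_smul, hg, hχ] at h1
      have h3 := congrArg (b.coord j) h1
      simpa using h3
    rw [← LinearEquiv.finrank_map_eq (ρ g) (E i)]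
    apply Submodule.finrank_mono
    rintro _ ⟨x, hx, rfl⟩ n
    have h1 : ρ (n : G) (ρ g x) = ρ g (ρ (g⁻¹ * n * g) x) := by
      rw [← LinearEquiv.mul_apply, ← LinearEquiv.mul_apply, ← _root_.map_mul, ← _root_.map_mul]
      congr 2
      group
    have h2 := hx ⟨g⁻¹ * n * g, by
      have := hN.conj_mem n n.2 g⁻¹
      rwa [inv_inv] at this⟩
    rw [LinearEquiv.coe_coe, h1, h2, _root_.map_smul, hconj]
  refine (injective_or_const_of_card_fiber fun i j => ?_).resolve_right fun h => hN0 ?_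
  · rw [← hfin, ← hfin]
    exact le_antisymm (hle i j) (hle j i)
  · rw [eq_bot_iff]
    intro n hn
    refine H.eq_one_of_scalar hρ (t := χ 0 ⟨n, hn⟩) fun x => ?_
    have h1 : (ρ n : V →ₗ[k] V) = χ 0 ⟨n, hn⟩ • LinearMap.id := b.ext fun i => by
      have := hχ ⟨n, hn⟩ i
      rw [h i 0] at this
      simpa using this
    exact LinearMap.congr_fun h1 x
end IsIrredAlt
end AlgebraOnModule

theorem Module.Basis.eq_of_smul_eq_smul {k V ι : Type*} [Field k] [AddCommGroup V] [Module k V]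
    (b : Basis ι k V) {s t : k} {i j : ι} (ht : t ≠ 0) (h : t • b i = s • b j) : i = j := by
  classical
  by_contra hne
  have h1 := congrArg (b.coord i) h
  simp [Ne.symm hne, ht] at h1

/-- A group normalising a multiplicity free diagonal group is monomial. -/
theorem exists_monomial_of_normal {k V G : Type*} [Field k] [AddCommGroup V] [Module k V] [Group G]
    {ρ : G →* (V ≃ₗ[k] V)} {N : Subgroup G} [hN : N.Normal]
    {b : Basis (Fin 5) k V} {χ : Fin 5 → N → k}
    (hχ : ∀ (n : N) i, ρ (n : G) (b i) = χ i n • b i) (hinj : Function.Injective χ) :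
    ∃ (π : G →* Equiv.Perm (Fin 5)) (τ : G → Fin 5 → k), (∀ g i, τ g i ≠ 0) ∧
      ∀ g i, ρ g (b i) = τ g i • b (π g i) := by
  classical
  have h0 : ∀ g : G, ∃ (σ : Equiv.Perm (Fin 5)) (τ : Fin 5 → k), (∀ i, τ i ≠ 0) ∧
      ∀ i, ρ g (b i) = τ i • b (σ i) := by
    intro g
    refine exists_perm_of_eigenvectors fun i => ?_
    have hx : ∀ n : N, ∃ t : k, ρ (n : G) (ρ g (b i)) = t • ρ g (b i) := by
      intro n
      have hm : g⁻¹ * n * g ∈ N := by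
        have := hN.conj_mem n n.2 g⁻¹
        rwa [inv_inv] at this
      have h1 : ρ (n : G) (ρ g (b i)) = ρ g (ρ (g⁻¹ * n * g) (b i)) := by
        rw [← LinearEquiv.mul_apply, ← LinearEquiv.mul_apply, ← map_mul, ← map_mul]
        congr 2
        group
      exact ⟨χ i ⟨_, hm⟩, by rw [h1, hχ ⟨_, hm⟩ i, map_smul]⟩
    have hx0 : ρ g (b i) ≠ 0 := (ρ g).map_ne_zero_iff.2 (b.ne_zero i)
    generalize ρ g (b i) = x at hx hx0
    obtain ⟨j, hj⟩ : ∃ j, b.coord j x ≠ 0 := by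
      by_contra! h
      exact hx0 (b.ext_elem fun i => by simpa using h i)
    have hu : ∀ n l, b.coord l x ≠ 0 → χ l n = (hx n).choose := by
      intro n l hl
      have h1 : b.coord l (ρ (n : G) x) = χ l n * b.coord l x :=
        coord_map_of_eigenbasis (f := (ρ (n : G) : V →ₗ[k] V)) (fun i => hχ n i) l x
      rw [(hx n).choose_spec, map_smul, smul_eq_mul] at h1
      exact (mul_right_cancel₀ hl h1).symm
    refine ⟨j, b.coord j x, b.ext_elem fun l => ?_⟩
    by_cases hl : l = j
    · subst hl
      simp
    · have : b.coord l x = 0 := by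
        by_contra h
        exact hl (hinj (funext fun n => by rw [hu n l h, hu n j hj]))
      rw [Basis.coord_apply] at this
      simp [this, Ne.symm hl]
  choose σ τ hτ hσ using h0
  refine ⟨MonoidHom.mk' σ fun g c => Equiv.ext fun i => ?_, τ, hτ, hσ⟩
  refine b.eq_of_smul_eq_smul (s := τ c i * τ g (σ c i)) (hτ (g * c) i) ?_
  rw [← hσ, map_mul, LinearEquiv.mul_apply, hσ, map_smul, hσ, smul_smul, Equiv.Perm.mul_apply]

/-- A nonzero alternating product gives a multiplicative relation between the eigenvalues of its
diagonal automorphisms. -/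
theorem exists_mul_eq_of_eigenbasis {k V ι : Type*} [Field k] [AddCommGroup V] [Module k V]
    {m : V →ₗ[k] V →ₗ[k] V} (b : Basis ι k V) (halt : ∀ x, m x x = 0)
    (hne : ∃ x y, m x y ≠ 0) : ∃ i j l, i ≠ j ∧ ∀ (f : V →ₗ[k] V) (lam : ι → k),
      (∀ x y, f (m x y) = m (f x) (f y)) → (∀ i, f (b i) = lam i • b i) →
        lam i * lam j = lam l := by
  obtain ⟨i, j, l, hl⟩ : ∃ i j l, b.coord l (m (b i) (b j)) ≠ 0 := by
    by_contra! hcon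
    obtain ⟨x, y, hxy⟩ := hne
    have : m = 0 := b.ext fun i => b.ext fun j => b.ext_elem fun l => by simpa using hcon i j l
    rw [this] at hxy
    exact hxy rfl
  refine ⟨i, j, l, ?_, fun f lam hm hf => ?_⟩
  · rintro rfl
    rw [halt, map_zero] at hl
    exact hl rfl
  · have h1 : b.coord l (f (m (b i) (b j))) = lam l * b.coord l (m (b i) (b j)) :=
      coord_map_of_eigenbasis hf l _
    rw [hm, hf, hf] at h1
    simp only [map_smul, LinearMap.smul_apply, smul_eq_mul] at h1
    exact mul_right_cancel₀ hl (by linear_combination h1)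
section AlgebraOnModule
variable {k V : Type*} [Field k] [AddCommGroup V] [Module k V]
variable {m : V →ₗ[k] V →ₗ[k] V}
namespace IsIrredAlt
variable {G : Type*} [Group G] {ρ : G →* (V ≃ₗ[k] V)} (H : IsIrredAlt ρ m)
include H
/-- Diagonal elements of a group containing a monomial five-cycle have coefficients that are
eleventh roots of unity, and are determined by any one of them. -/
theorem diagCoeff_pow_eleven {b : Basis (Fin 5) k V} {h : G} {τ : Fin 5 → k} (hτ : ∀ i, τ i ≠ 0)
    (hh : ∀ i, ρ h (b i) = τ i • b (i + 1)) {K : Subgroup G} (hKh : ∀ x ∈ K, h * x * h⁻¹ ∈ K)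
    (hK : ∀ x ∈ K, ∀ i, ρ x (b i) = diagCoeff ρ b x i • b i) {x : G} (hx : x ∈ K) :
    (∀ t, diagCoeff ρ b x t ^ 11 = 1) ∧
      ∀ s, diagCoeff ρ b x s = 1 → ∀ t, diagCoeff ρ b x t = 1 := by
  obtain ⟨i, j, l, hij, hl⟩ := exists_mul_eq_of_eigenbasis b H.alt H.ne_zero
  have hrel : ∀ x ∈ K, diagCoeff ρ b x i * diagCoeff ρ b x j = diagCoeff ρ b x l :=
    fun x hx => hl (ρ x : V →ₗ[k] V) _ (H.map_mul x) (hK x hx)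
  have hconj : ∀ x ∈ K, ∀ i, diagCoeff ρ b (h * x * h⁻¹) (i + 1) = diagCoeff ρ b x i := by
    intro x hx i
    exact diagCoeff_conj (σ := Equiv.addRight 1) hτ hh (hK x hx) i
  have hrelt : ∀ (n : ℕ), ∀ x ∈ K, diagCoeff ρ b x (i - n • (1 : Fin 5)) *
      diagCoeff ρ b x (j - n • (1 : Fin 5)) = diagCoeff ρ b x (l - n • (1 : Fin 5)) := by
    intro n
    induction n with
    | zero => simpa using hrel
    | succ n ih =>
      intro x hx
      have := ih _ (hKh x hx)
      have e : ∀ i : Fin 5, i - n • (1 : Fin 5) = (i - (n + 1) • (1 : Fin 5)) + 1 := fun i => by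
        rw [succ_nsmul, sub_add_eq_sub_sub, sub_add_cancel]
      rwa [e i, e j, e l, hconj x hx, hconj x hx, hconj x hx] at this
  refine pow_eleven_of_cyclic_relation (i := i - l) (j := j - l) ?_ ?_ ?_
  · intro t h0
    have h1 := hK x hx t
    rw [h0, zero_smul] at h1
    exact b.ne_zero t ((ρ x).map_eq_zero_iff.1 h1)
  · exact fun h => hij (sub_left_injective h)
  · intro t
    obtain ⟨n, hn⟩ : ∃ n : ℕ, l - n • (1 : Fin 5) = t :=
      ⟨(l - t).val, by clear * -; revert l t; decide⟩
    have := hrelt n x hx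
    rw [hn] at this
    rw [← this, ← hn]
    congr 2 <;> abel
end IsIrredAlt
end AlgebraOnModule

/-- Irreducibility of a multiplicity free diagonal action together with a monomial five-cycle. -/
theorem eq_bot_or_eq_top_of_diag_of_shift {k V D : Type*} [Field k] [AddCommGroup V] [Module k V]
    {b : Basis (Fin 5) k V} {f : D → V →ₗ[k] V} {chi : D → Fin 5 → k}
    (hf : ∀ d i, f d (b i) = chi d i • b i) (hchi : ∀ i j, i ≠ j → ∃ d, chi d i ≠ chi d j)
    {T : V →ₗ[k] V} {τ : Fin 5 → k} (hτ : ∀ i, τ i ≠ 0) (hT : ∀ i, T (b i) = τ i • b (i + 1))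
    {S : Submodule k V} (hS : ∀ d, ∀ x ∈ S, f d x ∈ S) (hST : ∀ x ∈ S, T x ∈ S) :
    S = ⊥ ∨ S = ⊤ := by
  refine eq_bot_or_eq_top_of_diag_of_perm hf hchi hS ?_
  have hstep : ∀ i, b i ∈ S → b (i + 1) ∈ S := by
    intro i hi
    have h1 := hST _ hi
    rw [hT] at h1
    exact (S.smul_mem_iff (hτ i)).1 h1
  have hstepn : ∀ (n : ℕ) i, b i ∈ S → b (i + n • (1 : Fin 5)) ∈ S := by
    intro n i hi
    induction n with
    | zero => simpa using hi
    | succ n ih =>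
      rw [succ_nsmul, ← add_assoc]
      exact hstep _ ih
  intro i j hi
  obtain ⟨n, rfl⟩ : ∃ n : ℕ, i + n • (1 : Fin 5) = j :=
    ⟨(j - i).val, by clear * -; revert i j; decide⟩
  exact hstepn n i hi
section AlgebraOnModule
variable {k V : Type*} [Field k] [AddCommGroup V] [Module k V]
variable {m : V →ₗ[k] V →ₗ[k] V}
namespace IsIrredAlt
variable {G : Type*} [Group G] {ρ : G →* (V ≃ₗ[k] V)} (H : IsIrredAlt ρ m)
include H
/-- A minimal irreducible group with a proper nontrivial normal subgroup is monomial of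
order 55. -/
theorem card_eq_of_not_isSimpleGroup [Finite G] (hρ : Function.Injective ρ)
    (hmin : ∀ K : Subgroup G, (∀ S : Submodule k V, (∀ g ∈ K, ∀ x ∈ S, ρ g x ∈ S) →
      S = ⊥ ∨ S = ⊤) → K = ⊤)
    {N : Subgroup G} [hN : N.Normal] (hN0 : N ≠ ⊥) (hN1 : N ≠ ⊤) :
    Nat.card G = 55 ∧ (∃ z : k, z ^ 11 = 1 ∧ z ≠ 1) ∧
      ∃ (b : Basis (Fin 5) k V) (χ : Fin 5 → N → k) (h : G) (τ : Fin 5 → k),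
        (∀ (n : N) i, ρ (n : G) (b i) = χ i n • b i) ∧ Function.Injective χ ∧
        (∀ i, τ i ≠ 0) ∧ ∀ i, ρ h (b i) = τ i • b (i + 1) := by
  have hred : ∃ S : Submodule k V, (∀ g ∈ N, ∀ x ∈ S, ρ g x ∈ S) ∧ S ≠ ⊥ ∧ S ≠ ⊤ := by
    by_contra! hcon
    exact hN1 (hmin N fun S hS => or_iff_not_imp_left.2 (hcon S hS))
  obtain ⟨b₀, χ₀, hχ₀, htr₀⟩ := H.exists_basis_of_normal_of_reducible hred
  have hinj₀ := H.injective_of_normal hρ hN0 hχ₀ htr₀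
  obtain ⟨π₀, τ₀, hτ₀, hπ₀⟩ := exists_monomial_of_normal hχ₀ hinj₀
  obtain ⟨_, ⟨h, rfl⟩, c, hc⟩ := Equiv.Perm.exists_conj_finRotate (P := π₀.range) fun i j => by
    obtain ⟨g, hg⟩ := htr₀ i j
    refine ⟨π₀ g, ⟨g, rfl⟩, b₀.eq_of_smul_eq_smul (hτ₀ g i) (s := 1) ?_⟩
    rw [← hπ₀, hg, one_smul]
  obtain ⟨b, hb⟩ : ∃ b : Basis (Fin 5) k V, ∀ i, b i = b₀ (c i) := ⟨b₀.reindex c.symm, by simp⟩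
  obtain ⟨χ, hχdef⟩ : ∃ χ : Fin 5 → N → k, χ = χ₀ ∘ c := ⟨_, rfl⟩
  have hχ : ∀ (n : N) i, ρ (n : G) (b i) = χ i n • b i := fun n i => by
    rw [hb, hχ₀, hχdef, Function.comp_apply]
  have hinj : Function.Injective χ := by
    rw [hχdef]
    exact hinj₀.comp c.injective
  obtain ⟨τ, hτ, hh⟩ : ∃ τ : Fin 5 → k, (∀ i, τ i ≠ 0) ∧ ∀ i, ρ h (b i) = τ i • b (i + 1) :=
    ⟨fun i => τ₀ h (c i), fun i => hτ₀ _ _, fun i => by rw [hb, hπ₀, hc, hb]⟩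
  obtain ⟨π, τ₁, hτ₁, hπ⟩ := exists_monomial_of_normal hχ hinj
  have hπh : π h = finRotate 5 := by
    ext1 i
    rw [finRotate_apply]
    exact b.eq_of_smul_eq_smul (hτ₁ h i) (by rw [← hπ, hh])
  have hNK : N ≤ π.ker := by
    intro n hn
    rw [MonoidHom.mem_ker]
    ext1 i
    exact b.eq_of_smul_eq_smul (hτ₁ n i) (by rw [← hπ, hχ ⟨n, hn⟩, Equiv.Perm.one_apply])
  have hK : ∀ x ∈ π.ker, ∀ i, ρ x (b i) = diagCoeff ρ b x i • b i := by
    intro x hx i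
    have h1 := hπ x i
    rw [MonoidHom.mem_ker.1 hx, Equiv.Perm.one_apply] at h1
    rw [diagCoeff_eq h1, h1]
  have hroot := fun x (hx : x ∈ π.ker) => H.diagCoeff_pow_eleven hτ hh (K := π.ker)
    (fun x hx => (MonoidHom.normal_ker π).conj_mem x hx h) hK hx
  have htop : π.ker ⊔ Subgroup.zpowers h = ⊤ := by
    refine hmin _ fun S hS => ?_
    exact eq_bot_or_eq_top_of_diag_of_shift (f := fun n : N => (ρ (n : G) : V →ₗ[k] V))
      (chi := fun n i => χ i n) hχ
      (fun i j hij => by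
        by_contra! hcon
        exact hij (hinj (funext hcon)))
      (T := (ρ h : V →ₗ[k] V)) hτ hh
      (fun n x hx => hS n (Subgroup.mem_sup_left (hNK n.2)) x hx)
      (hS h (Subgroup.mem_sup_right (Subgroup.mem_zpowers h)))
  have hrange : π.range = Subgroup.zpowers (finRotate 5) := by
    rw [MonoidHom.range_eq_map, ← htop, Subgroup.map_sup, MonoidHom.map_zpowers, hπh]
    rw [(Subgroup.map_eq_bot_iff _).2 le_rfl, bot_sup_eq]
  have hcardrange : Nat.card π.range = 5 := by
    rw [hrange, Nat.card_zpowers, isCycle_finRotate.orderOf, support_finRotate]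
    rfl
  have hinjK : ∀ x ∈ π.ker, diagCoeff ρ b x 0 = 1 → x = 1 := by
    intro x hx h0
    refine eq_one_of_forall_basis (b := b) hρ fun i => ?_
    rw [hK x hx, (hroot x hx).2 0 h0, one_smul]
  let f : π.ker →* k :=
    { toFun := fun x => diagCoeff ρ b x 0
      map_one' := diagCoeff_eq (by simp)
      map_mul' := fun x y => diagCoeff_mul (hK x x.2) (hK y y.2) 0 }
  have hf : Function.Injective f := by
    intro x y hxy
    have h1 : f (x * y⁻¹) = 1 := by
      rw [_root_.map_mul, hxy, ← _root_.map_mul, mul_inv_cancel, _root_.map_one]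
    exact mul_inv_eq_one.1 (Subtype.ext (hinjK _ (x * y⁻¹).2 h1))
  have hcyc : IsCyclic π.ker := isCyclic_of_injective_ringHom f hf
  obtain ⟨x, hx⟩ := hcyc.exists_generator
  have hx11 : x ^ 11 = 1 := hf (by rw [_root_.map_pow, _root_.map_one]; exact (hroot x x.2).1 0)
  have hcardx : Nat.card π.ker = orderOf x := (orderOf_eq_card_of_forall_mem_zpowers hx).symm
  have hx1 : x ≠ 1 := by
    rintro rfl
    refine hN0 (eq_bot_iff.2 fun n hn => ?_)
    have h1 := hx ⟨n, hNK hn⟩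
    rw [Subgroup.zpowers_one_eq_bot, Subgroup.mem_bot] at h1
    exact congrArg Subtype.val h1
  have hox : orderOf x = 11 := by
    have : Fact (Nat.Prime 11) := ⟨by norm_num⟩
    exact orderOf_eq_prime hx11 hx1
  refine ⟨?_, ⟨f x, ?_, fun h1 => hx1 (hf (by rw [h1, _root_.map_one]))⟩, b, χ, h, τ, hχ, hinj,
    hτ, hh⟩
  · rw [← Subgroup.card_mul_index π.ker, Subgroup.index_ker, hcardrange, hcardx, hox]
  · rw [← _root_.map_pow, hx11, _root_.map_one]
end IsIrredAlt
end AlgebraOnModule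

section BaseChange

variable {F k : Type*} [Field F] [Field k] [Algebra F k]

/-- The representation of `GL₅` on row vectors, made covariant by inverting. -/
def rowRep : GL (Fin 5) k →* ((Fin 5 → k) ≃ₗ[k] (Fin 5 → k)) where
  toFun g := LinearEquiv.ofLinearMap (Matrix.vecMulLinear (g⁻¹ : GL (Fin 5) k).1)
    (Matrix.vecMulLinear g.1)
    (LinearMap.ext fun x => by
      change Matrix.vecMul (Matrix.vecMul x g.1) (g⁻¹ : GL (Fin 5) k).1 = x
      rw [Matrix.vecMul_vecMul, ← Units.val_mul, mul_inv_cancel, Units.val_one, Matrix.vecMul_one])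
    (LinearMap.ext fun x => by
      change Matrix.vecMul (Matrix.vecMul x (g⁻¹ : GL (Fin 5) k).1) g.1 = x
      rw [Matrix.vecMul_vecMul, ← Units.val_mul, inv_mul_cancel, Units.val_one, Matrix.vecMul_one])
  map_one' := by ext1 x; simp
  map_mul' g h := by
    ext1 x
    simp [mul_inv_rev, Matrix.vecMul_vecMul]

theorem rowRep_apply (g : GL (Fin 5) k) (x : Fin 5 → k) :
    rowRep g x = Matrix.vecMul x (g⁻¹ : GL (Fin 5) k).1 := rfl

theorem rowRep_injective : Function.Injective (rowRep (k := k)) := by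
  intro g h hgh
  have h1 : (g⁻¹ : GL (Fin 5) k).1 = (h⁻¹ : GL (Fin 5) k).1 := by
    ext i j
    have h2 := congrFun (LinearEquiv.congr_fun hgh (Pi.single i 1)) j
    rw [rowRep_apply, rowRep_apply] at h2
    simpa using h2
  exact inv_injective (Units.ext h1)

variable (F k) in
/-- The inclusion of `F⁵` in `k⁵`. -/
def rowIncl : (Fin 5 → F) →ₗ[F] (Fin 5 → k) := (Algebra.linearMap F k).compLeft (Fin 5)

theorem rowIncl_apply (x : Fin 5 → F) (i : Fin 5) : rowIncl F k x i = algebraMap F k (x i) := rfl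

theorem rowIncl_injective : Function.Injective (rowIncl F k) := fun x y h =>
  funext fun i => (algebraMap F k).injective (congrFun h i)

theorem rowIncl_single (i : Fin 5) : rowIncl F k (Pi.single i 1) = Pi.single i 1 := by
  ext j
  rw [rowIncl_apply]
  by_cases h : j = i
  · subst h; simp
  · simp [h]

variable (k) in
/-- The base change of `rowRep`. -/
def rowRepMap : GL (Fin 5) F →* ((Fin 5 → k) ≃ₗ[k] (Fin 5 → k)) :=
  rowRep.comp (Matrix.GeneralLinearGroup.map (algebraMap F k))

theorem rowRepMap_apply (g : GL (Fin 5) F) (x : Fin 5 → k) :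
    rowRepMap k g x = Matrix.vecMul x ((g⁻¹ : GL (Fin 5) F).1.map (algebraMap F k)) := by
  rw [rowRepMap, MonoidHom.comp_apply, rowRep_apply, ← map_inv]
  rfl

theorem rowRepMap_rowIncl (g : GL (Fin 5) F) (x : Fin 5 → F) :
    rowRepMap k g (rowIncl F k x) = rowIncl F k (rowRep g x) := by
  ext i
  rw [rowRepMap_apply, rowIncl_apply, rowRep_apply, RingHom.map_vecMul]
  rfl

theorem rowRepMap_injective : Function.Injective (rowRepMap (F := F) k) := by
  intro g h hgh
  refine rowRep_injective (LinearEquiv.ext fun x => rowIncl_injective (k := k) ?_)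
  rw [← rowRepMap_rowIncl, ← rowRepMap_rowIncl, hgh]

theorem rowRepMap_comp (σ : k ≃ₐ[F] k) (g : GL (Fin 5) F) (x : Fin 5 → k) :
    rowRepMap k g (σ ∘ x) = σ ∘ rowRepMap k g x := by
  ext i
  have h1 : ((g⁻¹ : GL (Fin 5) F).1.map (algebraMap F k)).map σ =
      (g⁻¹ : GL (Fin 5) F).1.map (algebraMap F k) := by
    ext i j
    simp
  have h2 := RingHom.map_vecMul (σ : k →+* k) ((g⁻¹ : GL (Fin 5) F).1.map (algebraMap F k)) x i
  rw [rowRepMap_apply, rowRepMap_apply]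
  refine Eq.trans ?_ h2.symm
  have h3 : ((g⁻¹ : GL (Fin 5) F).1.map (algebraMap F k)).map (σ : k →+* k) =
      (g⁻¹ : GL (Fin 5) F).1.map (algebraMap F k) := h1
  rw [h3]
  rfl

/-- The submodule of vectors whose `σ`-twist lies in `S`. -/
def twist (σ : k ≃ₐ[F] k) (S : Submodule k (Fin 5 → k)) : Submodule k (Fin 5 → k) where
  carrier := {x | σ ∘ x ∈ S}
  add_mem' {x y} hx hy := by
    have : σ ∘ (x + y) = σ ∘ x + σ ∘ y := by ext; simp
    simpa only [Set.mem_ofPred_eq, this] using S.add_mem hx hy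
  zero_mem' := by
    have : σ ∘ (0 : Fin 5 → k) = 0 := by ext; simp
    simp only [Set.mem_ofPred_eq, this, S.zero_mem]
  smul_mem' c x hx := by
    have : σ ∘ (c • x) = σ c • σ ∘ x := by ext; simp
    simpa only [Set.mem_ofPred_eq, this] using S.smul_mem _ hx

theorem mem_twist {σ : k ≃ₐ[F] k} {S : Submodule k (Fin 5 → k)} {x : Fin 5 → k} :
    x ∈ twist σ S ↔ σ ∘ x ∈ S := Iff.rfl

theorem twist_mul (σ τ : k ≃ₐ[F] k) (S : Submodule k (Fin 5 → k)) :
    twist (σ * τ) S = twist τ (twist σ S) := rfl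

theorem twist_one (S : Submodule k (Fin 5 → k)) : twist (1 : k ≃ₐ[F] k) S = S := rfl

theorem twist_mono (σ : k ≃ₐ[F] k) {S T : Submodule k (Fin 5 → k)} (h : S ≤ T) :
    twist σ S ≤ twist σ T := fun _ hx => h hx

theorem finrank_twist (σ : k ≃ₐ[F] k) (S : Submodule k (Fin 5 → k)) :
    finrank k (twist σ S) = finrank k S := by
  let j : twist σ S ≃+ S :=
    { toFun := fun x => ⟨σ ∘ x.1, x.2⟩
      invFun := fun x => ⟨σ.symm ∘ x.1, by
        rw [mem_twist, ← Function.comp_assoc]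
        convert x.2
        ext; simp⟩
      left_inv := fun x => by ext; simp
      right_inv := fun x => by ext; simp
      map_add' := fun x y => by ext; simp }
  have h := rank_eq_of_equiv_equiv σ j σ.bijective fun r x => by
    ext i
    change σ (r * x.1 i) = σ r * σ (x.1 i)
    rw [map_mul]
  rw [finrank, finrank, h]

/-- Galois descent for subspaces: a nonzero `σ`-stable subspace contains a nonzero `σ`-fixed
vector. -/
theorem exists_fixed_of_stable {n : ℕ} {σ : k ≃ₐ[F] k} {S : Submodule k (Fin n → k)} (hS : S ≠ ⊥)
    (h : ∀ x ∈ S, σ ∘ x ∈ S) : ∃ x ∈ S, x ≠ 0 ∧ ∀ i, σ (x i) = x i := by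
  classical
  obtain ⟨x, hx, hx0⟩ := S.ne_bot_iff.1 hS
  induction hn : (Finset.univ.filter fun i => x i ≠ 0).card using Nat.strong_induction_on
    generalizing x with
  | _ r ih =>
    obtain ⟨j, hj⟩ : ∃ j, x j ≠ 0 := by
      by_contra! hcon
      exact hx0 (funext hcon)
    have hy : (x j)⁻¹ • x ∈ S := S.smul_mem _ hx
    have hyj : ((x j)⁻¹ • x) j = 1 := inv_mul_cancel₀ hj
    by_cases hfix : ∀ i, σ (((x j)⁻¹ • x) i) = ((x j)⁻¹ • x) i
    · exact ⟨_, hy, fun h0 => one_ne_zero (hyj.symm.trans (congrFun h0 j)), hfix⟩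
    · push Not at hfix
      obtain ⟨i, hi⟩ := hfix
      refine ih _ ?_ (σ ∘ ((x j)⁻¹ • x) - (x j)⁻¹ • x) (S.sub_mem (h _ hy) hy)
        (fun h0 => hi (sub_eq_zero.1 (congrFun h0 i))) rfl
      rw [← hn]
      apply Finset.card_lt_card
      rw [Finset.ssubset_iff_of_subset]
      · refine ⟨j, by simpa using hj, ?_⟩
        simp [hj]
      · intro l hl
        simp only [Finset.mem_filter, Finset.mem_univ, true_and] at hl ⊢
        contrapose! hl
        simp [hl]

theorem exists_frobenius (F k : Type*) [Field F] [Fintype F] [Field k] [Algebra F k]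
    [Algebra.IsAlgebraic F k] : ∃ σ : k ≃ₐ[F] k, (∀ x, σ x = x ^ Fintype.card F) ∧
      ∀ x, σ x = x → ∃ y, algebraMap F k y = x := by
  classical
  refine ⟨FiniteField.frobeniusAlgEquivOfAlgebraic F k, fun x => rfl, fun x hx => ?_⟩
  have hx' : x ^ Fintype.card F = x := hx
  by_contra! hcon
  have hq : 1 < Fintype.card F := Fintype.one_lt_card
  let P : Polynomial k := Polynomial.X ^ Fintype.card F - Polynomial.X
  have hP : P ≠ 0 := FiniteField.X_pow_card_sub_X_ne_zero k hq
  have hdeg : P.natDegree = Fintype.card F := FiniteField.X_pow_card_sub_X_natDegree_eq k hq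
  have hsub : insert x (Finset.univ.image (algebraMap F k)) ⊆ P.roots.toFinset := by
    intro z hz
    rw [Multiset.mem_toFinset, Polynomial.mem_roots hP]
    rcases Finset.mem_insert.1 hz with rfl | hz
    · simp [P, hx']
    · obtain ⟨y, -, rfl⟩ := Finset.mem_image.1 hz
      simp [P, ← map_pow, FiniteField.pow_card]
  have h1 := Finset.card_le_card hsub
  rw [Finset.card_insert_of_notMem (by simpa using hcon),
    Finset.card_image_of_injective _ (algebraMap F k).injective, Finset.card_univ] at h1
  have h2 := P.roots.toFinset_card_le
  have h3 := P.card_roots'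
  omega

/-- Descent for irreducible groups: stable subspaces invariant under an automorphism with fixed
field `F` are trivial. -/
theorem eq_top_of_twist_stable {G : Type*} [Group G] {γ : G →* GL (Fin 5) F}
    (hirr : ∀ S : Submodule F (Fin 5 → F), (∀ g, ∀ x ∈ S, rowRep (γ g) x ∈ S) → S = ⊥ ∨ S = ⊤)
    {σ : k ≃ₐ[F] k} (hσ : ∀ x, σ x = x → ∃ y, algebraMap F k y = x)
    {S : Submodule k (Fin 5 → k)} (hS0 : S ≠ ⊥) (hS : ∀ x ∈ S, σ ∘ x ∈ S)
    (hG : ∀ g, ∀ x ∈ S, rowRepMap k (γ g) x ∈ S) : S = ⊤ := by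
  obtain ⟨x, hx, hx0, hfix⟩ := exists_fixed_of_stable hS0 hS
  choose y hy using fun i => hσ _ (hfix i)
  have hyx : rowIncl F k y = x := funext hy
  have h1 := hirr ((S.restrictScalars F).comap (rowIncl F k)) fun g x hx => by
    have := hG g _ hx
    rwa [rowRepMap_rowIncl] at this
  rcases h1 with h1 | h1
  · exfalso
    have h2 : y ∈ (S.restrictScalars F).comap (rowIncl F k) := by
      change rowIncl F k y ∈ S
      rwa [hyx]
    rw [h1, Submodule.mem_bot] at h2
    rw [h2, map_zero] at hyx
    exact hx0 hyx.symm
  · rw [eq_top_iff, ← (Pi.basisFun k (Fin 5)).span_eq, Submodule.span_le]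
    rintro _ ⟨i, rfl⟩
    have h2 : Pi.single i 1 ∈ (S.restrictScalars F).comap (rowIncl F k) := by
      rw [h1]
      trivial
    have h3 : rowIncl F k (Pi.single i 1) ∈ S := h2
    rw [rowIncl_single] at h3
    simpa using h3

end BaseChange

section BaseChange

variable {F k : Type*} [Field F] [Field k] [Algebra F k]

variable (k) in
/-- The base change of a bilinear product. -/
noncomputable def baseBilin (m : (Fin 5 → F) →ₗ[F] (Fin 5 → F) →ₗ[F] (Fin 5 → F)) :
    (Fin 5 → k) →ₗ[k] (Fin 5 → k) →ₗ[k] (Fin 5 → k) :=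
  (Pi.basisFun k (Fin 5)).constr k fun i => (Pi.basisFun k (Fin 5)).constr k fun j =>
    rowIncl F k (m (Pi.single i 1) (Pi.single j 1))

variable {m : (Fin 5 → F) →ₗ[F] (Fin 5 → F) →ₗ[F] (Fin 5 → F)}

theorem rowIncl_smul (c : F) (x : Fin 5 → F) :
    rowIncl F k (c • x) = algebraMap F k c • rowIncl F k x := by
  ext i
  simp [rowIncl_apply]

theorem baseBilin_single (i j : Fin 5) :
    baseBilin k m (Pi.single i 1) (Pi.single j 1) =
      rowIncl F k (m (Pi.single i 1) (Pi.single j 1)) := by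
  rw [← Pi.basisFun_apply, ← Pi.basisFun_apply, baseBilin, Basis.constr_basis,
    Basis.constr_basis]

theorem baseBilin_rowIncl (x y : Fin 5 → F) :
    baseBilin k m (rowIncl F k x) (rowIncl F k y) = rowIncl F k (m x y) := by
  induction (Pi.basisFun F (Fin 5)).mem_span x using Submodule.span_induction with
  | zero => simp
  | add x x' _ _ h h' => simp [h, h']
  | smul c x _ h => rw [rowIncl_smul, map_smul, map_smul, LinearMap.smul_apply, h,
      LinearMap.smul_apply, rowIncl_smul]
  | mem x hx =>
    obtain ⟨i, rfl⟩ := hx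
    induction (Pi.basisFun F (Fin 5)).mem_span y using Submodule.span_induction with
    | zero => simp
    | add x x' _ _ h h' => rw [map_add, map_add, map_add, map_add, h, h']
    | smul c x _ h => rw [rowIncl_smul, map_smul, map_smul, h, rowIncl_smul]
    | mem y hy =>
      obtain ⟨j, rfl⟩ := hy
      rw [Pi.basisFun_apply, Pi.basisFun_apply, rowIncl_single, rowIncl_single, baseBilin_single]

variable {G : Type*} [Group G] {γ : G →* GL (Fin 5) F}

theorem IsIrredAlt.baseBilin_self (H : IsIrredAlt (rowRep.comp γ) m) (x : Fin 5 → k) :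
    baseBilin k m x x = 0 := by
  refine alt_of_basis (Pi.basisFun k (Fin 5)) (fun i => ?_) (fun i j => ?_) x
  · rw [Pi.basisFun_apply, baseBilin_single, H.alt, _root_.map_zero]
  · rw [Pi.basisFun_apply, Pi.basisFun_apply, baseBilin_single, baseBilin_single, H.anticomm,
      _root_.map_neg]

variable (k) in
theorem IsIrredAlt.exists_baseBilin_ne_zero (H : IsIrredAlt (rowRep.comp γ) m) :
    ∃ x y, baseBilin k m x y ≠ 0 := by
  obtain ⟨x, y, hxy⟩ := H.ne_zero
  refine ⟨rowIncl F k x, rowIncl F k y, fun h => hxy (rowIncl_injective (k := k) ?_)⟩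
  rw [← baseBilin_rowIncl, h, _root_.map_zero]

theorem IsIrredAlt.rowRepMap_baseBilin (H : IsIrredAlt (rowRep.comp γ) m) (g : G)
    (x y : Fin 5 → k) : rowRepMap k (γ g) (baseBilin k m x y) =
      baseBilin k m (rowRepMap k (γ g) x) (rowRepMap k (γ g) y) := by
  have h1 : (baseBilin k m).compr₂ (rowRepMap k (γ g) : (Fin 5 → k) →ₗ[k] (Fin 5 → k)) =
      (baseBilin k m).compl₁₂ (rowRepMap k (γ g) : (Fin 5 → k) →ₗ[k] (Fin 5 → k))
        (rowRepMap k (γ g) : (Fin 5 → k) →ₗ[k] (Fin 5 → k)) := by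
    refine (Pi.basisFun k (Fin 5)).ext fun i => (Pi.basisFun k (Fin 5)).ext fun j => ?_
    rw [LinearMap.compr₂_apply, LinearMap.compl₁₂_apply, Pi.basisFun_apply, Pi.basisFun_apply,
      ← rowIncl_single (F := F) i, ← rowIncl_single (F := F) j]
    simp only [LinearEquiv.coe_coe]
    rw [baseBilin_rowIncl, rowRepMap_rowIncl, rowRepMap_rowIncl, rowRepMap_rowIncl,
      baseBilin_rowIncl]
    congr 1
    exact H.map_mul g _ _
  exact LinearMap.congr_fun (LinearMap.congr_fun h1 x) y

theorem IsIrredAlt.baseChange (H : IsIrredAlt (rowRep.comp γ) m)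
    (hirr : ∀ S : Submodule k (Fin 5 → k), (∀ g, ∀ x ∈ S, rowRepMap k (γ g) x ∈ S) →
      S = ⊥ ∨ S = ⊤) : IsIrredAlt ((rowRepMap k).comp γ) (baseBilin k m) where
  finrank_eq := by simp
  alt := H.baseBilin_self
  ne_zero := H.exists_baseBilin_ne_zero k
  map_mul := H.rowRepMap_baseBilin
  irred := hirr

theorem IsIrredAlt.mul_comm_of_isSimpleGroup [Finite F] [Finite G] [IsSimpleGroup G]
    (H : IsIrredAlt (rowRep.comp γ) m) (hγ : Function.Injective γ) : ∀ a b : G, a * b = b * a := by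
  have := Fintype.ofFinite F
  by_contra hG
  let k := AlgebraicClosure F
  obtain ⟨p, hp⟩ := CharP.exists F
  have : Fact p.Prime := ⟨CharP.char_is_prime F p⟩
  have : CharP k p := charP_of_injective_algebraMap (algebraMap F k).injective p
  obtain ⟨σ, -, hσ⟩ := exists_frobenius F k
  have htop : (⊤ : Submodule k (Fin 5 → k)) ≠ ⊥ := top_ne_bot
  obtain ⟨S, -, hS, hS0, hSmin⟩ := exists_minimal_submodule
    (P := fun S : Submodule k (Fin 5 → k) => ∀ g, ∀ x ∈ S, rowRepMap k (γ g) x ∈ S)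
    (S := ⊤) (fun _ _ _ => trivial) htop
  have htw : ∀ (τ : k ≃ₐ[F] k) (T : Submodule k (Fin 5 → k)),
      (∀ g, ∀ x ∈ T, rowRepMap k (γ g) x ∈ T) →
      ∀ g, ∀ x ∈ twist τ T, rowRepMap k (γ g) x ∈ twist τ T := by
    intro τ T hT g x hx
    rw [mem_twist, ← rowRepMap_comp]
    exact hT g _ hx
  have hsup : sSup (Set.range fun τ : k ≃ₐ[F] k => twist τ S) = ⊤ := by
    refine eq_top_of_twist_stable H.irred hσ ?_ ?_ ?_
    · refine fun h => hS0 (eq_bot_iff.2 ?_)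
      rw [← h]
      exact le_sSup ⟨1, rfl⟩
    · have h1 : sSup (Set.range fun τ : k ≃ₐ[F] k => twist τ S) ≤
          twist σ (sSup (Set.range fun τ : k ≃ₐ[F] k => twist τ S)) := by
        refine sSup_le ?_
        rintro _ ⟨τ, rfl⟩
        have h2 : twist τ S = twist σ (twist (τ * σ⁻¹) S) := by
          rw [← twist_mul, inv_mul_cancel_right]
        simp only
        rw [h2]
        exact twist_mono σ (le_sSup ⟨τ * σ⁻¹, rfl⟩)
      exact fun x hx => h1 hx
    · intro g
      have h1 : sSup (Set.range fun τ : k ≃ₐ[F] k => twist τ S) ≤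
          (sSup (Set.range fun τ : k ≃ₐ[F] k => twist τ S)).comap
            (rowRepMap k (γ g) : (Fin 5 → k) →ₗ[k] (Fin 5 → k)) := by
        refine sSup_le ?_
        rintro _ ⟨τ, rfl⟩ x hx
        have h2 : twist τ S ≤ sSup (Set.range fun τ : k ≃ₐ[F] k => twist τ S) := le_sSup ⟨τ, rfl⟩
        exact h2 (htw τ S hS g x hx)
      exact fun x hx => h1 hx
  have hd : finrank k S ∣ finrank k (Fin 5 → k) := by
    refine dvd_finrank_of_sSup_eq_top
      (P := fun S : Submodule k (Fin 5 → k) => ∀ g, ∀ x ∈ S, rowRepMap k (γ g) x ∈ S)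
      ?_ ?_ ?_ ?_ ?_ ?_ ?_ hsup
    · intro g x hx
      rw [Submodule.mem_bot] at hx ⊢
      rw [hx, _root_.map_zero]
    · exact fun A B hA hB g x hx => ⟨hA g x hx.1, hB g x hx.2⟩
    · intro A B hA hB g x hx
      obtain ⟨y, hy, z, hz, rfl⟩ := Submodule.mem_sup.1 hx
      rw [_root_.map_add]
      exact Submodule.add_mem_sup (hA g y hy) (hB g z hz)
    · exact Nat.pos_of_ne_zero fun h => hS0 (Submodule.finrank_eq_zero.1 h)
    · rintro _ ⟨τ, rfl⟩
      exact finrank_twist τ S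
    · rintro _ ⟨τ, rfl⟩
      exact htw τ S hS
    · rintro _ ⟨τ, rfl⟩ T hT hle
      have h2 : T = twist τ (twist τ⁻¹ T) := by
        rw [← twist_mul, inv_mul_cancel, twist_one]
      have h3 : twist τ⁻¹ T ≤ S := by
        refine (twist_mono τ⁻¹ hle).trans (le_of_eq ?_)
        rw [← twist_mul, mul_inv_cancel, twist_one]
      rcases hSmin _ (htw τ⁻¹ T hT) h3 with h4 | h4
      · left
        rw [h2, h4, eq_bot_iff]
        intro x hx
        rw [mem_twist, Submodule.mem_bot] at hx
        refine (Submodule.mem_bot k).2 (funext fun i => τ.injective ?_)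
        rw [Pi.zero_apply, _root_.map_zero]
        exact congrFun hx i
      · right
        rw [h2, h4]
  rw [Module.finrank_fin_fun, Nat.dvd_prime (by norm_num)] at hd
  rcases hd with hd | hd
  · obtain ⟨⟨w, hw⟩, hw0, hwS⟩ := finrank_eq_one_iff'.1 hd
    have hex : ∀ g, ∃ c : k, rowRepMap k (γ g) w = c • w := fun g => by
      obtain ⟨c, hc⟩ := hwS ⟨_, hS g w hw⟩
      exact ⟨c, (congrArg Subtype.val hc).symm⟩
    have hw0' : w ≠ 0 := fun h => hw0 (Subtype.ext h)
    choose χ hχ using hex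
    let f : G →* k :=
      { toFun := χ
        map_one' := by
          refine smul_left_injective k hw0' ?_
          simp only
          rw [← hχ, _root_.map_one, _root_.map_one, LinearEquiv.coe_one, id_eq, one_smul]
        map_mul' := fun a c => by
          refine smul_left_injective k hw0' ?_
          simp only
          rw [← hχ, _root_.map_mul, _root_.map_mul, LinearEquiv.mul_apply, hχ, _root_.map_smul, hχ,
            smul_smul, mul_comm] }
    have hone : ∀ g, rowRepMap k (γ g) w = w := by
      intro g
      have h1 := congrArg Units.val (MonoidHom.eq_one_of_isSimpleGroup hG f.toHomUnits g)
      have h2 : χ g = 1 := h1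
      rw [hχ, h2, one_smul]
    let T : Submodule k (Fin 5 → k) :=
      { carrier := {x | ∀ g, rowRepMap k (γ g) x = x}
        add_mem' := fun {x y} hx hy g => by rw [_root_.map_add, hx, hy]
        zero_mem' := fun g => _root_.map_zero _
        smul_mem' := fun c x hx g => by rw [_root_.map_smul, hx] }
    have hT : T = ⊤ := by
      refine eq_top_of_twist_stable H.irred hσ ?_ ?_ ?_
      · exact fun h => hw0' ((Submodule.mem_bot k).1 (h ▸ (show w ∈ T from hone)))
      · intro x hx g
        rw [rowRepMap_comp, hx]
      · intro g x hx
        rw [hx g]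
        exact hx
    refine hG fun a b => ?_
    have h1 : ∀ g : G, g = 1 := fun g => by
      refine hγ (rowRepMap_injective (k := k) (LinearEquiv.ext fun x => ?_))
      have h2 : x ∈ T := hT ▸ Submodule.mem_top
      rw [h2 g, _root_.map_one, _root_.map_one, LinearEquiv.coe_one, id_eq]
    rw [h1 a, h1 b]
  · have hStop : S = ⊤ := Submodule.eq_top_of_finrank_eq (by rw [hd, Module.finrank_fin_fun])
    refine (H.baseChange (k := k) fun T hT => ?_).false_of_isSimpleGroup (p := p) hG
      ((rowRepMap_injective (k := k)).comp hγ)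
    exact hStop ▸ hSmin T hT (hStop ▸ le_top)

end BaseChange

section BaseChange

variable {F k : Type*} [Field F] [Field k] [Algebra F k]

theorem exists_minimal_period {σ : k ≃ₐ[F] k} {c : k} {n : ℕ} (hn : 0 < n) (hc : c ^ n = 1) :
    ∃ d, 0 < d ∧ (σ ^ d) c = c ∧ ∀ i < d, ∀ j < d, (σ ^ i) c = (σ ^ j) c → i = j := by
  classical
  have hfin : {z : k | z ^ n = 1}.Finite := by
    refine (Polynomial.nthRoots n (1 : k)).toFinset.finite_toSet.subset fun z hz => ?_
    rw [Finset.mem_coe, Multiset.mem_toFinset, Polynomial.mem_nthRoots hn]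
    exact hz
  have hsub : ∀ i j, i ≤ j → (σ ^ i) c = (σ ^ j) c → (σ ^ (j - i)) c = c := by
    intro i j hij h
    apply (σ ^ i).injective
    rw [h, ← AlgEquiv.mul_apply, ← pow_add, Nat.add_sub_cancel' hij]
  have hex : ∃ d, 0 < d ∧ (σ ^ d) c = c := by
    obtain ⟨i, j, hij, h⟩ := hfin.exists_lt_map_eq_of_forall_mem (f := fun i : ℕ => (σ ^ i) c)
      fun i => by
        change (σ ^ i) c ^ n = 1
        rw [← map_pow, hc, map_one]
    exact ⟨j - i, by omega, hsub i j hij.le h⟩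
  refine ⟨Nat.find hex, (Nat.find_spec hex).1, (Nat.find_spec hex).2, ?_⟩
  have key : ∀ i j, i < j → j < Nat.find hex → (σ ^ i) c ≠ (σ ^ j) c := fun i j hij hj h =>
    Nat.find_min hex (by omega : j - i < _) ⟨by omega, hsub i j hij.le h⟩
  intro i hi j hj h
  rcases lt_trichotomy i j with h1 | h1 | h1
  · exact (key i j h1 hj h).elim
  · exact h1
  · exact (key j i h1 hi h.symm).elim

/-- A generator of an irreducible cyclic group of degree five has, over the algebraic closure, an
eigenbasis that is permuted cyclically by the Galois group. -/
theorem exists_eigenbasis_of_cyclic [IsAlgClosed k] {G : Type*} [Group G] [Finite G]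
    {γ : G →* GL (Fin 5) F}
    (hirr : ∀ S : Submodule F (Fin 5 → F), (∀ g, ∀ x ∈ S, rowRep (γ g) x ∈ S) → S = ⊥ ∨ S = ⊤)
    {σ : k ≃ₐ[F] k} (hσ : ∀ x, σ x = x → ∃ y, algebraMap F k y = x)
    {g : G} (hg : ∀ x, x ∈ Subgroup.zpowers g) :
    ∃ (b : Basis (Fin 5) k (Fin 5 → k)) (x : Fin 5 → k), Function.Injective x ∧
      (∀ i, rowRepMap k (γ g) (b i) = x i • b i) ∧ (∀ i, x (i + 1) = σ (x i)) ∧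
      ∀ i, x i ^ Nat.card G = 1 := by
  let f : End k (Fin 5 → k) := (rowRepMap k (γ g)).toLinearMap
  obtain ⟨c, hc⟩ := Module.End.exists_eigenvalue f
  have hpow : ∀ (n : ℕ) (z : k) (x : Fin 5 → k), rowRepMap k (γ g) x = z • x →
      rowRepMap k (γ (g ^ n)) x = z ^ n • x := by
    intro n z x hx
    induction n with
    | zero => simp
    | succ n ih => rw [pow_succ', map_mul, map_mul, LinearEquiv.mul_apply, ih, map_smul, hx,
        smul_smul, pow_succ]
  have hroot : ∀ (z : k) (x : Fin 5 → k), x ≠ 0 → rowRepMap k (γ g) x = z • x →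
      z ^ Nat.card G = 1 := by
    intro z x hx0 hx
    have h1 := hpow (Nat.card G) z x hx
    rw [pow_card_eq_one', map_one, map_one, LinearEquiv.coe_one, id_eq] at h1
    have h2 : (z ^ Nat.card G - 1) • x = 0 := by rw [sub_smul, ← h1, one_smul, sub_self]
    exact sub_eq_zero.1 ((smul_eq_zero.1 h2).resolve_right hx0)
  obtain ⟨w, hw⟩ := hc.exists_hasEigenvector
  have hc1 := hroot c w hw.2 hw.apply_eq_smul
  obtain ⟨d, hd0, hdc, hdinj⟩ := exists_minimal_period (σ := σ) Nat.card_pos hc1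
  have htw : ∀ (τ : k ≃ₐ[F] k) (z : k) (x : Fin 5 → k), rowRepMap k (γ g) x = z • x →
      rowRepMap k (γ g) (τ ∘ x) = τ z • τ ∘ x := by
    intro τ z x hx
    rw [rowRepMap_comp, hx]
    ext i
    simp
  obtain ⟨v, hv, hv0, hvfix⟩ := exists_fixed_of_stable (σ := σ ^ d) hc (S := End.eigenspace f c)
    fun x hx => by
      rw [End.mem_eigenspace_iff] at hx ⊢
      have := htw (σ ^ d) c x hx
      rwa [hdc] at this
  rw [End.mem_eigenspace_iff] at hv
  have hve : ∀ i : ℕ, rowRepMap k (γ g) ((σ ^ i : k ≃ₐ[F] k) ∘ v) =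
      (σ ^ i) c • (σ ^ i : k ≃ₐ[F] k) ∘ v :=
    fun i => htw _ _ _ hv
  have hne : ∀ i : ℕ, (σ ^ i : k ≃ₐ[F] k) ∘ v ≠ 0 := by
    intro i h
    apply hv0
    ext j
    exact (σ ^ i).injective ((congrFun h j).trans (map_zero _).symm)
  have hmod : ∀ i : ℕ, (σ ^ i : k ≃ₐ[F] k) ∘ v = (σ ^ (i % d) : k ≃ₐ[F] k) ∘ v := by
    have h1 : ∀ r, ∀ j, ((σ ^ d) ^ r) (v j) = v j := by
      intro r j
      induction r with
      | zero => rfl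
      | succ r ih => rw [pow_succ, AlgEquiv.mul_apply, hvfix, ih]
    intro i
    ext j
    conv_lhs => rw [← Nat.mod_add_div i d]
    simp only [Function.comp_apply]
    rw [pow_add, pow_mul, AlgEquiv.mul_apply, h1]
  let u : Fin d → Fin 5 → k := fun i => (σ ^ (i : ℕ) : k ≃ₐ[F] k) ∘ v
  have hmem : ∀ i : ℕ, (σ ^ i : k ≃ₐ[F] k) ∘ v ∈ Submodule.span k (Set.range u) := fun i =>
    Submodule.subset_span ⟨⟨i % d, Nat.mod_lt _ hd0⟩, (hmod i).symm⟩
  have htop : Submodule.span k (Set.range u) = ⊤ := by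
    refine eq_top_of_twist_stable (γ := γ) hirr hσ ?_ ?_ ?_
    · intro h
      have := hmem 0
      rw [h, Submodule.mem_bot] at this
      exact hne 0 this
    · have h1 : Submodule.span k (Set.range u) ≤ twist σ (Submodule.span k (Set.range u)) := by
        rw [Submodule.span_le]
        rintro _ ⟨i, rfl⟩
        rw [SetLike.mem_coe, mem_twist]
        have := hmem (i + 1)
        rwa [pow_succ'] at this
      exact fun x hx => h1 hx
    · intro g' x hx
      obtain ⟨n, rfl⟩ : g' ∈ Submonoid.powers g := mem_powers_iff_mem_zpowers.2 (hg g')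
      have h1 : Submodule.span k (Set.range u) ≤ (Submodule.span k (Set.range u)).comap
          (rowRepMap k (γ (g ^ n)) : (Fin 5 → k) →ₗ[k] (Fin 5 → k)) := by
        rw [Submodule.span_le]
        rintro _ ⟨i, rfl⟩
        change rowRepMap k (γ (g ^ n)) (u i) ∈ Submodule.span k (Set.range u)
        rw [hpow n _ _ (hve i)]
        exact Submodule.smul_mem _ _ (hmem i)
      exact h1 hx
  have hli : LinearIndependent k u :=
    Module.End.eigenvectors_linearIndependent' f (fun i : Fin d => (σ ^ (i : ℕ)) c)
      (fun i j h => Fin.ext (hdinj i i.2 j j.2 h)) u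
      fun i => ⟨End.mem_eigenspace_iff.2 (hve i), hne i⟩
  have hd : d = 5 := by
    have h1 := finrank_range_le_card (R := k) u
    have h2 := hli.fintype_card_le_finrank
    rw [Set.finrank, htop, finrank_top] at h1
    simp only [Fintype.card_fin, finrank_fintype_fun_eq_card] at h1 h2
    omega
  subst hd
  refine ⟨basisOfLinearIndependentOfCardEqFinrank hli (by simp),
    fun i : Fin 5 => (σ ^ (i : ℕ)) c, fun i j h => Fin.ext (hdinj i i.2 j j.2 h), ?_, ?_, ?_⟩
  · intro i
    rw [coe_basisOfLinearIndependentOfCardEqFinrank]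
    exact hve i
  · intro i
    rw [← AlgEquiv.mul_apply, ← pow_succ']
    by_cases hi : i = 4
    · subst hi
      exact hdc.symm
    · have : ((i + 1 : Fin 5) : ℕ) = i + 1 := by
        clear * - hi
        revert i
        decide
      simp only [this]
  · intro i
    exact hroot _ _ (hne i) (hve i)

/-- An irreducible cyclic group of degree five preserving an alternating product has order eleven,
is not absolutely irreducible, and `|F|` has order five modulo eleven. -/
theorem IsIrredAlt.card_eq_of_cyclic [Fintype F] [IsAlgClosed k] [Algebra.IsAlgebraic F k]
    {G : Type*} [Group G] [Finite G] {γ : G →* GL (Fin 5) F}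
    {m : (Fin 5 → F) →ₗ[F] (Fin 5 → F) →ₗ[F] (Fin 5 → F)}
    (H : IsIrredAlt (rowRep.comp γ) m) (hγ : Function.Injective γ)
    {g : G} (hg : ∀ x, x ∈ Subgroup.zpowers g) :
    Nat.card G = 11 ∧ orderOf (Fintype.card F : ZMod 11) = 5 ∧
      ∃ S : Submodule k (Fin 5 → k), S ≠ ⊥ ∧ S ≠ ⊤ ∧ ∀ g, ∀ x ∈ S, rowRepMap k (γ g) x ∈ S := by
  obtain ⟨σ, hσq, hσ⟩ := exists_frobenius F k
  obtain ⟨b, x, hinj, hb, hx, hxG⟩ := exists_eigenbasis_of_cyclic (γ := γ) H.irred hσ hg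
  obtain ⟨i, j, l, hij, h⟩ := exists_mul_eq_of_eigenbasis b (m := baseBilin k m)
    H.baseBilin_self (H.exists_baseBilin_ne_zero k)
  have hrel := h (rowRepMap k (γ g) : (Fin 5 → k) →ₗ[k] (Fin 5 → k)) x
    (H.rowRepMap_baseBilin g) hb
  have hx0 : ∀ t, x t ≠ 0 := by
    intro t ht
    have := hxG t
    rw [ht, zero_pow Nat.card_pos.ne'] at this
    exact zero_ne_one this
  have hshift : ∀ n : ℕ, x (i + n • 1) * x (j + n • 1) = x (l + n • 1) := by
    intro n
    induction n with
    | zero => simpa using hrel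
    | succ n ih =>
      have := congrArg σ ih
      rwa [_root_.map_mul, ← hx, ← hx, ← hx, add_assoc, add_assoc, add_assoc, ← succ_nsmul] at this
  have hsm : ∀ t : Fin 5, (t : ℕ) • (1 : Fin 5) = t := by decide
  obtain ⟨h11, hone⟩ := pow_eleven_of_cyclic_relation (x := x) hx0 (i := i - l) (j := j - l)
    (fun hh => hij (sub_left_injective hh)) fun t => by
      have := hshift (t - l : Fin 5)
      rw [hsm] at this
      have e1 : i + (t - l) = i - l + t := by abel
      have e2 : j + (t - l) = j - l + t := by abel
      have e3 : l + (t - l) = t := by abel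
      rwa [e1, e2, e3] at this
  have hx1 : ∀ t, x t ≠ 1 := by
    intro t ht
    have h0 := hone t ht
    exact absurd (hinj ((h0 0).trans (h0 1).symm)) (by decide)
  have hpow : ∀ (n : ℕ) (t : Fin 5), rowRepMap k (γ (g ^ n)) (b t) = x t ^ n • b t := by
    intro n t
    induction n with
    | zero => simp
    | succ n ih => rw [pow_succ', _root_.map_mul, _root_.map_mul, LinearEquiv.mul_apply, ih,
        _root_.map_smul, hb, smul_smul, pow_succ]
  have : Fact (Nat.Prime 11) := ⟨by norm_num⟩
  have : Fact (Nat.Prime 5) := ⟨by norm_num⟩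
  have hg11 : g ^ 11 = 1 := by
    apply hγ
    apply rowRepMap_injective (k := k)
    refine LinearEquiv.toLinearMap_injective (b.ext fun t => ?_)
    change rowRepMap k (γ (g ^ 11)) (b t) = rowRepMap k (γ 1) (b t)
    rw [hpow, h11]
    simp
  have hg1 : g ≠ 1 := by
    rintro rfl
    apply hx1 0
    have h1 := hb 0
    rw [_root_.map_one, _root_.map_one, LinearEquiv.coe_one, id_eq] at h1
    have h2 : (x 0 - 1) • b 0 = 0 := by rw [sub_smul, ← h1, one_smul, sub_self]
    exact sub_eq_zero.1 ((smul_eq_zero.1 h2).resolve_right (b.ne_zero 0))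
  have hord : orderOf (x 0) = 11 := orderOf_eq_prime (h11 0) (hx1 0)
  have hmod : ∀ r s : ℕ, x 0 ^ r = x 0 ^ s ↔ r % 11 = s % 11 := by
    intro r s
    have h1 : orderOf (Units.mk0 (x 0) (hx0 0)) = 11 := by rw [← orderOf_units, Units.val_mk0, hord]
    rw [← h1, ← pow_inj_mod, Units.ext_iff, Units.val_pow_eq_pow_val, Units.val_pow_eq_pow_val,
      Units.val_mk0]
  have hq : ∀ n : ℕ, x (n • 1) = x 0 ^ (Fintype.card F ^ n) := by
    intro n
    induction n with
    | zero => simp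
    | succ n ih => rw [succ_nsmul, hx, ih, hσq, ← pow_mul, pow_succ]
  refine ⟨?_, orderOf_eq_prime ?_ ?_, Submodule.span k {b 0}, ?_, ?_, ?_⟩
  · rw [← orderOf_eq_prime hg11 hg1, Nat.card_zpowers g |>.symm]
    exact (Nat.card_congr (Equiv.subtypeUnivEquiv hg)).symm
  · have h1 : x 0 ^ (Fintype.card F ^ 5) = x 0 ^ 1 := by
      rw [← hq 5, pow_one]
      rfl
    rw [hmod] at h1
    have h2 := (ZMod.natCast_eq_natCast_iff' _ _ 11).2 h1
    rw [Nat.cast_pow, Nat.cast_one] at h2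
    exact h2
  · intro h1
    have h2 : Fintype.card F % 11 = 1 % 11 :=
      (ZMod.natCast_eq_natCast_iff' _ _ 11).1 (by rw [h1, Nat.cast_one])
    have h3 := hq 1
    rw [pow_one] at h3
    rw [← hmod, pow_one, ← h3] at h2
    exact absurd (hinj h2) (by decide)
  · rw [Ne, Submodule.span_singleton_eq_bot]
    exact b.ne_zero 0
  · intro h1
    have h2 := finrank_span_singleton (K := k) (b.ne_zero 0)
    rw [h1, finrank_top] at h2
    simp at h2
  · intro g' y hy
    obtain ⟨n, rfl⟩ : g' ∈ Submonoid.powers g := mem_powers_iff_mem_zpowers.2 (hg g')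
    obtain ⟨c, rfl⟩ := Submodule.mem_span_singleton.1 hy
    change rowRepMap k (γ (g ^ n)) _ ∈ _
    rw [_root_.map_smul, hpow]
    exact Submodule.smul_mem _ _ (Submodule.smul_mem _ _ (Submodule.mem_span_singleton_self _))

end BaseChange

section Translation

variable {F : Type*} [Field F]

theorem natAct_eq_rowRep (g : GL (Fin 5) F) (x : Fin 5 → F) : natAct g x = rowRep g⁻¹ x := by
  rw [rowRep_apply, inv_inv]
  rfl

theorem isIrred_iff {G : Subgroup (GL (Fin 5) F)} : IsIrred G ↔
    ∀ S : Submodule F (Fin 5 → F), (∀ g ∈ G, ∀ x ∈ S, rowRep g x ∈ S) → S = ⊥ ∨ S = ⊤ := by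
  refine forall_congr' fun S => ⟨fun h hS => h fun g hg => le_antisymm ?_ ?_,
    fun h hS => h fun g hg x hx => ?_⟩
  · rintro _ ⟨x, hx, rfl⟩
    rw [natAct_eq_rowRep]
    exact hS _ (inv_mem hg) x hx
  · intro x hx
    refine ⟨rowRep g x, hS g hg x hx, ?_⟩
    rw [natAct_eq_rowRep, ← LinearEquiv.mul_apply, ← map_mul, inv_mul_cancel, map_one,
      LinearEquiv.coe_one, id_eq]
  · rw [← hS g⁻¹ (inv_mem hg)]
    exact ⟨x, hx, by rw [natAct_eq_rowRep, inv_inv]⟩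

theorem isAbsIrred_iff {G : Subgroup (GL (Fin 5) F)} : IsAbsIrred G ↔
    ∀ S : Submodule (AlgebraicClosure F) (Fin 5 → AlgebraicClosure F),
      (∀ g ∈ G, ∀ x ∈ S, rowRepMap (AlgebraicClosure F) g x ∈ S) → S = ⊥ ∨ S = ⊤ := by
  have hact : ∀ (g : GL (Fin 5) F) (x : Fin 5 → AlgebraicClosure F),
      Matrix.vecMulLinear ((g : Matrix (Fin 5) (Fin 5) F).map
        (algebraMap F (AlgebraicClosure F))) x = rowRepMap (AlgebraicClosure F) g⁻¹ x := by
    intro g x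
    rw [rowRepMap_apply, inv_inv]
    rfl
  refine forall_congr' fun S => ⟨fun h hS => h fun g hg => le_antisymm ?_ ?_,
    fun h hS => h fun g hg x hx => ?_⟩
  · rintro _ ⟨x, hx, rfl⟩
    rw [hact]
    exact hS _ (inv_mem hg) x hx
  · intro x hx
    refine ⟨rowRepMap _ g x, hS g hg x hx, ?_⟩
    rw [hact, ← LinearEquiv.mul_apply, ← map_mul, inv_mul_cancel, map_one,
      LinearEquiv.coe_one, id_eq]
  · rw [← hS g⁻¹ (inv_mem hg)]
    exact ⟨x, hx, by rw [hact, inv_inv]⟩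

/-- An irreducible group with an ESQ natural module preserves a nonzero alternating product. -/
theorem IsESQ.exists_isIrredAlt {G : Subgroup (GL (Fin 5) F)} (h : IsESQ G) (hirr : IsIrred G) :
    ∃ m : (Fin 5 → F) →ₗ[F] (Fin 5 → F) →ₗ[F] (Fin 5 → F),
      IsIrredAlt (rowRep.comp G.subtype) m := by
  obtain ⟨U, e, -, he⟩ := h
  let p : (Fin 5 → F) ⊗[F] (Fin 5 → F) →ₗ[F] (Fin 5 → F) :=
    e.toLinearMap ∘ₗ U.mkQ ∘ₗ (sqSub F (Fin 5 → F)).mkQ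
  have hp : Function.Surjective p :=
    e.surjective.comp ((Submodule.mkQ_surjective _).comp (Submodule.mkQ_surjective _))
  refine ⟨(TensorProduct.mk F _ _).compr₂ p, ?_, ?_, ?_, ?_, ?_⟩
  · simp
  · intro x
    have h1 : (sqSub F (Fin 5 → F)).mkQ (x ⊗ₜ x) = 0 :=
      (Submodule.Quotient.mk_eq_zero _).2 (Submodule.subset_span ⟨x, rfl⟩)
    rw [LinearMap.compr₂_apply, TensorProduct.mk_apply, LinearMap.comp_apply,
      LinearMap.comp_apply, h1, map_zero, map_zero]
  · by_contra! hcon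
    have h1 : p = 0 := TensorProduct.ext' fun x y => hcon x y
    obtain ⟨z, hz⟩ := hp (Pi.single 0 1)
    rw [h1] at hz
    simpa using congrFun hz 0
  · intro g x y
    have h1 := he (g⁻¹ : G) (g⁻¹ : G).2 ((sqSub F (Fin 5 → F)).mkQ (x ⊗ₜ y))
    have h2 : ∀ z, natAct ((g⁻¹ : G) : GL (Fin 5) F) z = rowRep g.1 z := by
      intro z
      rw [natAct_eq_rowRep, Subgroup.coe_inv, inv_inv]
    rw [h2] at h1
    refine h1.symm.trans ?_
    change p (TensorProduct.map _ _ (x ⊗ₜ y)) = _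
    rw [TensorProduct.map_tmul, h2, h2]
    rfl
  · intro S hS
    exact isIrred_iff.1 hirr S fun g hg x hx => hS ⟨g, hg⟩ x hx

theorem IsMinIrredESQ.eq_top {G : Subgroup (GL (Fin 5) F)} (h : IsMinIrredESQ G)
    {K : Subgroup G} (hK : ∀ S : Submodule F (Fin 5 → F),
      (∀ g ∈ K, ∀ x ∈ S, rowRep.comp G.subtype g x ∈ S) → S = ⊥ ∨ S = ⊤) : K = ⊤ := by
  by_contra hne
  refine h.2.2 (K.map G.subtype) (lt_of_le_of_ne (Subgroup.map_subtype_le K) fun heq => hne ?_)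
    (isIrred_iff.2 fun S hS => hK S fun g hg x hx =>
      hS _ (Subgroup.mem_map_of_mem G.subtype hg) x hx)
  rw [eq_top_iff]
  intro g _
  have h1 : g.1 ∈ K.map G.subtype := heq.ge g.2
  obtain ⟨g', hg', hgg⟩ := h1
  rwa [← Subtype.ext hgg]

theorem IsIrred.nontrivial {G : Subgroup (GL (Fin 5) F)} (h : IsIrred G) : Nontrivial G := by
  by_contra hG
  rw [not_nontrivial_iff_subsingleton] at hG
  have h0 : (Pi.single 0 1 : Fin 5 → F) ≠ 0 := by simp
  have h1 := isIrred_iff.1 h (Submodule.span F {Pi.single 0 1}) fun g hg x hx => by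
    have : g = 1 := congrArg Subtype.val (Subsingleton.elim (⟨g, hg⟩ : G) 1)
    rwa [this, map_one]
  rcases h1 with h1 | h1
  · exact h0 (Submodule.span_singleton_eq_bot.1 h1)
  · have h2 := finrank_span_singleton (K := F) h0
    rw [h1, finrank_top] at h2
    simp at h2

theorem card_mod_eleven_eq_one [Fintype F] {z : F} (h : z ^ 11 = 1) (hz : z ≠ 1) :
    Fintype.card F % 11 = 1 := by
  have : Fact (Nat.Prime 11) := ⟨by norm_num⟩
  have hz0 : z ≠ 0 := by
    rintro rfl
    simp at h
  have h1 : orderOf z = 11 := orderOf_eq_prime h hz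
  have h2 : 11 ∣ Fintype.card F - 1 := by
    rw [← h1]
    exact orderOf_dvd_of_pow_eq_one (FiniteField.pow_card_sub_one_eq_one z hz0)
  have h3 : 1 < Fintype.card F := Fintype.one_lt_card
  omega

theorem exists_basis_rowIncl (k : Type*) [Field k] [Algebra F k]
    (b : Basis (Fin 5) F (Fin 5 → F)) :
    ∃ b' : Basis (Fin 5) k (Fin 5 → k), ∀ i, b' i = rowIncl F k (b i) := by
  suffices hspan : ⊤ ≤ Submodule.span k (Set.range fun i => rowIncl F k (b i)) from
    ⟨basisOfTopLeSpanOfCardEqFinrank _ hspan (by simp), fun i => by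
      rw [coe_basisOfTopLeSpanOfCardEqFinrank]⟩
  rw [← (Pi.basisFun k (Fin 5)).span_eq, Submodule.span_le]
  rintro _ ⟨i, rfl⟩
  rw [SetLike.mem_coe, Pi.basisFun_apply, ← rowIncl_single (F := F)]
  generalize (Pi.single i 1 : Fin 5 → F) = y
  induction b.mem_span y using Submodule.span_induction with
  | zero => rw [map_zero]; exact Submodule.zero_mem _
  | add x y _ _ hx hy => rw [map_add]; exact Submodule.add_mem _ hx hy
  | smul c x _ hx => rw [rowIncl_smul]; exact Submodule.smul_mem _ _ hx
  | mem x hx =>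
    obtain ⟨j, rfl⟩ := hx
    exact Submodule.subset_span ⟨j, rfl⟩

/-- The classification of minimal irreducible ESQ-groups of degree five. -/
theorem IsMinIrredESQ.classification [Fintype F] {G : Subgroup (GL (Fin 5) F)}
    (hG : IsMinIrredESQ G) :
    (¬ IsAbsIrred G ∧ IsCyclic G ∧ Nat.card G = 11 ∧
        orderOf ((Fintype.card F : ZMod 11)) = 5) ∨
      (IsAbsIrred G ∧ Nat.card G = 55 ∧ (¬ ∀ a b : G, a * b = b * a) ∧
        Fintype.card F % 11 = 1) := by
  have : Finite (GL (Fin 5) F) := inferInstance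
  have : Nontrivial G := hG.1.nontrivial
  obtain ⟨m, H⟩ := hG.2.1.exists_isIrredAlt hG.1
  have hγ : Function.Injective G.subtype := G.subtype_injective
  by_cases hN : ∃ N : Subgroup G, N.Normal ∧ N ≠ ⊥ ∧ N ≠ ⊤
  · right
    obtain ⟨N, hN, hN0, hN1⟩ := hN
    obtain ⟨hcard, ⟨z, hz, hz1⟩, b, χ, h, τ, hχ, hinj, hτ, hh⟩ :=
      H.card_eq_of_not_isSimpleGroup (rowRep_injective.comp hγ) (fun K hK => hG.eq_top hK) hN0 hN1
    have hsep : ∀ i j, i ≠ j → ∃ n : N, χ i n ≠ χ j n := by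
      intro i j hij
      by_contra! hcon
      exact hij (hinj (funext hcon))
    refine ⟨isAbsIrred_iff.2 fun S hS => ?_, hcard, fun hab => ?_, card_mod_eleven_eq_one hz hz1⟩
    · obtain ⟨b', hb'⟩ := exists_basis_rowIncl (AlgebraicClosure F) b
      refine eq_bot_or_eq_top_of_diag_of_shift (b := b')
        (f := fun n : N => (rowRepMap (AlgebraicClosure F) (n : G).1).toLinearMap)
        (chi := fun n i => algebraMap F _ (χ i n)) (fun n i => ?_) (fun i j hij => ?_)
        (T := (rowRepMap (AlgebraicClosure F) (h : GL (Fin 5) F)).toLinearMap)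
        (τ := fun i => algebraMap F _ (τ i)) (fun i => ?_) (fun i => ?_)
        (fun n => hS _ (n : G).2) (hS _ h.2)
      · rw [hb', LinearEquiv.coe_coe, rowRepMap_rowIncl, ← rowIncl_smul, ← hχ n i]
        rfl
      · obtain ⟨n, hn⟩ := hsep i j hij
        exact ⟨n, fun hcon => hn ((algebraMap F _).injective hcon)⟩
      · exact (_root_.map_ne_zero _).2 (hτ i)
      · rw [hb', hb', LinearEquiv.coe_coe, rowRepMap_rowIncl, ← rowIncl_smul, ← hh i]
        rfl
    · obtain ⟨n, hn⟩ := hsep 0 1 (by decide)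
      apply hn
      have h1 : rowRep (h : GL (Fin 5) F) (rowRep (n : G).1 (b 0)) =
          rowRep (n : G).1 (rowRep (h : GL (Fin 5) F) (b 0)) := by
        rw [← LinearEquiv.mul_apply, ← LinearEquiv.mul_apply, ← map_mul, ← map_mul]
        exact congrArg (fun g : G => rowRep g.1 (b 0)) (hab h n)
      have e1 := hχ n 0
      have e2 := hχ n 1
      have e3 := hh 0
      simp only [MonoidHom.comp_apply, Subgroup.subtype_apply] at e1 e2 e3
      rw [e1, map_smul, e3, map_smul, zero_add, e2, smul_comm] at h1
      exact smul_left_injective _ (b.ne_zero 1) (smul_right_injective _ (hτ 0) h1)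
  · left
    have hsimple : IsSimpleGroup G := ⟨fun N hN' => by
      by_contra! hcon
      exact hN ⟨N, hN', hcon⟩⟩
    have hcomm := H.mul_comm_of_isSimpleGroup hγ
    obtain ⟨g, hg1⟩ := exists_ne (1 : G)
    have hz : Subgroup.zpowers g = ⊤ := by
      have : (Subgroup.zpowers g).Normal := ⟨fun n hn x => by
        rwa [hcomm x n, mul_inv_cancel_right]⟩
      refine (this.eq_bot_or_eq_top).resolve_left ?_
      rwa [Subgroup.zpowers_eq_bot]
    have hg : ∀ x, x ∈ Subgroup.zpowers g := fun x => hz ▸ Subgroup.mem_top x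
    obtain ⟨hcard, hord, S, hS0, hS1, hS⟩ :=
      H.card_eq_of_cyclic (k := AlgebraicClosure F) hγ hg
    refine ⟨fun habs => ?_, ⟨g, hg⟩, hcard, hord⟩
    rcases isAbsIrred_iff.1 habs S fun g hg => hS ⟨g, hg⟩ with h | h
    exacts [hS0 h, hS1 h]

end Translation

section Existence

variable {F : Type*} [Field F]

/-- The natural module is ESQ as soon as the group is irreducible and preserves a nonzero
alternating product. -/
theorem IsIrred.isESQ {G : Subgroup (GL (Fin 5) F)} (hirr : IsIrred G)
    {m : (Fin 5 → F) →ₗ[F] (Fin 5 → F) →ₗ[F] (Fin 5 → F)} (halt : ∀ x, m x x = 0)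
    (hne : ∃ x y, m x y ≠ 0)
    (hm : ∀ g ∈ G, ∀ x y, m (natAct g x) (natAct g y) = natAct g (m x y)) : IsESQ G := by
  let p : Wedge2 F (Fin 5 → F) →ₗ[F] (Fin 5 → F) :=
    (sqSub F (Fin 5 → F)).liftQ (TensorProduct.lift m) (Submodule.span_le.2 (by
      rintro _ ⟨v, rfl⟩
      rw [SetLike.mem_coe, LinearMap.mem_ker, TensorProduct.lift.tmul, halt]))
  have hp : ∀ g ∈ G, ∀ w, p (wedge2Map (natAct g) w) = natAct g (p w) := by
    intro g hg w
    have h1 : p ∘ₗ wedge2Map (natAct g) = natAct g ∘ₗ p :=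
      Submodule.linearMap_qext _ (TensorProduct.ext' fun x y => hm g hg x y)
    exact LinearMap.congr_fun h1 w
  have hsurj : LinearMap.range p = ⊤ := by
    refine (isIrred_iff.1 hirr _ ?_).resolve_left ?_
    · rintro g hg _ ⟨w, rfl⟩
      rw [← inv_inv g, ← natAct_eq_rowRep, ← hp _ (inv_mem hg)]
      exact ⟨_, rfl⟩
    · intro h
      obtain ⟨x, y, hxy⟩ := hne
      refine hxy ((Submodule.mem_bot F).1 (h ▸ ?_))
      exact ⟨Submodule.Quotient.mk (x ⊗ₜ y), rfl⟩
  refine ⟨LinearMap.ker p, p.quotKerEquivOfSurjective (LinearMap.range_eq_top.1 hsurj), ?_, hp⟩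
  rintro g hg _ ⟨w, hw, rfl⟩
  rw [LinearMap.mem_ker, hp g hg, LinearMap.mem_ker.1 hw, map_zero]

theorem IsESQ.mono {G H : Subgroup (GL (Fin 5) F)} (h : IsESQ G) (hle : H ≤ G) : IsESQ H := by
  obtain ⟨U, e, h1, h2⟩ := h
  exact ⟨U, e, fun g hg => h1 g (hle hg), fun g hg => h2 g (hle hg)⟩

theorem IsESQ.exists_isMinIrredESQ [Finite F] {G : Subgroup (GL (Fin 5) F)} (h : IsESQ G)
    (hirr : IsIrred G) : ∃ H : Subgroup (GL (Fin 5) F), IsMinIrredESQ H := by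
  obtain ⟨H, hH, hmin⟩ := WellFounded.has_min (wellFounded_lt (α := Subgroup (GL (Fin 5) F)))
    {H | H ≤ G ∧ IsIrred H} ⟨G, le_rfl, hirr⟩
  exact ⟨H, hH.2, h.mono hH.1, fun K hK hKirr => hmin K ⟨hK.le.trans hH.1, hKirr⟩ hK⟩

theorem exists_natAct_eq (f : (Fin 5 → F) ≃ₗ[F] (Fin 5 → F)) :
    ∃ g : GL (Fin 5) F, ∀ x, natAct g x = f x := by
  refine ⟨⟨(LinearMap.toMatrix' f.toLinearMap).transpose,
    (LinearMap.toMatrix' f.symm.toLinearMap).transpose, ?_, ?_⟩,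
    fun x => ?_⟩
  · rw [← Matrix.transpose_mul, ← LinearMap.toMatrix'_comp]
    simp
  · rw [← Matrix.transpose_mul, ← LinearMap.toMatrix'_comp]
    simp
  · change Matrix.vecMul x (LinearMap.toMatrix' f.toLinearMap).transpose = f x
    rw [Matrix.vecMul_transpose, LinearMap.toMatrix'_mulVec]
    rfl

/-- A five-dimensional alternating algebra whose automorphisms act irreducibly yields an irreducible
ESQ-group, hence a minimal one. -/
theorem exists_isMinIrredESQ_of_product [Finite F] {V : Type*} [AddCommGroup V] [Module F V]
    (hV : finrank F V = 5) {m : V →ₗ[F] V →ₗ[F] V} (halt : ∀ x, m x x = 0)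
    (hne : ∃ x y, m x y ≠ 0)
    (hirr : ∀ S : Submodule F V, (∀ f : V ≃ₗ[F] V, (∀ x y, m (f x) (f y) = f (m x y)) →
      ∀ x ∈ S, f x ∈ S) → S = ⊥ ∨ S = ⊤) :
    ∃ H : Subgroup (GL (Fin 5) F), IsMinIrredESQ H := by
  have : FiniteDimensional F V := Module.finite_of_finrank_pos (by omega)
  let c : V ≃ₗ[F] (Fin 5 → F) := LinearEquiv.ofFinrankEq _ _ (by simp [hV])
  let m' : (Fin 5 → F) →ₗ[F] (Fin 5 → F) →ₗ[F] (Fin 5 → F) :=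
    (m.compl₁₂ c.symm.toLinearMap c.symm.toLinearMap).compr₂ c.toLinearMap
  have hm' : ∀ x y, m' x y = c (m (c.symm x) (c.symm y)) := fun x y => rfl
  let G : Subgroup (GL (Fin 5) F) :=
    { carrier := {g | ∀ x y, m' (rowRep g x) (rowRep g y) = rowRep g (m' x y)}
      mul_mem' := fun {g h} hg hh x y => by
        rw [map_mul, LinearEquiv.mul_apply, LinearEquiv.mul_apply, LinearEquiv.mul_apply, hg, hh]
      one_mem' := fun x y => by rw [map_one]; rfl
      inv_mem' := fun {g} hg x y => by
        apply (rowRep g).injective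
        rw [← hg, ← LinearEquiv.mul_apply, ← LinearEquiv.mul_apply, ← LinearEquiv.mul_apply,
          ← map_mul, mul_inv_cancel, map_one]
        rfl }
  have hG : IsIrred G := by
    refine isIrred_iff.2 fun S hS => ?_
    have h1 := hirr (S.comap c.toLinearMap) fun f hf x hx => by
      obtain ⟨g, hg⟩ := exists_natAct_eq ((c.symm.trans f).trans c)
      have hg' : ∀ y, rowRep g⁻¹ y = c (f (c.symm y)) := fun y => by
        rw [← natAct_eq_rowRep, hg]
        rfl
      have h2 := hS g⁻¹ (fun x y => by
        rw [hm', hm', hg', hg', hg']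
        simp [hf]) (c x) hx
      rw [hg', LinearEquiv.symm_apply_apply] at h2
      exact h2
    refine h1.imp (fun h => ?_) fun h => ?_
    · rw [eq_bot_iff]
      intro x hx
      have h2 : c.symm x ∈ S.comap c.toLinearMap := by
        change c (c.symm x) ∈ S
        rwa [LinearEquiv.apply_symm_apply]
      rw [h, Submodule.mem_bot, LinearEquiv.map_eq_zero_iff] at h2
      exact h2
    · rw [eq_top_iff]
      intro x _
      have h2 : c.symm x ∈ S.comap c.toLinearMap := h ▸ Submodule.mem_top
      have h3 : c (c.symm x) ∈ S := h2
      rwa [LinearEquiv.apply_symm_apply] at h3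
  have hESQ : IsESQ G := by
    refine hG.isESQ (m := m') (fun x => by rw [hm', halt, map_zero]) ?_ fun g hg x y => ?_
    · obtain ⟨x, y, hxy⟩ := hne
      refine ⟨c x, c y, fun h => hxy ?_⟩
      rwa [hm', LinearEquiv.symm_apply_apply, LinearEquiv.symm_apply_apply,
        LinearEquiv.map_eq_zero_iff] at h
    · rw [natAct_eq_rowRep, natAct_eq_rowRep, natAct_eq_rowRep]
      exact inv_mem hg x y
  exact hESQ.exists_isMinIrredESQ hG

end Existence

theorem ZMod.exists_pow_add_pow_eq_one : ∀ a : ZMod 11, a ^ 5 = 1 → a ≠ 1 →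
    ∃ i j : Fin 5, a ^ (i : ℕ) + a ^ (j : ℕ) = 1 ∧ a ^ (i : ℕ) ≠ a ^ (j : ℕ) := by
  decide

section Examples

variable (F : Type*) [Field F] [Fintype F]

theorem exists_isMinIrredESQ_of_card_mod_eq_one (hq : Fintype.card F % 11 = 1) :
    ∃ H : Subgroup (GL (Fin 5) F), IsMinIrredESQ H := by
  classical
  have : Fact (Nat.Prime 11) := ⟨by norm_num⟩
  obtain ⟨z, hz⟩ := exists_prime_orderOf_dvd_card' (G := Fˣ) 11 (by
    rw [Nat.card_eq_fintype_card, Fintype.card_units]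
    omega)
  let c : Fin 5 → Fˣ := fun i => z ^ 3 ^ (i : ℕ)
  have hc : ∀ i, c (i + 1) * c (i + 2) = c i := by
    intro i
    simp only [c]
    rw [← pow_add, pow_inj_mod, hz]
    revert i
    decide
  have hcinj : ∀ i j, i ≠ j → (c i : F) ≠ c j := by
    intro i j hij h
    have h1 := Units.ext h
    simp only [c] at h1
    rw [pow_inj_mod, hz] at h1
    revert h1 hij
    clear * -
    revert i j
    decide
  let m : (Fin 5 → F) →ₗ[F] (Fin 5 → F) →ₗ[F] (Fin 5 → F) :=
    LinearMap.mk₂ F (fun x y i => x (i + 1) * y (i + 2) - x (i + 2) * y (i + 1))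
      (fun x x' y => by ext i; simp only [Pi.add_apply]; ring)
      (fun a x y => by ext i; simp only [Pi.smul_apply, smul_eq_mul]; ring)
      (fun x y y' => by ext i; simp only [Pi.add_apply]; ring)
      (fun a x y => by ext i; simp only [Pi.smul_apply, smul_eq_mul]; ring)
  have hm : ∀ x y i, m x y i = x (i + 1) * y (i + 2) - x (i + 2) * y (i + 1) :=
    fun x y i => rfl
  refine exists_isMinIrredESQ_of_product (V := Fin 5 → F) (by simp) (m := m) (fun x => ?_)
    ⟨Pi.single 1 1, Pi.single 2 1, fun h => ?_⟩ fun S hS => ?_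
  · ext i
    rw [hm, mul_comm, sub_self, Pi.zero_apply]
  · have := congrFun h 0
    rw [hm] at this
    simp at this
  · let f : (Fin 5 → F) ≃ₗ[F] (Fin 5 → F) :=
      LinearEquiv.piCongrRight fun i => LinearEquiv.smulOfNeZero F F (c i : F) (c i).ne_zero
    have hf : ∀ x i, f x i = c i * x i := fun x i => rfl
    let t : (Fin 5 → F) ≃ₗ[F] (Fin 5 → F) := LinearEquiv.funCongrLeft F F (Equiv.subRight 1)
    have ht : ∀ x i, t x i = x (i - 1) := fun x i => rfl
    refine eq_bot_or_eq_top_of_diag_of_shift (b := Pi.basisFun F (Fin 5))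
      (f := fun _ : Unit => f.toLinearMap) (chi := fun _ i => (c i : F)) (fun _ i => ?_)
      (fun i j hij => ⟨(), hcinj i j hij⟩) (T := t.toLinearMap) (τ := fun _ => 1)
      (fun _ => one_ne_zero) (fun i => ?_) (fun _ => hS f fun x y => ?_) (hS t fun x y => ?_)
    · ext j
      rw [LinearEquiv.coe_coe, hf, Pi.basisFun_apply, Pi.smul_apply, smul_eq_mul]
      by_cases h : j = i
      · rw [h]
      · rw [Pi.single_eq_of_ne h, mul_zero, mul_zero]
    · ext j
      rw [LinearEquiv.coe_coe, ht, Pi.basisFun_apply, Pi.basisFun_apply, one_smul,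
        Pi.single_apply, Pi.single_apply]
      simp only [sub_eq_iff_eq_add]
    · ext i
      rw [hm, hf, hf, hf, hf, hf, hm, ← hc i, Units.val_mul]
      ring
    · ext i
      have e1 : i + 1 - 1 = i - 1 + 1 := by abel
      have e2 : i + 2 - 1 = i - 1 + 2 := by abel
      rw [hm, ht, ht, ht, ht, ht, hm, e1, e2]

theorem exists_isMinIrredESQ_of_orderOf_eq_five
    (hq : orderOf (Fintype.card F : ZMod 11) = 5) :
    ∃ H : Subgroup (GL (Fin 5) F), IsMinIrredESQ H := by
  classical
  have : Fact (Nat.Prime 11) := ⟨by norm_num⟩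
  have hq5 : (Fintype.card F : ZMod 11) ^ 5 = 1 := by rw [← hq, pow_orderOf_eq_one]
  have hq1 : (Fintype.card F : ZMod 11) ≠ 1 := fun h => by
    rw [h, orderOf_one] at hq
    omega
  obtain ⟨p, hp⟩ := CharP.exists F
  have : Fact p.Prime := ⟨CharP.char_is_prime F p⟩
  let E := FiniteField.Extension F p 5
  have hfin : finrank F E = 5 := FiniteField.finrank_extension F p 5
  have : Finite E := Module.finite_of_finite F
  have := Fintype.ofFinite E
  have hcardE : Fintype.card E = Fintype.card F ^ 5 := by
    rw [← hfin]
    exact Module.card_eq_pow_finrank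
  obtain ⟨z, hz⟩ := exists_prime_orderOf_dvd_card' (G := Eˣ) 11 (by
    rw [Nat.card_eq_fintype_card, Fintype.card_units, hcardE]
    refine (Nat.modEq_iff_dvd' (Nat.one_le_pow _ _ Fintype.card_pos)).1 ?_
    rw [← ZMod.natCast_eq_natCast_iff, Nat.cast_pow, hq5, Nat.cast_one])
  have hzpow : ∀ r s : ℕ, (z : E) ^ r = (z : E) ^ s ↔ (r : ZMod 11) = (s : ZMod 11) := by
    intro r s
    rw [← Units.val_pow_eq_pow_val, ← Units.val_pow_eq_pow_val, ← Units.ext_iff, pow_inj_mod, hz,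
      ZMod.natCast_eq_natCast_iff']
  obtain ⟨i, j, hij, hne⟩ : ∃ i j : Fin 5,
      (Fintype.card F : ZMod 11) ^ (i : ℕ) + (Fintype.card F : ZMod 11) ^ (j : ℕ) = 1 ∧
      (Fintype.card F : ZMod 11) ^ (i : ℕ) ≠ (Fintype.card F : ZMod 11) ^ (j : ℕ) := by
    exact ZMod.exists_pow_add_pow_eq_one _ hq5 hq1
  let φ : E →ₗ[F] E := (FiniteField.frobeniusAlgHom F E).toLinearMap
  have hφ : ∀ (n : ℕ) x, (φ ^ n) x = x ^ Fintype.card F ^ n := by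
    intro n x
    induction n with
    | zero => simp
    | succ n ih =>
      rw [pow_succ', Module.End.mul_apply, ih, pow_succ, pow_mul]
      rfl
  let m : E →ₗ[F] E →ₗ[F] E :=
    (LinearMap.mul F E).compl₁₂ (φ ^ (i : ℕ)) (φ ^ (j : ℕ)) -
      (LinearMap.mul F E).compl₁₂ (φ ^ (j : ℕ)) (φ ^ (i : ℕ))
  have hm : ∀ x y, m x y = x ^ Fintype.card F ^ (i : ℕ) * y ^ Fintype.card F ^ (j : ℕ) -
      x ^ Fintype.card F ^ (j : ℕ) * y ^ Fintype.card F ^ (i : ℕ) := by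
    intro x y
    rw [← hφ, ← hφ, ← hφ, ← hφ]
    rfl
  refine exists_isMinIrredESQ_of_product hfin (m := m) (fun x => ?_) ⟨z, 1, fun h => ?_⟩
    fun S hS => ?_
  · rw [hm, mul_comm, sub_self]
  · rw [hm, one_pow, one_pow, mul_one, mul_one, sub_eq_zero, hzpow] at h
    push_cast at h
    exact hne h
  · have hzS : ∀ x ∈ S, (z : E) * x ∈ S := by
      have hz1 : (z : E) ^ Fintype.card F ^ (i : ℕ) * (z : E) ^ Fintype.card F ^ (j : ℕ) = z := by
        have := (hzpow (Fintype.card F ^ (i : ℕ) + Fintype.card F ^ (j : ℕ)) 1).2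
          (by push_cast; exact hij)
        rwa [pow_add, pow_one] at this
      let f : E ≃ₗ[F] E := (LinearEquiv.smulOfNeZero E E (z : E) z.ne_zero).restrictScalars F
      have hf : ∀ x, f x = z * x := fun x => rfl
      refine hS f fun x y => ?_
      rw [hm, hf, hf, hf, hm, mul_pow, mul_pow, mul_pow, mul_pow]
      linear_combination (x ^ Fintype.card F ^ (i : ℕ) * y ^ Fintype.card F ^ (j : ℕ) -
        x ^ Fintype.card F ^ (j : ℕ) * y ^ Fintype.card F ^ (i : ℕ)) * hz1
    have hadj : Algebra.adjoin F {(z : E)} = ⊤ := by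
      have := IntermediateField.isSimpleOrder_of_finrank_prime F E (by rw [hfin]; norm_num)
      rw [← IntermediateField.adjoin_simple_toSubalgebra_of_isAlgebraic
        (Algebra.IsAlgebraic.isAlgebraic _)]
      rcases eq_bot_or_eq_top (IntermediateField.adjoin F {(z : E)}) with h | h
      · exfalso
        obtain ⟨r, hr⟩ := IntermediateField.mem_bot.1
          (IntermediateField.adjoin_simple_eq_bot_iff.1 h)
        refine hq1 ?_
        have h1 := (hzpow (Fintype.card F) 1).1 (by
          rw [pow_one, ← hr, ← map_pow, FiniteField.pow_card])
        rwa [Nat.cast_one] at h1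
      · rw [h, IntermediateField.top_toSubalgebra]
    have hall : ∀ a : E, ∀ x ∈ S, a * x ∈ S := by
      intro a
      have ha : a ∈ Algebra.adjoin F {(z : E)} := hadj ▸ Algebra.mem_top
      induction ha using Algebra.adjoin_induction with
      | mem a ha => rwa [Set.mem_singleton_iff.1 ha]
      | algebraMap r =>
        intro x hx
        rw [← Algebra.smul_def]
        exact S.smul_mem r hx
      | add a b _ _ ha hb =>
        intro x hx
        rw [add_mul]
        exact S.add_mem (ha x hx) (hb x hx)
      | mul a b _ _ ha hb =>
        intro x hx
        rw [mul_assoc]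
        exact ha _ (hb x hx)
    rcases eq_or_ne S ⊥ with h | h
    · exact Or.inl h
    · obtain ⟨x, hx, hx0⟩ := S.ne_bot_iff.1 h
      refine Or.inr (eq_top_iff.2 fun y _ => ?_)
      have := hall (y * x⁻¹) x hx
      rwa [inv_mul_cancel_right₀ hx0] at this

end Examples

theorem stmt15 :
    -- classification of minimal irreducible ESQ-subgroups of `GL₅(F_q)`
    (∀ (F : Type) [Field F] [Fintype F] (G : Subgroup (GL (Fin 5) F)),
      IsMinIrredESQ G →
        (((¬ IsAbsIrred G) ∧ IsCyclic G ∧ Nat.card G = 11 ∧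
            orderOf ((Fintype.card F : ZMod 11)) = 5) ∨
          (IsAbsIrred G ∧ Nat.card G = 55 ∧ (¬ ∀ a b : G, a * b = b * a) ∧
            Fintype.card F % 11 = 1)) ∧
        -- in particular `G` is not a non-abelian simple group,
        ¬ ((¬ ∀ a b : G, a * b = b * a) ∧ IsSimpleGroup G) ∧
        -- and `11` divides `|G|`
        11 ∣ Nat.card G) ∧
    -- both possibilities occur: order `11` whenever `ord₁₁(q) = 5` …
    (∀ (F : Type) [Field F] [Fintype F],
      orderOf ((Fintype.card F : ZMod 11)) = 5 →
        ∃ H : Subgroup (GL (Fin 5) F), IsIrred H ∧ IsESQ H ∧ Nat.card H = 11) ∧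
    -- … and order `55` whenever `q ≡ 1 (mod 11)`
    (∀ (F : Type) [Field F] [Fintype F],
      Fintype.card F % 11 = 1 →
        ∃ H : Subgroup (GL (Fin 5) F), IsIrred H ∧ IsESQ H ∧ Nat.card H = 55) := by
  refine ⟨fun F _ _ G hG => ?_, fun F _ _ hq => ?_, fun F _ _ hq => ?_⟩
  · have h := hG.classification
    refine ⟨h, ?_, ?_⟩
    · rintro ⟨hne, hs⟩
      obtain ⟨m, H⟩ := hG.2.1.exists_isIrredAlt hG.1
      exact hne (H.mul_comm_of_isSimpleGroup G.subtype_injective)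
    · rcases h with h | h
      · rw [h.2.2.1]
      · rw [h.2.1]
        norm_num
  · obtain ⟨H, hH⟩ := exists_isMinIrredESQ_of_orderOf_eq_five F hq
    refine ⟨H, hH.1, hH.2.1, (hH.classification.resolve_right fun h => ?_).2.2.1⟩
    have h1 : (Fintype.card F : ZMod 11) = 1 := by
      rw [← Nat.cast_one, ZMod.natCast_eq_natCast_iff']
      exact h.2.2.2
    rw [h1, orderOf_one] at hq
    omega
  · obtain ⟨H, hH⟩ := exists_isMinIrredESQ_of_card_mod_eq_one F hq
    refine ⟨H, hH.1, hH.2.1, (hH.classification.resolve_left fun h => ?_).2.1⟩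
    have h1 : (Fintype.card F : ZMod 11) = 1 := by
      rw [← Nat.cast_one, ZMod.natCast_eq_natCast_iff']
      exact hq
    have h2 := h.2.2.2
    rw [h1, orderOf_one] at h2
    omega
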